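/- Let n ≥ 2 and let P ⊂ ℝ^n be a lattice polytope with non-empty interior whose centroid is at the origin. Let −γ_1(P), …, −γ_n(P) be the roots of the Ehrhart polynomial of P. Then Σ_{i=1}^n γ_i(P) < (n/2)·Σ_{i=1}^n λ_i(P, ℤ^n). -/

import Mathlib

open MeasureTheory Set Filter Pointwise RealInnerProductSpace
open scoped ENNReal

noncomputable section

namespace Paper

/-- Euclidean space `ℝ^n`. -/
abbrev Euc (n : ℕ) := EuclideanSpace ℝ (Fin n)

variable {n : ℕ}

/-- A convex body: a compact convex set with non-empty interior. -/
def IsConvexBody (K : Set (Euc n)) : Prop :=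
  Convex ℝ K ∧ IsCompact K ∧ (interior K).Nonempty

/-- The centroid of `K` lies at the origin, i.e. `∫_K x dx = 0`. -/
def CentroidAtOrigin (K : Set (Euc n)) : Prop :=
  (∫ x in K, x) = (0 : Euc n)

/-- The lattice generated by the family `b`. -/
def latticeOf (b : Fin n → Euc n) : Set (Euc n) :=
  {x | ∃ z : Fin n → ℤ, x = ∑ i, (z i : ℝ) • b i}

/-- The determinant of the lattice generated by `b`. -/
def latticeDet (b : Fin n → Euc n) : ℝ :=
  |Matrix.det (Matrix.of fun i j => b j i)|

/-- The integer lattice `ℤ^n` inside `ℝ^n`. -/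
def stdLattice (n : ℕ) : Set (Euc n) :=
  {x | ∀ i, ∃ m : ℤ, x i = (m : ℝ)}

/-- `succMin K Λ i` is the `i`-th successive minimum
`λ_i(K,Λ) = inf {t > 0 : t•K contains at least i linearly independent points of Λ}`. -/
def succMin (K Λ : Set (Euc n)) (i : ℕ) : ℝ :=
  sInf {t : ℝ | 0 < t ∧ ∃ v : Fin i → Euc n,
    LinearIndependent ℝ v ∧ ∀ j, v j ∈ Λ ∧ v j ∈ t • K}

/-- Surface area of a convex body, via the (outer) Minkowski content. -/
def surfaceArea (K : Set (Euc n)) : ℝ :=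
  limUnder (nhdsWithin (0 : ℝ) (Ioi 0)) fun ε =>
    ((volume (Metric.cthickening ε K)).toReal - (volume K).toReal) / ε

/-- The `k`-th elementary symmetric function of `ρ 0, …, ρ (n-1)`. -/
def esym (n k : ℕ) (ρ : Fin n → ℝ) : ℝ :=
  ∑ J ∈ Finset.powersetCard k (Finset.univ : Finset (Fin n)), ∏ i ∈ J, ρ i

/-- A rational polytope: convex hull of finitely many points with rational coordinates. -/
def IsRationalPolytope (P : Set (Euc n)) : Prop :=
  ∃ V : Finset (Euc n), (∀ v ∈ V, ∀ i, ∃ q : ℚ, v i = (q : ℝ)) ∧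
    P = convexHull ℝ (V : Set (Euc n))

/-- A lattice polytope: convex hull of finitely many points of `ℤ^n`. -/
def IsLatticePolytope (P : Set (Euc n)) : Prop :=
  ∃ V : Finset (Euc n), (∀ v ∈ V, v ∈ stdLattice n) ∧
    P = convexHull ℝ (V : Set (Euc n))

/-- `F` is a facet of `P`: an `(n-1)`-dimensional face cut out by a supporting hyperplane. -/
def IsFacet (P F : Set (Euc n)) : Prop :=
  ∃ (a : Euc n) (b : ℝ), a ≠ 0 ∧ (∀ x ∈ P, ⟪a, x⟫ ≤ b) ∧
    F = {x | x ∈ P ∧ ⟪a, x⟫ = b} ∧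
    Module.finrank ℝ (affineSpan ℝ F).direction = n - 1

/-- The determinant of a `k`-dimensional lattice `L ⊆ ℝ^n` (given as a set of points):
the square root of the Gram determinant of any ℤ-basis of `L`. -/
def sublatticeDetOf (k : ℕ) (L : Set (Euc n)) : ℝ :=
  sInf {d : ℝ | ∃ c : Fin k → Euc n, LinearIndependent ℝ c ∧
    L = {x | ∃ z : Fin k → ℤ, x = ∑ i, (z i : ℝ) • c i} ∧
    d = Real.sqrt (Matrix.det (Matrix.of fun i j => ⟪c i, c j⟫))}

/-- The lattice surface area
`lE_{n-1}(P) = (1/2) ∑_{F facet of P} vol_{n-1}(F) / det(aff₀(F) ∩ ℤ^n)`,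
where `vol_{n-1}` is realized by the `(n-1)`-dimensional Hausdorff measure. -/
def latticeSurfaceArea (P : Set (Euc n)) : ℝ :=
  (1/2) * ∑ᶠ F ∈ {F : Set (Euc n) | IsFacet P F},
    (μH[(n : ℝ) - 1] F).toReal /
      sublatticeDetOf (n - 1) (((affineSpan ℝ F).direction : Set (Euc n)) ∩ stdLattice n)

/-- `D_i(Λ)`: the minimal determinant of an `i`-dimensional sublattice of `Λ`. -/
def minSublatticeDet (Λ : Set (Euc n)) (i : ℕ) : ℝ :=
  sInf {d : ℝ | ∃ c : Fin i → Euc n, LinearIndependent ℝ c ∧ (∀ j, c j ∈ Λ) ∧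
    d = Real.sqrt (Matrix.det (Matrix.of fun k l => ⟪c k, c l⟫))}

/-- `D_min(Λ) = min {D_i(Λ)^(1/i) : 1 ≤ i ≤ n}`. -/
def Dmin (Λ : Set (Euc n)) : ℝ :=
  sInf {d : ℝ | ∃ i : Fin n, d = minSublatticeDet Λ ((i : ℕ) + 1) ^ ((1 : ℝ) / ((i : ℕ) + 1))}

/-- The polar lattice `Λ^⋆ = {x : ⟨x,y⟩ ∈ ℤ for all y ∈ Λ}`. -/
def polarLattice (Λ : Set (Euc n)) : Set (Euc n) :=
  {x | ∀ y ∈ Λ, ∃ m : ℤ, ⟪x, y⟫ = (m : ℝ)}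

/-- The standard cross-polytope `C_n^⋆ = conv{±e_1, …, ±e_n}`. -/
def crossPolytope (n : ℕ) : Set (Euc n) :=
  convexHull ℝ ((Set.range fun i : Fin n => EuclideanSpace.single i (1 : ℝ)) ∪
    (Set.range fun i : Fin n => -EuclideanSpace.single i (1 : ℝ)))

/-- The standard simplex `S_n = conv{0, e_1, …, e_n}`. -/
def stdSimplexSet (n : ℕ) : Set (Euc n) :=
  convexHull ℝ (insert 0 (Set.range fun i : Fin n => EuclideanSpace.single i (1 : ℝ)))

/-- The all-ones vector `𝟙 = (1,…,1)`. -/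
def allOnes (n : ℕ) : Euc n := WithLp.toLp 2 fun _ => (1 : ℝ)

/-- The simplex `T_n = -𝟙 + (n+1) S_n`. -/
def Tn (n : ℕ) : Set (Euc n) :=
  (fun x => ((n : ℝ) + 1) • x - allOnes n) '' stdSimplexSet n


lemma volr {X : Set ℝ} (hc : Convex ℝ X) (hn : X.Nonempty) (hb : Bornology.IsBounded X) :
    volume.real X = sSup X - sInf X := by
  have hba := hb.bddAbove
  have hbb := hb.bddBelow
  have hle : sInf X ≤ sSup X := csInf_le_csSup hn hbb hba
  have h1 : Ioo (sInf X) (sSup X) ⊆ X := IsConnected.Ioo_csInf_csSup_subset ⟨hn, hc.ordConnected.isPreconnected⟩ hbb hba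
  have h2 : X ⊆ Icc (sInf X) (sSup X) := fun x hx => ⟨csInf_le hbb hx, le_csSup hba hx⟩
  apply le_antisymm
  · have := measureReal_mono (μ := volume) h2 (by simp)
    simpa [Real.volume_real_Icc, hle] using this
  · have := measureReal_mono (μ := volume) h1 (hb.measure_lt_top.ne)
    simpa [Real.volume_real_Ioo, hle] using this

lemma bm1 {X Y Z : Set ℝ} (hX : Convex ℝ X) (hXn : X.Nonempty) (hXb : Bornology.IsBounded X)
    (hY : Convex ℝ Y) (hYn : Y.Nonempty) (hYb : Bornology.IsBounded Y)
    (hZ : Convex ℝ Z) (hZb : Bornology.IsBounded Z) {u : ℝ} (hu0 : 0 ≤ u) (hu1 : u ≤ 1)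
    (h : ∀ x ∈ X, ∀ y ∈ Y, (1 - u) * x + u * y ∈ Z) :
    (1 - u) * volume.real X + u * volume.real Y ≤ volume.real Z := by
  have hu1' : 0 ≤ 1 - u := by linarith
  have hZn : Z.Nonempty := ⟨_, h _ hXn.some_mem _ hYn.some_mem⟩
  rw [volr hX hXn hXb, volr hY hYn hYb, volr hZ hZn hZb]
  have hsub : (1 - u) • X + u • Y ⊆ Z := by
    rintro _ ⟨_, ⟨x, hx, rfl⟩, _, ⟨y, hy, rfl⟩, rfl⟩
    exact h x hx y hy
  have e1 : sSup ((1 - u) • X + u • Y) = (1 - u) * sSup X + u * sSup Y := by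
    rw [csSup_add (hXn.smul_set) ((hXb.smul₀ _).bddAbove) (hYn.smul_set) ((hYb.smul₀ _).bddAbove),
      Real.sSup_smul_of_nonneg hu1', Real.sSup_smul_of_nonneg hu0]
    simp
  have e2 : sInf ((1 - u) • X + u • Y) = (1 - u) * sInf X + u * sInf Y := by
    rw [csInf_add (hXn.smul_set) ((hXb.smul₀ _).bddBelow) (hYn.smul_set) ((hYb.smul₀ _).bddBelow),
      Real.sInf_smul_of_nonneg hu1', Real.sInf_smul_of_nonneg hu0]
    simp
  have hne : ((1 - u) • X + u • Y).Nonempty := (hXn.smul_set).add (hYn.smul_set)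
  have f1 := csSup_le_csSup hZb.bddAbove hne hsub
  have f2 := csInf_le_csInf hZb.bddBelow hne hsub
  rw [e1] at f1; rw [e2] at f2
  linarith

/-- final algebra for BBL -/
lemma persp {D : ℕ} {u a b x y C : ℝ} (hu0 : 0 ≤ u) (hu1 : u ≤ 1) (ha : 0 < a) (hb : 0 < b)
    (hx : 0 ≤ x) (hy : 0 ≤ y) (hC : C = (1 - u) * a + u * b) :
    ((1 - u) * x + u * y) ^ (D + 1) ≤
      C ^ D * ((1 - u) * (x ^ (D + 1) / a ^ D) + u * (y ^ (D + 1) / b ^ D)) := by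
  have hCp : 0 < C := by
    rw [hC]
    rcases eq_or_lt_of_le hu0 with h | h
    · subst h; simpa using ha
    · have : 0 ≤ (1 - u) * a := mul_nonneg (by linarith) ha.le
      have : 0 < u * b := mul_pos h hb
      linarith
  have w1 : 0 ≤ (1 - u) * a / C := div_nonneg (mul_nonneg (by linarith) ha.le) hCp.le
  have w2 : 0 ≤ u * b / C := by positivity
  have w3 : (1 - u) * a / C + u * b / C = 1 := by rw [← add_div, ← hC, div_self hCp.ne']
  have m1 : x / a ∈ Ici (0 : ℝ) := by simp only [mem_Ici]; positivity
  have m2 : y / b ∈ Ici (0 : ℝ) := by simp only [mem_Ici]; positivity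
  have hj := (convexOn_pow (𝕜 := ℝ) (D + 1)).2 m1 m2 w1 w2 w3
  simp only [smul_eq_mul] at hj
  have e1 : (1 - u) * a / C * (x / a) + u * b / C * (y / b) = ((1 - u) * x + u * y) / C := by
    field_simp
  rw [e1, div_pow, div_le_iff₀ (by positivity)] at hj
  refine hj.trans (le_of_eq ?_)
  rw [div_pow, div_pow]
  field_simp

  ring

/-- power-concave density -/
def Fx {X : Type*} (S : Set X) (g : X → ℝ) (D : ℕ) : X → ℝ := S.indicator (fun x => g x ^ D)

/-- one-dimensional slice data -/
structure Sl (A : Set ℝ) (γ : ℝ → ℝ) (M : ℝ) : Prop where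
  bdd : Bornology.IsBounded A
  conc : ConcaveOn ℝ A γ
  nn : ∀ x ∈ A, 0 ≤ γ x
  le : ∀ x ∈ A, γ x ≤ M
  meas : Measurable (A.indicator γ)

lemma Sl.conv {A : Set ℝ} {γ : ℝ → ℝ} {M : ℝ} (h : Sl A γ M) : Convex ℝ A := h.conc.1

lemma Sl.measA {A : Set ℝ} {γ : ℝ → ℝ} {M : ℝ} (h : Sl A γ M) : MeasurableSet A :=
  h.conv.ordConnected.measurableSet

lemma Fx_eq {X : Type*} (S : Set X) (g : X → ℝ) (D : ℕ) (x : X) :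
    Fx S g D x = S.indicator 1 x * (S.indicator g x) ^ D := by
  unfold Fx
  by_cases hx : x ∈ S <;> simp [hx]

lemma Fx_succ {X : Type*} (S : Set X) (g : X → ℝ) {D : ℕ} (hD : D ≠ 0) (x : X) :
    Fx S g D x = (S.indicator g x) ^ D := by
  unfold Fx
  by_cases hx : x ∈ S <;> simp [hx, hD]

lemma Fx_meas {X : Type*} [MeasurableSpace X] {S : Set X} {g : X → ℝ} (hS : MeasurableSet S)
    (hg : Measurable (S.indicator g)) (D : ℕ) : Measurable (Fx S g D) := by
  have : Fx S g D = fun x => S.indicator 1 x * (S.indicator g x) ^ D := funext (Fx_eq S g D)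
  rw [this]
  exact (measurable_one.indicator hS).mul (hg.pow_const D)

lemma Fx_nn {X : Type*} {S : Set X} {g : X → ℝ} (D : ℕ) (h : ∀ x ∈ S, 0 ≤ g x) (x : X) :
    0 ≤ Fx S g D x := by
  unfold Fx
  by_cases hx : x ∈ S
  · simpa [hx] using pow_nonneg (h x hx) D
  · simp [hx]

lemma Fx_le {X : Type*} {S : Set X} {g : X → ℝ} (D : ℕ) {M : ℝ} (h : ∀ x ∈ S, 0 ≤ g x)
    (h2 : ∀ x ∈ S, g x ≤ M) (hM : 0 ≤ M) (x : X) :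
    Fx S g D x ≤ M ^ D := by
  unfold Fx
  by_cases hx : x ∈ S
  · simpa [hx] using pow_le_pow_left₀ (h x hx) (h2 x hx) D
  · simpa [hx] using pow_nonneg hM D

lemma Fx_int {X : Type*} [MeasurableSpace X] {μ : Measure X} {S : Set X} {g : X → ℝ} {M : ℝ}
    (hS : MeasurableSet S) (hf : μ S ≠ ⊤)
    (hg : Measurable (S.indicator g)) (D : ℕ) (h : ∀ x ∈ S, 0 ≤ g x)
    (h2 : ∀ x ∈ S, g x ≤ M) : Integrable (Fx S g D) μ := by
  have hm := Fx_meas hS hg D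
  have : Integrable (S.indicator (Fx S g D)) μ := by
    rw [integrable_indicator_iff hS]
    refine IntegrableOn.of_bound hf.lt_top hm.aestronglyMeasurable (|M| ^ D) ?_
    refine Eventually.of_forall fun x => ?_
    rw [Real.norm_of_nonneg (Fx_nn D h x)]
    exact Fx_le D h (fun x hx => (h2 x hx).trans (le_abs_self M)) (abs_nonneg M) x
  convert this using 1
  ext x
  by_cases hx : x ∈ S <;> simp [hx, Fx]

lemma Sl.int {A : Set ℝ} {γ : ℝ → ℝ} {M : ℝ} (h : Sl A γ M) (D : ℕ) : Integrable (Fx A γ D) :=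
  Fx_int h.measA h.bdd.measure_lt_top.ne h.meas D h.nn h.le

lemma lev {A : Set ℝ} {γ : ℝ → ℝ} {M : ℝ} (h : Sl A γ M) {D : ℕ} (hD : D ≠ 0) {a : ℝ} (ha : 0 < a) :
    ENNReal.ofReal ((∫ x, Fx A γ D x) / a ^ D) =
      ENNReal.ofReal D * ∫⁻ t in Ioi 0, volume {x ∈ A | a * t ≤ γ x} *
        ENNReal.ofReal (t ^ ((D : ℝ) - 1)) := by
  have h0 : ∀ x, 0 ≤ A.indicator γ x := fun x => indicator_nonneg h.nn x
  have key := lintegral_rpow_eq_lintegral_meas_le_mul (μ := volume) (f := fun x => A.indicator γ x / a)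
    (Eventually.of_forall fun x => by have := h0 x; simp only [Pi.zero_apply]; positivity)
    (h.meas.div_const a).aemeasurable (p := (D : ℝ)) (by positivity)
  have e1 : (∫ x, Fx A γ D x) / a ^ D = ∫ x, Fx A γ D x / a ^ D := by rw [integral_div]
  rw [e1, ofReal_integral_eq_lintegral_ofReal ((h.int D).div_const _)
    (Eventually.of_forall fun x => by
      have := Fx_nn D h.nn x; simp only [Pi.zero_apply]; positivity)]
  have e2 : ∀ x, Fx A γ D x / a ^ D = (A.indicator γ x / a) ^ (D : ℝ) := by
    intro x
    rw [Fx_succ _ _ hD, Real.rpow_natCast, div_pow]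
  simp only [e2]
  rw [key]
  congr 1
  refine setLIntegral_congr_fun measurableSet_Ioi ?_
  intro t ht
  simp only [mem_Ioi] at ht
  simp only []
  congr 2
  ext x
  simp only [mem_ofPred_eq]
  rw [le_div_iff₀ ha, mul_comm t a]
  by_cases hx : x ∈ A
  · simp [hx]
  · have : 0 < a * t := by positivity
    simp [hx, this]

lemma bbl_pos {D : ℕ} (hD : D ≠ 0) {A0 A1 Z : Set ℝ} {γ0 γ1 γ : ℝ → ℝ} {M0 M1 M a b : ℝ}
    (h0 : Sl A0 γ0 M0) (h1 : Sl A1 γ1 M1) (hZ : Sl Z γ M)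
    {u : ℝ} (hu0 : 0 < u) (hu1 : u < 1)
    (h : ∀ s ∈ A0, ∀ t ∈ A1, (1 - u) * s + u * t ∈ Z ∧
      (1 - u) * γ0 s + u * γ1 t ≤ γ ((1 - u) * s + u * t))
    (ha : 0 < a) (hb : 0 < b) (ha1 : ∀ x ∈ A0, γ0 x ≤ a) (hb1 : ∀ x ∈ A1, γ1 x ≤ b)
    (ha2 : ∀ c < a, ∃ x ∈ A0, c < γ0 x) (hb2 : ∀ c < b, ∃ x ∈ A1, c < γ1 x)
     :
    ((1 - u) * a + u * b) ^ D * ((1 - u) * ((∫ x, Fx A0 γ0 D x) / a ^ D) +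
      u * ((∫ x, Fx A1 γ1 D x) / b ^ D)) ≤ ∫ x, Fx Z γ D x := by
  set C := (1 - u) * a + u * b with hC
  have hu1' : 0 < 1 - u := by linarith
  have hCp : 0 < C := by positivity
  have i0 : 0 ≤ ∫ x, Fx A0 γ0 D x := integral_nonneg (Fx_nn D h0.nn)
  have i1 : 0 ≤ ∫ x, Fx A1 γ1 D x := integral_nonneg (Fx_nn D h1.nn)
  have iZ : 0 ≤ ∫ x, Fx Z γ D x := integral_nonneg (Fx_nn D hZ.nn)
  suffices hs : (1 - u) * ((∫ x, Fx A0 γ0 D x) / a ^ D) +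
      u * ((∫ x, Fx A1 γ1 D x) / b ^ D) ≤ (∫ x, Fx Z γ D x) / C ^ D by
    rw [le_div_iff₀ (by positivity)] at hs
    linarith
  rw [← ENNReal.ofReal_le_ofReal_iff (by positivity), ENNReal.ofReal_add (by positivity) (by positivity),
    ENNReal.ofReal_mul hu1'.le, ENNReal.ofReal_mul hu0.le, lev h0 hD ha, lev h1 hD hb, lev hZ hD hCp]
  rw [mul_left_comm, mul_left_comm (ENNReal.ofReal u), ← mul_add]
  gcongr
  refine (add_le_add (lintegral_const_mul_le _ _) (lintegral_const_mul_le _ _)).trans ?_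
  refine (le_lintegral_add _ _).trans ?_
  refine setLIntegral_mono_ae' measurableSet_Ioi ?_
  have hne : ∀ᵐ t : ℝ, t ≠ 1 := by
    simp [ae_iff]
  filter_upwards [hne] with t ht1 ht
  simp only [mem_Ioi] at ht
  rw [← mul_assoc, ← mul_assoc, ← add_mul]
  gcongr
  have b0 : Bornology.IsBounded {x ∈ A0 | a * t ≤ γ0 x} := h0.bdd.subset (sep_subset _ _)
  have b1 : Bornology.IsBounded {x ∈ A1 | b * t ≤ γ1 x} := h1.bdd.subset (sep_subset _ _)
  have bZ : Bornology.IsBounded {x ∈ Z | C * t ≤ γ x} := hZ.bdd.subset (sep_subset _ _)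
  rcases lt_or_gt_of_ne ht1 with ht1 | ht1
  · have n0 : {x ∈ A0 | a * t ≤ γ0 x}.Nonempty := by
      obtain ⟨x, hx, hx2⟩ := ha2 (a * t) (by nlinarith)
      exact ⟨x, hx, hx2.le⟩
    have n1 : {x ∈ A1 | b * t ≤ γ1 x}.Nonempty := by
      obtain ⟨x, hx, hx2⟩ := hb2 (b * t) (by nlinarith)
      exact ⟨x, hx, hx2.le⟩
    have := bm1 (h0.conc.convex_ge _) n0 b0 (h1.conc.convex_ge _) n1 b1 (hZ.conc.convex_ge (C * t)) bZ
      hu0.le hu1.le (by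
        rintro x ⟨hx, hx2⟩ y ⟨hy, hy2⟩
        obtain ⟨k1, k2⟩ := h x hx y hy
        refine ⟨k1, le_trans ?_ k2⟩
        rw [hC]
        nlinarith)
    rw [← ofReal_measureReal b0.measure_lt_top.ne, ← ofReal_measureReal b1.measure_lt_top.ne,
      ← ofReal_measureReal bZ.measure_lt_top.ne, ← ENNReal.ofReal_mul hu1'.le,
      ← ENNReal.ofReal_mul hu0.le, ← ENNReal.ofReal_add (by positivity) (by positivity)]
    exact ENNReal.ofReal_le_ofReal this
  · have e0 : {x ∈ A0 | a * t ≤ γ0 x} = ∅ := by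
      ext x; simp only [mem_ofPred_eq, mem_empty_iff_false, iff_false, not_and, not_le]
      intro hx; have := ha1 x hx; nlinarith
    have e1 : {x ∈ A1 | b * t ≤ γ1 x} = ∅ := by
      ext x; simp only [mem_ofPred_eq, mem_empty_iff_false, iff_false, not_and, not_le]
      intro hx; have := hb1 x hx; nlinarith
    rw [e0, e1]; simp

/-- degenerate case -/
lemma bbl_deg {D : ℕ} {A1 Z : Set ℝ} {γ1 γ : ℝ → ℝ} {M1 M : ℝ}
    (h1 : Sl A1 γ1 M1) (hZ : Sl Z γ M)
    {u c : ℝ} (hu0 : 0 < u)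
    (h : ∀ t ∈ A1, c + u * t ∈ Z ∧ u * γ1 t ≤ γ (c + u * t)) :
    u ^ (D + 1) * (∫ x, Fx A1 γ1 D x) ≤ ∫ x, Fx Z γ D x := by
  have e1 : ∫ x, Fx Z γ D (c + u * x) = u⁻¹ * ∫ x, Fx Z γ D x := by
    have := Measure.integral_comp_mul_left (fun x => Fx Z γ D (c + x)) u
    rw [this, integral_add_left_eq_self (fun x => Fx Z γ D x) c]
    simp [abs_of_pos hu0]
  have hi : Integrable (fun x => Fx Z γ D (c + u * x)) :=
    ((hZ.int D).comp_add_left c).comp_mul_left' hu0.ne'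
  have : ∫ x, u ^ D * Fx A1 γ1 D x ≤ ∫ x, Fx Z γ D (c + u * x) := by
    refine integral_mono ((h1.int D).const_mul _) hi ?_
    intro x
    by_cases hx : x ∈ A1
    · obtain ⟨k1, k2⟩ := h x hx
      have := pow_le_pow_left₀ (mul_nonneg hu0.le (h1.nn x hx)) k2 D
      simpa [Fx, hx, k1, mul_pow] using this
    · have := Fx_nn D hZ.nn (c + u * x)
      simpa [Fx, hx] using this
  rw [integral_const_mul, e1] at this
  rw [pow_succ']
  have := mul_le_mul_of_nonneg_left this hu0.le
  rwa [← mul_assoc, ← mul_assoc, mul_inv_cancel₀ hu0.ne', one_mul] at this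

lemma bbl (D : ℕ) {A0 A1 Z : Set ℝ} {γ0 γ1 γ : ℝ → ℝ} {M0 M1 M : ℝ}
    (h0 : Sl A0 γ0 M0) (h1 : Sl A1 γ1 M1) (hZ : Sl Z γ M) (n0 : A0.Nonempty) (n1 : A1.Nonempty)
    {u : ℝ} (hu0 : 0 < u) (hu1 : u < 1)
    (h : ∀ s ∈ A0, ∀ t ∈ A1, (1 - u) * s + u * t ∈ Z ∧
      (1 - u) * γ0 s + u * γ1 t ≤ γ ((1 - u) * s + u * t))
    {x y : ℝ} (hx : 0 ≤ x) (hy : 0 ≤ y) (hx1 : x ^ (D + 1) = ∫ x, Fx A0 γ0 D x)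
    (hy1 : y ^ (D + 1) = ∫ x, Fx A1 γ1 D x) :
    ((1 - u) * x + u * y) ^ (D + 1) ≤ ∫ x, Fx Z γ D x := by
  have hu1' : 0 < 1 - u := by linarith
  rcases Nat.eq_zero_or_pos D with rfl | hD
  · have e : ∀ (A : Set ℝ) (g : ℝ → ℝ), MeasurableSet A → ∫ x, Fx A g 0 x = volume.real A := by
      intro A g hA
      simp only [Fx, pow_zero]
      rw [integral_indicator hA]; simp
    rw [e _ _ h0.measA] at hx1; rw [e _ _ h1.measA] at hy1; rw [e _ _ hZ.measA]
    simp only [zero_add, pow_one] at hx1 hy1 ⊢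
    rw [hx1, hy1]
    exact bm1 h0.conv n0 h0.bdd h1.conv n1 h1.bdd hZ.conv hZ.bdd hu0.le hu1.le
      (fun x hx y hy => (h x hx y hy).1)
  · have hD' : D ≠ 0 := hD.ne'
    have B0 : BddAbove (γ0 '' A0) := ⟨M0, by rintro _ ⟨z, hz, rfl⟩; exact h0.le z hz⟩
    have B1 : BddAbove (γ1 '' A1) := ⟨M1, by rintro _ ⟨z, hz, rfl⟩; exact h1.le z hz⟩
    set a := sSup (γ0 '' A0) with ha
    set b := sSup (γ1 '' A1) with hb
    have ha1 : ∀ z ∈ A0, γ0 z ≤ a := fun z hz => le_csSup B0 (mem_image_of_mem _ hz)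
    have hb1 : ∀ z ∈ A1, γ1 z ≤ b := fun z hz => le_csSup B1 (mem_image_of_mem _ hz)
    obtain ⟨s0, hs0⟩ := n0
    obtain ⟨t0, ht0⟩ := n1
    have hapos : 0 ≤ a := (h0.nn s0 hs0).trans (ha1 s0 hs0)
    have hbpos : 0 ≤ b := (h1.nn t0 ht0).trans (hb1 t0 ht0)
    have zero : ∀ {A : Set ℝ} {g : ℝ → ℝ} {M : ℝ}, Sl A g M → (∀ z ∈ A, g z ≤ 0) →
        ∫ x, Fx A g D x = 0 := by
      intro A g M hA hz
      have : Fx A g D = 0 := by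
        ext z
        by_cases hzA : z ∈ A
        · have : g z = 0 := le_antisymm (hz z hzA) (hA.nn z hzA)
          simp [Fx, hzA, this, hD']
        · simp [Fx, hzA]
      rw [this]; simp
    rcases hapos.eq_or_lt with ha0 | ha0
    · rw [zero h0 (fun z hz => by rw [ha0]; exact ha1 z hz)] at hx1
      have : x = 0 := by simpa using hx1
      rw [this, mul_zero, zero_add, mul_pow, hy1]
      refine bbl_deg h1 hZ hu0 (c := (1 - u) * s0) (fun t ht => ⟨(h s0 hs0 t ht).1, ?_⟩)
      refine le_trans ?_ (h s0 hs0 t ht).2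
      have := mul_nonneg hu1'.le (h0.nn s0 hs0)
      linarith
    rcases hbpos.eq_or_lt with hb0 | hb0
    · rw [zero h1 (fun z hz => by rw [hb0]; exact hb1 z hz)] at hy1
      have : y = 0 := by simpa using hy1
      rw [this, mul_zero, add_zero, mul_pow, hx1]
      refine bbl_deg h0 hZ hu1' (c := u * t0) (fun t ht => ?_)
      have k := h t ht t0 ht0
      rw [add_comm (u * t0)]
      refine ⟨k.1, le_trans ?_ k.2⟩
      have := mul_nonneg hu0.le (h1.nn t0 ht0)
      linarith
    have := persp (D := D) hu0.le hu1.le ha0 hb0 hx hy rfl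
    refine this.trans ?_
    rw [hx1, hy1]
    refine bbl_pos hD' h0 h1 hZ hu0 hu1 h ha0 hb0 ha1 hb1 ?_ ?_
    · intro c hc
      obtain ⟨_, ⟨z, hz, rfl⟩, hz2⟩ := exists_lt_of_lt_csSup (Set.Nonempty.image _ ⟨s0, hs0⟩) hc
      exact ⟨z, hz, hz2⟩
    · intro c hc
      obtain ⟨_, ⟨z, hz, rfl⟩, hz2⟩ := exists_lt_of_lt_csSup (Set.Nonempty.image _ ⟨t0, ht0⟩) hc
      exact ⟨z, hz, hz2⟩

/-- cons of a coordinate -/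
def cn {d : ℕ} (t : ℝ) (y : Fin d → ℝ) : Fin (d + 1) → ℝ := Fin.cons t y

@[simp] lemma cn_zero {d : ℕ} (t : ℝ) (y : Fin d → ℝ) : cn t y 0 = t := rfl
@[simp] lemma cn_succ {d : ℕ} (t : ℝ) (y : Fin d → ℝ) (i : Fin d) : cn t y i.succ = y i := rfl

lemma cn_comb {d : ℕ} (a b s t : ℝ) (x y : Fin d → ℝ) :
    a • cn s x + b • cn t y = cn (a * s + b * t) (a • x + b • y) := by
  ext i
  refine Fin.cases ?_ (fun j => ?_) i <;> simp

lemma cn_smul {d : ℕ} (a s : ℝ) (x : Fin d → ℝ) :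
    a • cn s x = cn (a * s) (a • x) := by
  ext i
  refine Fin.cases ?_ (fun j => ?_) i <;> simp

lemma cn_self {d : ℕ} (x : Fin (d + 1) → ℝ) : cn (x 0) (fun i => x i.succ) = x := by
  ext i
  refine Fin.cases ?_ (fun j => ?_) i <;> simp

lemma cn_cont {d : ℕ} : Continuous (fun p : ℝ × (Fin d → ℝ) => cn p.1 p.2) := by
  refine continuous_pi fun i => ?_
  refine Fin.cases ?_ (fun j => ?_) i
  · simpa using continuous_fst
  · exact (continuous_apply j).comp continuous_snd

lemma cn_equiv {d : ℕ} : (fun p : ℝ × (Fin d → ℝ) => cn p.1 p.2) =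
      ⇑(MeasurableEquiv.piFinSuccAbove (fun _ : Fin (d + 1) => ℝ) 0).symm := by
  ext p i
  refine Fin.cases ?_ (fun j => ?_) i <;> simp [MeasurableEquiv.piFinSuccAbove]

lemma fub_mp {d : ℕ} : MeasurePreserving
    (fun p : ℝ × (Fin d → ℝ) => cn p.1 p.2) (volume.prod volume) volume := by
  have h := (volume_preserving_piFinSuccAbove (fun _ : Fin (d + 1) => ℝ) 0).symm
  have e : (fun p : ℝ × (Fin d → ℝ) => cn p.1 p.2) =
      ⇑(MeasurableEquiv.piFinSuccAbove (fun _ : Fin (d + 1) => ℝ) 0).symm := cn_equiv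
  rw [e]
  exact h

lemma fub_emb {d : ℕ} : MeasurableEmbedding (fun p : ℝ × (Fin d → ℝ) => cn p.1 p.2) := by
  have := (MeasurableEquiv.piFinSuccAbove (fun _ : Fin (d + 1) => ℝ) 0).symm.measurableEmbedding
  rw [cn_equiv]
  exact this

lemma fub_int {d : ℕ} {F : (Fin (d + 1) → ℝ) → ℝ} (hF : Integrable F) :
    Integrable (fun p : ℝ × (Fin d → ℝ) => F (cn p.1 p.2)) (volume.prod volume) :=
  (fub_mp.integrable_comp_emb fub_emb).2 hF

lemma fub {d : ℕ} {F : (Fin (d + 1) → ℝ) → ℝ} (hF : Integrable F) :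
    ∫ x, F x = ∫ y, ∫ t, F (cn t y) := by
  rw [← integral_prod_symm _ (fub_int hF)]
  exact (fub_mp.integral_comp fub_emb F).symm

/-- good data -/
structure Good {d : ℕ} (S : Set (Fin d → ℝ)) (g : (Fin d → ℝ) → ℝ) (M : ℝ) : Prop where
  cpt : IsCompact S
  zero : S ∈ nhds 0
  conc : ConcaveOn ℝ S g
  nn : ∀ x ∈ S, 0 ≤ g x
  le : ∀ x ∈ S, g x ≤ M
  one : 1 ≤ M
  meas : Measurable (S.indicator g)

lemma Good.conv {d : ℕ} {S : Set (Fin d → ℝ)} {g : (Fin d → ℝ) → ℝ} {M : ℝ} (h : Good S g M) :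
  Convex ℝ S := h.conc.1

lemma Good.fmeas {d : ℕ} {S : Set (Fin d → ℝ)} {g : (Fin d → ℝ) → ℝ} {M : ℝ} (h : Good S g M)
    (D : ℕ) : Measurable (Fx S g D) := Fx_meas h.cpt.measurableSet h.meas D

lemma Good.int {d : ℕ} {S : Set (Fin d → ℝ)} {g : (Fin d → ℝ) → ℝ} {M : ℝ} (h : Good S g M)
    (D : ℕ) : Integrable (Fx S g D) :=
  Fx_int h.cpt.measurableSet h.cpt.measure_lt_top.ne h.meas D h.nn h.le

lemma Good.one' {d : ℕ} {S : Set (Fin d → ℝ)} {g : (Fin d → ℝ) → ℝ} {M : ℝ} (h : Good S g M) :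
    Good S (fun _ => 1) 1 where
  cpt := h.cpt
  zero := h.zero
  conc := concaveOn_const _ h.conv
  nn := by intros; norm_num
  le := by intros; norm_num
  one := le_rfl
  meas := measurable_const.indicator h.cpt.measurableSet

lemma Good.mem0 {d : ℕ} {S : Set (Fin d → ℝ)} {g : (Fin d → ℝ) → ℝ} {M : ℝ} (h : Good S g M) :
    0 ∈ S := mem_of_mem_nhds h.zero

lemma Good.smul_sub {d : ℕ} {S : Set (Fin d → ℝ)} {g : (Fin d → ℝ) → ℝ} {M : ℝ} (h : Good S g M)
    {r : ℝ} (h0 : 0 ≤ r) (h1 : r ≤ 1) : r • S ⊆ S := by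
  rintro _ ⟨x, hx, rfl⟩
  exact h.conv.smul_mem_of_zero_mem h.mem0 hx ⟨h0, h1⟩

lemma Good.smul {d : ℕ} {S : Set (Fin d → ℝ)} {g : (Fin d → ℝ) → ℝ} {M : ℝ} (h : Good S g M)
    {r : ℝ} (h0 : 0 < r) (h1 : r ≤ 1) : Good (r • S) g M where
  cpt := h.cpt.smul r
  zero := by
    have := smul_mem_nhds_smul₀ h0.ne' h.zero
    simpa using this
  conc := h.conc.subset (h.smul_sub h0.le h1) (h.conv.smul r)
  nn := fun x hx => h.nn x (h.smul_sub h0.le h1 hx)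
  le := fun x hx => h.le x (h.smul_sub h0.le h1 hx)
  one := h.one
  meas := by
    have : (r • S).indicator g = (r • S).indicator (S.indicator g) := by
      rw [indicator_indicator, inter_eq_left.2 (h.smul_sub h0.le h1)]
    rw [this]
    exact h.meas.indicator (h.cpt.smul r).measurableSet

/-- projection -/
def mS {d : ℕ} (S : Set (Fin (d + 1) → ℝ)) : Set (Fin d → ℝ) := {y | ∃ t, cn t y ∈ S}

/-- root of marginal -/
def mg {d : ℕ} (S : Set (Fin (d + 1) → ℝ)) (g : (Fin (d + 1) → ℝ) → ℝ) (D : ℕ) : (Fin d → ℝ) → ℝ :=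
  fun y => (∫ t, Fx S g D (cn t y)) ^ (((D + 1 : ℕ) : ℝ)⁻¹)

/-- slice -/
def sl {d : ℕ} (S : Set (Fin (d + 1) → ℝ)) (y : Fin d → ℝ) : Set ℝ := {t | cn t y ∈ S}

lemma Fx_sl {d : ℕ} (S : Set (Fin (d + 1) → ℝ)) (g : (Fin (d + 1) → ℝ) → ℝ) (D : ℕ)
    (y : Fin d → ℝ) (t : ℝ) : Fx S g D (cn t y) = Fx (sl S y) (fun t => g (cn t y)) D t := rfl

lemma bdd_coord {d : ℕ} {S : Set (Fin d → ℝ)} (h : IsCompact S) :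
    ∃ R : ℝ, 0 < R ∧ ∀ x ∈ S, ∀ i, |x i| ≤ R := by
  obtain ⟨R, hR⟩ := h.isBounded.exists_norm_le
  refine ⟨max R 1, by positivity, fun x hx i => ?_⟩
  exact (norm_le_pi_norm x i).trans ((hR x hx).trans (le_max_left _ _))

section
variable {d : ℕ} {S : Set (Fin (d + 1) → ℝ)} {g : (Fin (d + 1) → ℝ) → ℝ} {M : ℝ}

lemma sl_sub {R : ℝ} (hR : ∀ x ∈ S, ∀ i, |x i| ≤ R) (y : Fin d → ℝ) : sl S y ⊆ Icc (-R) R := by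
  intro t ht
  have := hR _ ht 0
  exact abs_le.1 this

lemma Good.sl (h : Good S g M) (y : Fin d → ℝ) : Sl (sl S y) (fun t => g (cn t y)) M where
  bdd := by
    obtain ⟨R, _, hR⟩ := bdd_coord h.cpt
    exact (Metric.isBounded_Icc (-R) R).subset (sl_sub hR y)
  conc := by
    have e : ∀ (a b s t : ℝ), a + b = 1 → cn (a * s + b * t) y = a • cn s y + b • cn t y := by
      intro a b s t hab
      rw [cn_comb, ← add_smul, hab, one_smul]
    refine ⟨?_, ?_⟩
    · intro s hs t ht a b ha hb hab
      change cn (a * s + b * t) y ∈ S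
      rw [e a b s t hab]
      exact h.conv hs ht ha hb hab
    · intro s hs t ht a b ha hb hab
      change a • g (cn s y) + b • g (cn t y) ≤ g (cn (a * s + b * t) y)
      rw [e a b s t hab]
      exact h.conc.2 hs ht ha hb hab
  nn := fun t ht => h.nn _ ht
  le := fun t ht => h.le _ ht
  meas := by
    have : (Paper.sl S y).indicator (fun t => g (cn t y)) = fun t => S.indicator g (cn t y) := rfl
    rw [this]
    exact h.meas.comp (cn_cont.measurable.comp (measurable_id.prodMk measurable_const))

lemma marg_zero (D : ℕ) {y : Fin d → ℝ} (hy : y ∉ mS S) : ∫ t, Fx S g D (cn t y) = 0 := by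
  have : ∀ t, Fx S g D (cn t y) = 0 := by
    intro t
    have : cn t y ∉ S := fun h => hy ⟨t, h⟩
    simp [Fx, this]
  simp [this]

lemma Good.marg_nn (h : Good S g M) (D : ℕ) (y : Fin d → ℝ) : 0 ≤ ∫ t, Fx S g D (cn t y) :=
  integral_nonneg fun t => Fx_nn D h.nn _

lemma Good.mg_pow (h : Good S g M) (D : ℕ) (y : Fin d → ℝ) :
    mg S g D y ^ (D + 1) = ∫ t, Fx S g D (cn t y) :=
  Real.rpow_inv_natCast_pow (h.marg_nn D y) (by omega)

lemma Good.mg_nn (h : Good S g M) (D : ℕ) (y : Fin d → ℝ) : 0 ≤ mg S g D y :=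
  Real.rpow_nonneg (h.marg_nn D y) _

lemma Good.mg_Fx (h : Good S g M) (D : ℕ) (y : Fin d → ℝ) :
    Fx (mS S) (mg S g D) (D + 1) y = ∫ t, Fx S g D (cn t y) := by
  unfold Fx
  by_cases hy : y ∈ mS S
  · simp only [hy, indicator_of_mem]
    exact h.mg_pow D y
  · rw [indicator_of_notMem hy]
    exact (marg_zero D hy).symm

lemma Good.marg_le (h : Good S g M) (D : ℕ) {R : ℝ} (hR0 : 0 < R) (hR : ∀ x ∈ S, ∀ i, |x i| ≤ R)
    (y : Fin d → ℝ) : ∫ t, Fx S g D (cn t y) ≤ M ^ D * (2 * R) := by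
  have hM : 0 ≤ M := by linarith [h.one]
  have h1 : ∫ t, Fx S g D (cn t y) ≤ ∫ t, (Icc (-R) R).indicator (fun _ => M ^ D) t := by
    refine integral_mono ((h.sl y).int D) ?_ ?_
    · rw [integrable_indicator_iff measurableSet_Icc]
      exact integrableOn_const (by simp)
    · intro t
      by_cases ht : t ∈ Paper.sl S y
      · rw [indicator_of_mem (sl_sub hR y ht)]
        exact Fx_le D h.nn h.le hM _
      · have : cn t y ∉ S := ht
        simp only [Fx, this, not_false_iff, indicator_of_notMem]
        exact indicator_nonneg (fun _ _ => pow_nonneg hM D) _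
  refine h1.trans (le_of_eq ?_)
  rw [integral_indicator measurableSet_Icc]
  simp [Real.volume_real_Icc]
  rw [max_eq_left (by linarith)]; ring

lemma Good.mgood (h : Good S g M) (D : ℕ) : ∃ M', Good (mS S) (mg S g D) M' := by
  obtain ⟨R, hR0, hR⟩ := bdd_coord h.cpt
  have hM : 0 ≤ M := by linarith [h.one]
  refine ⟨max 1 (M ^ D * (2 * R)), ?_⟩
  have himg : mS S = (fun x : Fin (d + 1) → ℝ => fun i : Fin d => x i.succ) '' S := by
    ext y
    constructor
    · rintro ⟨t, ht⟩
      exact ⟨_, ht, by ext i; simp⟩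
    · rintro ⟨x, hx, rfl⟩
      exact ⟨x 0, by rw [cn_self]; exact hx⟩
  refine ⟨?_, ?_, ?_, ?_, ?_, ?_, ?_⟩
  · rw [himg]
    exact h.cpt.image (continuous_pi fun i => continuous_apply i.succ)
  · have hc : Continuous (fun y : Fin d → ℝ => cn 0 y) :=
      cn_cont.comp (continuous_const.prodMk continuous_id)
    have : (fun y : Fin d → ℝ => cn 0 y) ⁻¹' S ∈ nhds 0 := by
      refine hc.continuousAt.preimage_mem_nhds ?_
      have : cn 0 (0 : Fin d → ℝ) = 0 := by
        ext i; refine Fin.cases ?_ (fun j => ?_) i <;> simp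
      rw [this]; exact h.zero
    exact mem_of_superset this fun y hy => ⟨0, hy⟩
  · have hcv : Convex ℝ (mS S) := by
      rintro x ⟨s, hs⟩ y ⟨t, ht⟩ a b ha hb hab
      refine ⟨a * s + b * t, ?_⟩
      rw [← cn_comb]
      exact h.conv hs ht ha hb hab
    rw [concaveOn_iff_pairwise_pos]
    refine ⟨hcv, ?_⟩
    intro x hx y hy _ a b ha hb hab
    have ha' : a = 1 - b := by linarith
    subst ha'
    have hb1 : b < 1 := by linarith
    have key := bbl D (h.sl x) (h.sl y) (h.sl ((1 - b) • x + b • y)) hx hy hb hb1 (by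
      intro s hs t ht
      change cn _ _ ∈ S ∧ _ ≤ g (cn _ _)
      rw [← cn_comb]
      exact ⟨h.conv hs ht ha.le hb.le hab, h.conc.2 hs ht ha.le hb.le hab⟩)
      (h.mg_nn D x) (h.mg_nn D y) (h.mg_pow D x) (h.mg_pow D y)
    simp only [smul_eq_mul]
    have e := h.mg_pow D ((1 - b) • x + b • y)
    rw [show (∫ t, Fx S g D (cn t ((1 - b) • x + b • y))) = _ from rfl] at e
    have key2 : ((1 - b) * mg S g D x + b * mg S g D y) ^ (D + 1) ≤
        mg S g D ((1 - b) • x + b • y) ^ (D + 1) := by rw [e]; exact key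
    exact le_of_pow_le_pow_left₀ (by omega) (h.mg_nn D _) key2
  · intro y _; exact h.mg_nn D y
  · intro y _
    have h1 : ∫ t, Fx S g D (cn t y) ≤ max 1 (M ^ D * (2 * R)) :=
      (h.marg_le D hR0 hR y).trans (le_max_right _ _)
    have h2 : mg S g D y ≤ (max 1 (M ^ D * (2 * R))) ^ (((D + 1 : ℕ) : ℝ)⁻¹) :=
      Real.rpow_le_rpow (h.marg_nn D y) h1 (by positivity)
    refine h2.trans ?_
    have := Real.rpow_le_rpow_of_exponent_le (le_max_left 1 (M ^ D * (2 * R)))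
      (show (((D + 1 : ℕ) : ℝ)⁻¹) ≤ 1 from inv_le_one_of_one_le₀ (by push_cast; linarith [Nat.cast_nonneg (α := ℝ) D]))
    rwa [Real.rpow_one] at this
  · exact le_max_left _ _
  · have : (mS S).indicator (mg S g D) = mg S g D := by
      rw [indicator_eq_self]
      intro y hy
      by_contra hn
      apply hy
      unfold mg
      rw [marg_zero D hn, Real.zero_rpow (by positivity)]
    rw [this]
    have hm : StronglyMeasurable (fun p : (Fin d → ℝ) × ℝ => Fx S g D (cn p.2 p.1)) :=
      ((h.fmeas D).comp (cn_cont.measurable.comp measurable_swap)).stronglyMeasurable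
    exact hm.integral_prod_right'.measurable.pow_const _

lemma Good.mg_integral (h : Good S g M) (D : ℕ) :
    ∫ y, Fx (mS S) (mg S g D) (D + 1) y = ∫ x, Fx S g D x := by
  rw [fub (h.int D)]
  exact integral_congr_ae (Eventually.of_forall fun y => h.mg_Fx D y)

end

lemma pt_ineq {X Y p g0 ε : ℝ} (D : ℕ) (hX : 0 ≤ X) (hε0 : 0 < ε) (hε1 : ε < 1)
    (hg : X ≤ g0 + p) (hg0 : 0 ≤ g0) (hz : g0 = 0 → X = 0) (hY : (1 - ε) * X + ε * g0 ≤ Y) :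
    X ^ D * (1 - ε * D * (p / g0)) ≤ Y ^ D := by
  have hY0 : 0 ≤ Y := le_trans (by nlinarith) hY
  rcases Nat.eq_zero_or_pos D with rfl | hD
  · simp
  rcases hX.eq_or_lt with h | h
  · rw [← h, zero_pow hD.ne', zero_mul]; positivity
  have hg0' : 0 < g0 := by
    rcases hg0.eq_or_lt with h' | h'
    · have := hz h'.symm; linarith
    · exact h'
  have b := one_add_mul_le_pow (a := ε * (g0 / X - 1)) (by
    have : 0 < g0 / X := by positivity
    nlinarith) D
  have c1 : X * (1 + ε * (g0 / X - 1)) ≤ Y := by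
    have : X * (1 + ε * (g0 / X - 1)) = (1 - ε) * X + ε * g0 := by field_simp; ring
    rw [this]; exact hY
  have c0 : 0 ≤ X * (1 + ε * (g0 / X - 1)) := by
    have : X * (1 + ε * (g0 / X - 1)) = (1 - ε) * X + ε * g0 := by field_simp; ring
    rw [this]; nlinarith
  have c2 := pow_le_pow_left₀ c0 c1 D
  rw [mul_pow] at c2
  refine le_trans (mul_le_mul_of_nonneg_left (le_trans ?_ b) (by positivity)) c2
  have : 1 - p / g0 ≤ g0 / X := by
    rw [le_div_iff₀ h]
    have e : (1 - p / g0) * X = ((g0 - p) * X) / g0 := by field_simp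
    rw [e, div_le_iff₀ hg0']
    by_cases hp : g0 - p ≤ 0
    · nlinarith
    · have := mul_le_mul_of_nonneg_left hg (show 0 ≤ g0 - p by linarith)
      nlinarith [sq_nonneg p]
  have : 0 ≤ ε * D * (g0 / X - 1 + p / g0) := by
    apply mul_nonneg (by positivity); linarith
  nlinarith

lemma Good.supgrad {d : ℕ} {S : Set (Fin d → ℝ)} {g : (Fin d → ℝ) → ℝ} {M : ℝ} (h : Good S g M) :
    ∃ p : (Fin d → ℝ) →L[ℝ] ℝ, ∀ y ∈ S, g y ≤ g 0 + p y := by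
  have hi : (0 : Fin d → ℝ) ∈ interior S := mem_interior_iff_mem_nhds.2 h.zero
  have hci := h.conc.subset interior_subset h.conv.interior
  have hcv := hci.convex_strict_hypograph
  have hop : IsOpen {p : (Fin d → ℝ) × ℝ | p.1 ∈ interior S ∧ p.2 < g p.1} := by
    have hc : ContinuousOn (fun p : (Fin d → ℝ) × ℝ => p.2 - g p.1) (interior S ×ˢ univ) := by
      refine continuousOn_snd.sub ?_
      exact h.conc.continuousOn_interior.comp continuousOn_fst (fun p hp => hp.1)
    have := hc.isOpen_inter_preimage (isOpen_interior.prod isOpen_univ) (isOpen_Iio (a := (0 : ℝ)))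
    convert this using 1
    ext p
    simp [sub_neg]
  obtain ⟨f, hf⟩ := geometric_hahn_banach_open_point hcv hop (x := ((0 : Fin d → ℝ), g 0))
    (by simp)
  set c := f (0, 1) with hc
  set p : (Fin d → ℝ) →L[ℝ] ℝ := f.comp (ContinuousLinearMap.inl ℝ _ _) with hp
  have hfe : ∀ x y, f (x, y) = p x + c * y := by
    intro x y
    have e : ((x, y) : (Fin d → ℝ) × ℝ) = (x, 0) + y • ((0 : Fin d → ℝ), (1 : ℝ)) := by simp
    rw [e, map_add, map_smul]; simp [hp, hc, mul_comm]
  have hcpos : 0 < c := by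
    have := hf (0, g 0 - 1) ⟨hi, by simp⟩
    rw [hfe, hfe] at this
    simp at this; linarith
  have h1 : ∀ x ∈ interior S, p x + c * g x ≤ c * g 0 := by
    intro x hx
    by_contra hcon
    push Not at hcon
    have hε : 0 < (p x + c * g x - c * g 0) / c := by
      apply div_pos (by linarith) hcpos
    have := hf (x, g x - (p x + c * g x - c * g 0) / c) ⟨hx, by simpa using hε⟩
    rw [hfe, hfe] at this
    simp only [map_zero, zero_add] at this
    have e : c * (g x - (p x + c * g x - c * g 0) / c) = c * g 0 - p x := by field_simp; ring
    rw [e] at this; linarith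
  have h2 : ∀ x ∈ S, p x + c * g x ≤ c * g 0 := by
    intro x hx
    have hm : (1 / 2 : ℝ) • (0 : Fin d → ℝ) + (1 / 2 : ℝ) • x ∈ interior S :=
      h.conv.combo_interior_self_mem_interior hi hx (by norm_num) (by norm_num) (by norm_num)
    have a1 := h1 _ hm
    have a2 := h.conc.2 h.mem0 hx (show (0 : ℝ) ≤ 1 / 2 by norm_num) (show (0 : ℝ) ≤ 1 / 2 by norm_num)
      (by norm_num)
    simp only [smul_eq_mul] at a2
    have a3 : p ((1 / 2 : ℝ) • (0 : Fin d → ℝ) + (1 / 2 : ℝ) • x) = 1 / 2 * p x := by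
      rw [map_add, map_smul, map_smul]; simp
    rw [a3] at a1
    nlinarith
  refine ⟨(-c⁻¹) • p, fun y hy => ?_⟩
  have := h2 y hy
  have e : ((-c⁻¹) • p) y = -(p y / c) := by
    simp [div_eq_inv_mul]
  rw [e]
  have : g y ≤ (c * g 0 - p y) / c := by rw [le_div_iff₀ hcpos]; linarith
  have e2 : (c * g 0 - p y) / c = g 0 + -(p y / c) := by field_simp; ring
  linarith

lemma Good.zero_of {d : ℕ} {S : Set (Fin d → ℝ)} {g : (Fin d → ℝ) → ℝ} {M : ℝ} (h : Good S g M)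
    (h0 : g 0 = 0) : ∀ y ∈ S, g y = 0 := by
  intro y hy
  have hc : Continuous (fun t : ℝ => (-t) • y) := by fun_prop
  have : ∀ᶠ t : ℝ in nhds 0, (-t) • y ∈ S := hc.continuousAt.preimage_mem_nhds (by simpa using h.zero)
  obtain ⟨r, hr, hball⟩ := Metric.eventually_nhds_iff.1 this
  have hm := hball (y := r / 2) (by simp [abs_of_pos hr]; linarith)
  have hr' : 0 < 1 + r / 2 := by linarith
  have := h.conc.2 hy hm (show 0 ≤ (r / 2) / (1 + r / 2) by positivity)
    (show 0 ≤ 1 / (1 + r / 2) by positivity) (by field_simp; ring)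
  have e : ((r / 2) / (1 + r / 2)) • y + (1 / (1 + r / 2)) • (-(r / 2)) • y = 0 := by
    rw [smul_smul, ← add_smul]
    convert zero_smul ℝ y using 2
    field_simp; ring
  rw [e, h0] at this
  simp only [smul_eq_mul] at this
  have n1 := h.nn _ hm
  have n2 := h.nn _ hy
  have n3 : 0 ≤ 1 / (1 + r / 2) * g (-(r / 2) • y) := by positivity
  have n4 : 0 < (r / 2) / (1 + r / 2) := by positivity
  nlinarith

/-- centroid condition -/
def Cen {d : ℕ} (S : Set (Fin d → ℝ)) (g : (Fin d → ℝ) → ℝ) (D : ℕ) : Prop :=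
  ∀ i, ∫ x, x i * Fx S g D x = 0

lemma Good.int_coord {d : ℕ} {S : Set (Fin d → ℝ)} {g : (Fin d → ℝ) → ℝ} {M : ℝ} (h : Good S g M)
    (D : ℕ) (i : Fin d) : Integrable (fun x : Fin d → ℝ => x i * Fx S g D x) := by
  obtain ⟨R, hR0, hR⟩ := bdd_coord h.cpt
  refine ((h.int D).const_mul R).mono' ?_ ?_
  · exact ((measurable_pi_apply i).mul (h.fmeas D)).aestronglyMeasurable
  · refine Eventually.of_forall fun x => ?_
    by_cases hx : x ∈ S
    · rw [norm_mul, Real.norm_of_nonneg (Fx_nn D h.nn x)]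
      exact mul_le_mul_of_nonneg_right (hR x hx i) (Fx_nn D h.nn x)
    · simp [Fx, hx]

lemma Fx_scale {d : ℕ} (S : Set (Fin d → ℝ)) (g : (Fin d → ℝ) → ℝ) (D : ℕ) {r : ℝ} (hr : 0 < r)
    (x : Fin d → ℝ) : Fx (r • S) g D (r • x) = S.indicator (fun x => g (r • x) ^ D) x := by
  by_cases hx : x ∈ S
  · have : r • x ∈ r • S := smul_mem_smul_set hx
    simp [Fx, hx, this]
  · have : r • x ∉ r • S := fun h => hx ((smul_mem_smul_set_iff₀ hr.ne' S x).1 h)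
    simp [Fx, hx, this]

lemma scale_int {d : ℕ} (S : Set (Fin d → ℝ)) (g : (Fin d → ℝ) → ℝ) (D : ℕ) {r : ℝ} (hr : 0 < r) :
    ∫ x, Fx (r • S) g D x = r ^ d * ∫ x, S.indicator (fun x => g (r • x) ^ D) x := by
  have := Measure.integral_comp_smul (volume : Measure (Fin d → ℝ)) (Fx (r • S) g D) r
  have e : (fun x => Fx (r • S) g D (r • x)) = S.indicator (fun x => g (r • x) ^ D) := by
    ext x
    exact Fx_scale S g D hr x
  rw [e] at this
  rw [this]
  simp only [Module.finrank_fintype_fun_eq_card, Fintype.card_fin, smul_eq_mul]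
  rw [abs_of_pos (by positivity), ← mul_assoc, mul_inv_cancel₀ (by positivity), one_mul]

lemma Good.centroid {d : ℕ} {S : Set (Fin d → ℝ)} {g : (Fin d → ℝ) → ℝ} {M : ℝ} (h : Good S g M)
    {D : ℕ} (hc : Cen S g D) {ε : ℝ} (hε0 : 0 < ε) (hε1 : ε < 1) :
    (1 - ε) ^ d * ∫ x, Fx S g D x ≤ ∫ x, Fx ((1 - ε) • S) g D x := by
  have hr : 0 < 1 - ε := by linarith
  rw [scale_int S g D hr]
  refine mul_le_mul_of_nonneg_left ?_ (by positivity)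
  obtain ⟨p, hp⟩ := h.supgrad
  have hsum : ∀ y, p y = ∑ i, p (Pi.single i 1) * y i := by
    intro y
    conv_lhs => rw [pi_eq_sum_univ y]
    rw [map_sum]
    refine Finset.sum_congr rfl fun i _ => ?_
    rw [map_smul, smul_eq_mul, mul_comm]
    congr 2
    ext j; simp [Pi.single_apply, eq_comm]
  have hpint : ∀ y, p y * Fx S g D y = ∑ i, p (Pi.single i 1) * (y i * Fx S g D y) := by
    intro y; rw [hsum, Finset.sum_mul]; exact Finset.sum_congr rfl fun i _ => by ring
  have i1 : Integrable (fun y => p y * Fx S g D y) := by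
    simp only [hpint]
    exact integrable_finsetSum _ fun i _ => (h.int_coord D i).const_mul _
  have z1 : ∫ y, p y * Fx S g D y = 0 := by
    simp only [hpint]
    rw [integral_finsetSum _ fun i _ => (h.int_coord D i).const_mul _]
    refine Finset.sum_eq_zero fun i _ => ?_
    rw [integral_const_mul, hc i, mul_zero]
  have i3 : Integrable (S.indicator (fun x => g ((1 - ε) • x) ^ D)) := by
    have := (h.smul hr (by linarith)).int D
    have := this.comp_smul hr.ne'
    convert this using 1
    ext x
    exact (Fx_scale S g D hr x).symm
  have e2 : ∫ y, Fx S g D y = ∫ y, (Fx S g D y - ε * D / g 0 * (p y * Fx S g D y)) := by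
    rw [integral_sub (h.int D) (i1.const_mul _), integral_const_mul, z1]; simp
  rw [e2]
  refine integral_mono ((h.int D).sub (i1.const_mul _)) i3 ?_
  intro y
  simp only [Fx]
  by_cases hy : y ∈ S
  · simp only [hy, indicator_of_mem]
    have key := pt_ineq D (h.nn y hy) hε0 hε1 (hp y hy) (h.nn 0 h.mem0)
      (fun h0 => h.zero_of h0 y hy) (Y := g ((1 - ε) • y)) (by
        have := h.conc.2 hy h.mem0 hr.le hε0.le (by ring)
        simpa using this)
    refine le_trans (le_of_eq ?_) key
    ring
  · simp [hy]

lemma Good.cen_marg {d : ℕ} {S : Set (Fin (d + 1) → ℝ)} {g : (Fin (d + 1) → ℝ) → ℝ} {M : ℝ}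
    (h : Good S g M) {D : ℕ} (hc : Cen S g D) : Cen (mS S) (mg S g D) (D + 1) := by
  intro i
  rw [← hc i.succ, fub (h.int_coord D i.succ)]
  refine integral_congr_ae (Eventually.of_forall fun y => ?_)
  simp only [cn_succ]
  rw [h.mg_Fx, integral_const_mul]

lemma inter_sum {a b : ℤ → ℝ} {s : Finset ℤ} (p : ℤ) {K : ℝ} (ha : ∀ j ∉ s, a j = 0)
    (haK : ∀ j, a j ≤ K) (hK : 0 ≤ K)
    (hb : ∀ j, 0 ≤ b j) (hbs : Summable b) (h1 : ∀ j < p, a j ≤ b (j + 1)) (h2 : ∀ j > p, a j ≤ b j) :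
    ∑' j, a j ≤ ∑' j, b j + K := by
  classical
  rw [tsum_eq_sum (s := s) (fun j hj => ha j hj)]
  have e0 : ∑ j ∈ s, a j ≤ ∑ j ∈ s.erase p, a j + K := by
    by_cases hp : p ∈ s
    · rw [← Finset.sum_erase_add _ _ hp]
      linarith [haK p]
    · rw [Finset.erase_eq_of_notMem hp]; linarith
  refine e0.trans (by
    gcongr
    set e : ℤ → ℤ := fun j => if j < p then j + 1 else j with he
    have inj : Set.InjOn e (s.erase p : Finset ℤ) := by
      intro x hx y hy hxy
      have hx' : x ≠ p := (Finset.mem_erase.1 hx).1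
      have hy' : y ≠ p := (Finset.mem_erase.1 hy).1
      simp only [he] at hxy
      split_ifs at hxy <;> omega
    calc ∑ j ∈ s.erase p, a j ≤ ∑ j ∈ s.erase p, b (e j) := by
          refine Finset.sum_le_sum fun j hj => ?_
          have hj' : j ≠ p := (Finset.mem_erase.1 hj).1
          simp only [he]
          split_ifs with h
          · exact h1 j h
          · exact h2 j (by omega)
      _ = ∑ j ∈ (s.erase p).image e, b j := (Finset.sum_image inj).symm
      _ ≤ ∑' j, b j := hbs.sum_le_tsum _ (fun j _ => hb j))

lemma arg_max {a : ℤ → ℝ} {s : Finset ℤ} (hs : s.Nonempty) (ha : ∀ j ∉ s, a j = 0)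
    (hn : ∀ j, 0 ≤ a j) : ∃ p, ∀ j, a j ≤ a p := by
  obtain ⟨p, hp, hmax⟩ := s.exists_max_image a hs
  refine ⟨p, fun j => ?_⟩
  by_cases hj : j ∈ s
  · exact hmax j hj
  · rw [ha j hj]; exact hn p

lemma oneD_a {ψ : ℝ → ℝ} {K : ℝ} {N : ℕ} (nn : ∀ x, 0 ≤ ψ x) (hle : ∀ x, ψ x ≤ K)
    (supp : ∀ x, ψ x ≠ 0 → |x| ≤ N)
    (qc : ∀ a x b, a ≤ x → x ≤ b → min (ψ a) (ψ b) ≤ ψ x) (hint : Integrable ψ) :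
    |∑' m : ℤ, ψ m - ∫ x, ψ x| ≤ K := by
  have hK : 0 ≤ K := (nn 0).trans (hle 0)
  set s : Finset ℤ := Finset.Icc (-(N : ℤ) - 2) (N + 2) with hs
  have hsn : s.Nonempty := ⟨0, by simp [hs]; omega⟩
  have z : ∀ v : ℝ, |v| ≤ 1 → ∀ j ∉ s, ψ (j + v) = 0 := by
    intro v hv j hj
    by_contra hne
    have h1 := abs_le.1 (supp _ hne)
    have h2 := abs_le.1 hv
    apply hj
    rw [hs, Finset.mem_Icc]
    constructor
    · have : (-(N : ℤ) - 2 : ℝ) ≤ j := by push_cast; linarith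
      exact_mod_cast this
    · have : (j : ℝ) ≤ (N : ℤ) + 2 := by push_cast; linarith
      exact_mod_cast this
  have sm : ∀ v : ℝ, |v| ≤ 1 → Summable (fun j : ℤ => ψ (j + v)) := fun v hv =>
    summable_of_ne_finset_zero (s := s) (z v hv)
  have z0 : ∀ j ∉ s, ψ (j : ℤ) = 0 := fun j hj => by simpa using z 0 (by simp) j hj
  have sm0 : Summable (fun j : ℤ => ψ j) := summable_of_ne_finset_zero (s := s) z0
  have up : ∀ v : ℝ, 0 ≤ v → v ≤ 1 → ∑' j : ℤ, ψ (j + v) ≤ ∑' j : ℤ, ψ j + K := by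
    intro v h0 h1
    have hv : |v| ≤ 1 := abs_le.2 ⟨by linarith, h1⟩
    obtain ⟨p, hp⟩ := arg_max hsn (z v hv) (fun j => nn _)
    refine inter_sum p (z v hv) (fun j => hle _) hK (fun j => nn _) sm0 ?_ ?_
    · intro j hj
      have : (j : ℝ) + 1 ≤ p := by exact_mod_cast hj
      have := qc (j + v) ((j + 1 : ℤ) : ℝ) (p + v) (by push_cast; linarith) (by push_cast; linarith)
      rwa [min_eq_left (hp j)] at this
    · intro j hj
      have : (p : ℝ) + 1 ≤ j := by exact_mod_cast hj
      have := qc (p + v) j (j + v) (by linarith) (by linarith)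
      rwa [min_eq_right (hp j)] at this
  have lo : ∀ v : ℝ, 0 ≤ v → v ≤ 1 → ∑' j : ℤ, ψ j ≤ ∑' j : ℤ, ψ (j + v) + K := by
    intro v h0 h1
    have hv : |v - 1| ≤ 1 := abs_le.2 ⟨by linarith, by linarith⟩
    obtain ⟨p, hp⟩ := arg_max hsn z0 (fun j => nn _)
    have e : ∑' j : ℤ, ψ (j + v) = ∑' j : ℤ, ψ (j + (v - 1)) := by
      rw [← (Equiv.addRight (1 : ℤ)).tsum_eq (fun j : ℤ => ψ (j + (v - 1)))]
      refine tsum_congr fun j => ?_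
      simp
    rw [e]
    refine inter_sum p z0 (fun j => hle _) hK (fun j => nn _) (sm _ hv) ?_ ?_
    · intro j hj
      have : (j : ℝ) + 1 ≤ p := by exact_mod_cast hj
      have := qc j (((j + 1 : ℤ) : ℝ) + (v - 1)) p (by push_cast; linarith) (by push_cast; linarith)
      rwa [min_eq_left (hp j)] at this
    · intro j hj
      have : (p : ℝ) + 1 ≤ j := by exact_mod_cast hj
      have := qc p ((j : ℝ) + (v - 1)) j (by linarith) (by linarith)
      rwa [min_eq_right (hp j)] at this
  have fin : ∀ v : ℝ, 0 ≤ v → v ≤ 1 → ∑' j : ℤ, ψ (j + v) = ∑ j ∈ s, ψ (v + j) := by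
    intro v h0 h1
    rw [tsum_eq_sum (s := s) (z v (abs_le.2 ⟨by linarith, h1⟩))]
    exact Finset.sum_congr rfl fun j _ => by rw [add_comm]
  have hii : ∀ j : ℤ, IntervalIntegrable (fun v : ℝ => ψ (v + j)) volume 0 1 := fun j =>
    (hint.comp_add_right (j : ℝ)).intervalIntegrable
  have hI : ∫ x, ψ x = ∫ v in (0 : ℝ)..1, ∑ j ∈ s, ψ (v + j) := by
    rw [intervalIntegral.integral_finsetSum (fun j _ => hii j)]
    have := hint.hasSum_intervalIntegral_comp_add_int.tsum_eq
    rw [← this]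
    refine tsum_eq_sum fun j hj => ?_
    have : ∀ v ∈ Set.uIcc (0 : ℝ) 1, ψ (v + j) = 0 := by
      intro v hv
      rw [uIcc_of_le zero_le_one] at hv
      have := z v (abs_le.2 ⟨by linarith [hv.1], hv.2⟩) j hj
      rwa [add_comm]
    rw [intervalIntegral.integral_congr this]; simp
  have hsumi : IntervalIntegrable (fun v : ℝ => ∑ j ∈ s, ψ (v + j)) volume 0 1 := by
    have : Integrable (fun v : ℝ => ∑ j ∈ s, ψ (v + j)) :=
      integrable_finsetSum _ fun j _ => hint.comp_add_right (j : ℝ)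
    exact this.intervalIntegrable
  rw [abs_le]
  constructor
  · have : ∫ v in (0 : ℝ)..1, ∑ j ∈ s, ψ (v + j) ≤ ∫ v in (0 : ℝ)..1, (∑' j : ℤ, ψ j + K) := by
      refine intervalIntegral.integral_mono_on zero_le_one hsumi (by simp) fun v hv => ?_
      rw [← fin v hv.1 hv.2]; exact up v hv.1 hv.2
    simp only [intervalIntegral.integral_const, sub_zero, one_smul] at this
    rw [hI]; linarith
  · have : ∫ v in (0 : ℝ)..1, (∑' j : ℤ, ψ j - K) ≤ ∫ v in (0 : ℝ)..1, ∑ j ∈ s, ψ (v + j) := by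
      refine intervalIntegral.integral_mono_on zero_le_one (by simp) hsumi fun v hv => ?_
      rw [← fin v hv.1 hv.2]; linarith [lo v hv.1 hv.2]
    simp only [intervalIntegral.integral_const, sub_zero, one_smul] at this
    rw [hI]; linarith

lemma trapz {a b u M : ℝ} (D : ℕ) (ha : 0 ≤ a) (hb : 0 ≤ b) (haM : a ≤ M) (hbM : b ≤ M) (hM : 1 ≤ M)
    (hu0 : 0 ≤ u) (hu1 : u ≤ 1) :
    (1 - u) * a ^ D + u * b ^ D ≤ ((1 - u) * a + u * b) ^ D + (D : ℝ) ^ 2 * M ^ D * (b - a) ^ 2 := by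
  have hpow : ∀ D : ℕ, (b - a) * (b ^ D - a ^ D) ≤ D * M ^ D * (b - a) ^ 2 := by
    intro D
    induction D with
    | zero => simp
    | succ D ih =>
      have e : (b - a) * (b ^ (D + 1) - a ^ (D + 1)) = b * ((b - a) * (b ^ D - a ^ D)) + a ^ D * (b - a) ^ 2 := by
        ring
      rw [e]
      have h1 : b * ((b - a) * (b ^ D - a ^ D)) ≤ M * (D * M ^ D * (b - a) ^ 2) := by
        calc b * ((b - a) * (b ^ D - a ^ D)) ≤ b * (D * M ^ D * (b - a) ^ 2) := by gcongr
          _ ≤ M * (D * M ^ D * (b - a) ^ 2) := by gcongr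
      have h2 : a ^ D ≤ M ^ (D + 1) :=
        (pow_le_pow_left₀ ha haM D).trans (pow_le_pow_right₀ hM (by omega))
      have h3 : a ^ D * (b - a) ^ 2 ≤ M ^ (D + 1) * (b - a) ^ 2 := by gcongr
      push_cast
      calc _ ≤ M * (D * M ^ D * (b - a) ^ 2) + M ^ (D + 1) * (b - a) ^ 2 := add_le_add h1 h3
        _ = _ := by ring
  have hu1' : 0 ≤ 1 - u := by linarith
  induction D with
  | zero => simp
  | succ D ih =>
    set c := (1 - u) * a + u * b with hc
    have hc0 : 0 ≤ c := by positivity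
    have hcM : c ≤ M := by
      calc c ≤ (1 - u) * M + u * M := by rw [hc]; gcongr
        _ = M := by ring
    have e : (1 - u) * a ^ (D + 1) + u * b ^ (D + 1) =
        c * ((1 - u) * a ^ D + u * b ^ D) + (1 - u) * u * ((b - a) * (b ^ D - a ^ D)) := by
      rw [hc]; ring
    rw [e]
    have h1 : c * ((1 - u) * a ^ D + u * b ^ D) ≤ c ^ (D + 1) + M * ((D : ℝ) ^ 2 * M ^ D * (b - a) ^ 2) := by
      calc _ ≤ c * (c ^ D + (D : ℝ) ^ 2 * M ^ D * (b - a) ^ 2) := by gcongr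
        _ = c ^ (D + 1) + c * ((D : ℝ) ^ 2 * M ^ D * (b - a) ^ 2) := by ring
        _ ≤ _ := by gcongr
    have h2 : (1 - u) * u * ((b - a) * (b ^ D - a ^ D)) ≤ D * M ^ (D + 1) * (b - a) ^ 2 := by
      have k1 : (1 - u) * u ≤ 1 := by nlinarith
      calc (1 - u) * u * ((b - a) * (b ^ D - a ^ D)) ≤ (1 - u) * u * (D * M ^ D * (b - a) ^ 2) :=
            mul_le_mul_of_nonneg_left (hpow D) (mul_nonneg hu1' hu0)
        _ ≤ 1 * (D * M ^ D * (b - a) ^ 2) := by gcongr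
        _ ≤ D * M ^ (D + 1) * (b - a) ^ 2 := by
            rw [one_mul]; gcongr
            omega
    have h3 : 0 ≤ ((D : ℝ) + 1) * M ^ (D + 1) * (b - a) ^ 2 := by positivity
    push_cast
    calc _ ≤ c ^ (D + 1) + M * ((D : ℝ) ^ 2 * M ^ D * (b - a) ^ 2) + D * M ^ (D + 1) * (b - a) ^ 2 :=
          add_le_add h1 h2
      _ ≤ c ^ (D + 1) + M * ((D : ℝ) ^ 2 * M ^ D * (b - a) ^ 2) + D * M ^ (D + 1) * (b - a) ^ 2 +
          ((D : ℝ) + 1) * M ^ (D + 1) * (b - a) ^ 2 := by linarith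
      _ = _ := by ring

lemma shr {A : Set ℝ} {γ : ℝ → ℝ} (hconc : ConcaveOn ℝ A γ) (nn : ∀ x ∈ A, 0 ≤ γ x) {x y c s : ℝ}
    (hy : y ∈ A) (hc : c ∈ A) (hs0 : 0 ≤ s) (hs1 : s ≤ 1) (hx : x = (1 - s) * y + s * c) :
    (1 - s) * γ y ≤ γ x := by
  have := hconc.2 hy hc (show 0 ≤ 1 - s by linarith) hs0 (by ring)
  simp only [smul_eq_mul] at this
  rw [← hx] at this
  have := mul_nonneg hs0 (nn c hc)
  linarith

lemma half {γ φ : ℝ → ℝ} {L T M δ δ' : ℝ} (D : ℕ) (hconc : ConcaveOn ℝ (Icc (-L) T) γ)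
    (nn : ∀ x ∈ Icc (-L) T, 0 ≤ γ x) (le : ∀ x ∈ Icc (-L) T, γ x ≤ M) (hM : 1 ≤ M)
    (hδ' : 0 < δ') (hδL : δ' ≤ L) (hδ : δ' + 1 ≤ δ) (hT : δ ≤ T)
    (hφ : ∀ x ∈ Icc (-L) T, φ x = γ x ^ D) (hi : Integrable φ) :
    φ 0 / 2 + ∑ j ∈ Finset.range ⌊T⌋₊, φ (j + 1) ≤ (∫ x in (0 : ℝ)..T, φ x) +
      1 / (2 * δ) * (∫ x in (T - δ)..T, φ x) +
      ((D : ℝ) ^ 2 * M ^ (D + 2) * T / δ' ^ 2 + (δ' + 1) * (D * M ^ D / L) +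
        (M ^ D * (δ' + 1) / δ + D * M ^ D * δ / L) / 2) := by
  have hL : 0 < L := by linarith
  have hδp : 0 < δ := by linarith
  have hTp : 0 < T := by linarith
  have hMp : 0 < M := by linarith
  have hii : ∀ a b, IntervalIntegrable φ volume a b := fun a b => hi.intervalIntegrable
  have hφ0 : ∀ x ∈ Icc (-L) T, 0 ≤ φ x := fun x hx => by
    rw [hφ x hx]; exact pow_nonneg (nn x hx) D
  have hφM : ∀ x ∈ Icc (-L) T, φ x ≤ M ^ D := fun x hx => by
    rw [hφ x hx]; exact pow_le_pow_left₀ (nn x hx) (le x hx) D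
  -- decay towards the origin is slow
  have mono : ∀ x y, 0 ≤ x → x ≤ y → y ≤ T → φ y ≤ φ x + (y - x) * (D * M ^ D / L) := by
    intro x y hx hxy hy
    have hyA : y ∈ Icc (-L) T := ⟨by linarith, hy⟩
    have hxA : x ∈ Icc (-L) T := ⟨by linarith, by linarith⟩
    have hLA : -L ∈ Icc (-L) T := ⟨le_rfl, by linarith⟩
    set s := (y - x) / (y + L) with hs
    have hyL : 0 < y + L := by linarith
    have hs0 : 0 ≤ s := div_nonneg (by linarith) hyL.le
    have hs1 : s ≤ 1 := by rw [hs, div_le_one hyL]; linarith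
    have hsL : s ≤ (y - x) / L := by
      rw [hs]; apply div_le_div_of_nonneg_left (by linarith) hL; linarith
    have h1 := shr hconc nn hyA hLA hs0 hs1 (x := x) (by rw [hs]; field_simp; ring)
    have h2 := pow_le_pow_left₀ (mul_nonneg (by linarith) (nn y hyA)) h1 D
    rw [mul_pow, ← hφ y hyA, ← hφ x hxA] at h2
    have h3 := one_add_mul_le_pow (a := -s) (by linarith) D
    have h4 : (1 + D * -s) * φ y ≤ (1 - s) ^ D * φ y := by
      have := hφ0 y hyA
      rw [sub_eq_add_neg]; gcongr
    have h5 : D * s * φ y ≤ D * ((y - x) / L) * M ^ D := by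
      have := hφM y hyA
      have := hφ0 y hyA
      gcongr
    have h6 : (D : ℝ) * ((y - x) / L) * M ^ D = (y - x) * (D * M ^ D / L) := by ring
    linarith
  set N := ⌊T⌋₊ with hN
  set J := ⌊T - δ'⌋₊ with hJ
  have hJ1 : (J : ℝ) ≤ T - δ' := Nat.floor_le (by linarith)
  have hJ2 : T - δ' < J + 1 := Nat.lt_floor_add_one _
  have hN1 : (N : ℝ) ≤ T := Nat.floor_le hTp.le
  have hJN : J ≤ N := Nat.floor_mono (by linarith)
  have hJN' : (J : ℝ) ≤ N := by exact_mod_cast hJN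
  set e1 := (D : ℝ) ^ 2 * M ^ D * (M / δ') ^ 2 with he1
  set e2 := (D * M ^ D / L) with he2
  have he1p : 0 ≤ e1 := by positivity
  have he2p : 0 ≤ e2 := by positivity
  -- trapezoid on one cell
  have cell1 : ∀ j : ℕ, j < J → φ j / 2 + φ (j + 1) / 2 ≤ (∫ x in (j : ℝ)..(j + 1 : ℕ), φ x) + e1 := by
    intro j hj
    have hj' : (j : ℝ) + 1 ≤ J := by exact_mod_cast hj
    have hj0 : (0 : ℝ) ≤ j := Nat.cast_nonneg j
    have mj : (j : ℝ) ∈ Icc (-L) T := ⟨by linarith, by linarith⟩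
    have mj1 : (j : ℝ) + 1 ∈ Icc (-L) T := ⟨by linarith, by linarith⟩
    have mL : -L ∈ Icc (-L) T := ⟨le_rfl, by linarith⟩
    have mT : T ∈ Icc (-L) T := ⟨by linarith, le_rfl⟩
    have up : γ (j + 1) - γ j ≤ M / δ' := by
      have hp : 0 < (j : ℝ) + 1 + L := by linarith
      have h1 := shr hconc nn mj1 mL (s := 1 / (j + 1 + L)) (by positivity)
        (by rw [div_le_one hp]; linarith) (x := j) (by field_simp; ring)
      have h2 : 1 / ((j : ℝ) + 1 + L) * γ (j + 1) ≤ 1 / δ' * M := by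
        have := nn _ mj1
        gcongr
        · linarith
        · exact le _ mj1
      have h3 : 1 / δ' * M = M / δ' := by ring
      linarith
    have dn : γ j - γ (j + 1) ≤ M / δ' := by
      have hp : 0 < T - j := by linarith
      have h1 := shr hconc nn mj mT (s := 1 / (T - j)) (by positivity)
        (by rw [div_le_one hp]; linarith) (x := (j : ℝ) + 1) (by field_simp; ring)
      have h2 : 1 / (T - j) * γ j ≤ 1 / δ' * M := by
        have := nn _ mj
        gcongr
        · linarith
        · exact le _ mj
      have h3 : 1 / δ' * M = M / δ' := by ring
      linarith
    have hsq : (γ (j + 1) - γ j) ^ 2 ≤ (M / δ') ^ 2 := by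
      apply sq_le_sq'
      · linarith
      · linarith
    have e : (∫ x in (j : ℝ)..(j + 1 : ℕ), φ x) = ∫ u in (0 : ℝ)..1, φ (u + j) := by
      rw [intervalIntegral.integral_comp_add_right]; simp [add_comm]
    rw [e]
    have : ∫ u in (0 : ℝ)..1, ((φ j - e1) + u * (φ (j + 1) - φ j)) ≤ ∫ u in (0 : ℝ)..1, φ (u + j) := by
      refine intervalIntegral.integral_mono_on zero_le_one (by
        apply Continuous.intervalIntegrable; fun_prop)
        ((hi.comp_add_right (j : ℝ)).intervalIntegrable) fun u hu => ?_
      have mu : u + j ∈ Icc (-L) T := ⟨by linarith [hu.1], by linarith [hu.2]⟩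
      have h1 := trapz D (nn _ mj) (nn _ mj1) (le _ mj) (le _ mj1) hM hu.1 hu.2
      have h2 := hconc.2 mj mj1 (show 0 ≤ 1 - u by linarith [hu.2]) hu.1 (by ring)
      simp only [smul_eq_mul] at h2
      have e3 : (1 - u) * (j : ℝ) + u * (j + 1) = u + j := by ring
      rw [e3] at h2
      have h3 := pow_le_pow_left₀ (add_nonneg (mul_nonneg (by linarith [hu.2]) (nn _ mj))
        (mul_nonneg hu.1 (nn _ mj1))) h2 D
      rw [← hφ _ mu] at h3
      rw [← hφ _ mj, ← hφ _ mj1] at h1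
      have h4 : (D : ℝ) ^ 2 * M ^ D * (γ (j + 1) - γ j) ^ 2 ≤ e1 := by rw [he1]; gcongr
      linarith
    have e4 : ∫ u in (0 : ℝ)..1, ((φ j - e1) + u * (φ (j + 1) - φ j)) =
        φ j - e1 + (φ (j + 1) - φ j) / 2 := by
      rw [intervalIntegral.integral_add (by simp) (by apply Continuous.intervalIntegrable; fun_prop),
        intervalIntegral.integral_mul_const, integral_id]
      simp; ring
    rw [e4] at this
    linarith
  have cell2 : ∀ j : ℕ, j < N → φ (j + 1) ≤ (∫ x in (j : ℝ)..(j + 1 : ℕ), φ x) + e2 := by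
    intro j hj
    have hj' : (j : ℝ) + 1 ≤ N := by exact_mod_cast hj
    have hj0 : (0 : ℝ) ≤ j := Nat.cast_nonneg j
    have : ∫ u in (j : ℝ)..(j + 1 : ℕ), (φ (j + 1) - e2) ≤ ∫ u in (j : ℝ)..(j + 1 : ℕ), φ u := by
      refine intervalIntegral.integral_mono_on (by push_cast; linarith) (by simp) (hii _ _) fun u hu => ?_
      have hu2 : u ≤ (j : ℝ) + 1 := by have := hu.2; push_cast at this; exact this
      have := mono u (j + 1) (by linarith [hu.1]) hu2 (by linarith)
      have h2 : ((j : ℝ) + 1 - u) * e2 ≤ 1 * e2 := by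
        gcongr; linarith [hu.1]
      linarith
    simp only [intervalIntegral.integral_const] at this
    push_cast at this ⊢
    simp only [add_sub_cancel_left, one_smul] at this
    linarith
  have sum1 : ∀ K : ℕ, K ≤ J → φ 0 / 2 + ∑ j ∈ Finset.range K, φ (j + 1) ≤
      (∫ x in (0 : ℝ)..K, φ x) + φ K / 2 + K * e1 := by
    intro K hK
    induction K with
    | zero => simp
    | succ K ih =>
      have := ih (by omega)
      have c := cell1 K (by omega)
      rw [Finset.sum_range_succ]
      have ea := intervalIntegral.integral_add_adjacent_intervals (hii 0 K) (hii K (K + 1 : ℕ))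
      rw [← ea]
      push_cast at c ⊢
      linarith
  have sum2 : ∀ K : ℕ, J ≤ K → K ≤ N → φ 0 / 2 + ∑ j ∈ Finset.range K, φ (j + 1) ≤
      (∫ x in (0 : ℝ)..K, φ x) + φ J / 2 + J * e1 + (K - J) * e2 := by
    intro K hK
    induction K, hK using Nat.le_induction with
    | base => intro _; simpa using sum1 J le_rfl
    | succ K hK ih =>
      intro hKN
      have := ih (by omega)
      have c := cell2 K (by omega)
      rw [Finset.sum_range_succ]
      have ea := intervalIntegral.integral_add_adjacent_intervals (hii 0 K) (hii K (K + 1 : ℕ))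
      rw [← ea]
      push_cast at c ⊢
      linarith
  have s2 := sum2 N hJN le_rfl
  have s3 : (∫ x in (0 : ℝ)..N, φ x) ≤ ∫ x in (0 : ℝ)..T, φ x := by
    have ea := intervalIntegral.integral_add_adjacent_intervals (hii 0 N) (hii N T)
    have : 0 ≤ ∫ x in (N : ℝ)..T, φ x := intervalIntegral.integral_nonneg hN1
      fun u hu => hφ0 u ⟨by linarith [hu.1, Nat.cast_nonneg (α := ℝ) N], hu.2⟩
    linarith
  have mJ : (J : ℝ) ∈ Icc (-L) T := ⟨by linarith [Nat.cast_nonneg (α := ℝ) J], by linarith⟩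
  have s4 : φ J ≤ 1 / δ * (∫ x in (T - δ)..T, φ x) + M ^ D * (δ' + 1) / δ + δ * e2 := by
    have hl : T - δ ≤ J := by linarith
    have t1 : ∫ x in (T - δ)..J, (φ J - δ * e2) ≤ ∫ x in (T - δ)..J, φ x := by
      refine intervalIntegral.integral_mono_on hl (by simp) (hii _ _) fun u hu => ?_
      have := mono u J (by linarith [hu.1]) hu.2 (by linarith)
      have h2 : ((J : ℝ) - u) * e2 ≤ δ * e2 := by
        gcongr; linarith [hu.1]
      linarith
    simp only [intervalIntegral.integral_const, smul_eq_mul] at t1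
    have ea := intervalIntegral.integral_add_adjacent_intervals (hii (T - δ) J) (hii J T)
    have t2 : 0 ≤ ∫ x in (J : ℝ)..T, φ x := intervalIntegral.integral_nonneg (by linarith)
      fun u hu => hφ0 u ⟨by linarith [hu.1, Nat.cast_nonneg (α := ℝ) J], hu.2⟩
    have t3 : (J - (T - δ)) * (δ * e2) ≤ δ * (δ * e2) := by gcongr; linarith
    have t4 : (δ - (J - (T - δ))) * φ J ≤ (δ' + 1) * M ^ D := by
      have := hφM _ mJ
      have := hφ0 _ mJ
      gcongr
      linarith
    have t5 : δ * φ J ≤ (∫ x in (T - δ)..T, φ x) + M ^ D * (δ' + 1) + δ * (δ * e2) := by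
      nlinarith
    have e : 1 / δ * (∫ x in (T - δ)..T, φ x) + M ^ D * (δ' + 1) / δ + δ * e2 =
      ((∫ x in (T - δ)..T, φ x) + M ^ D * (δ' + 1) + δ * (δ * e2)) / δ := by field_simp
    rw [e, le_div_iff₀ hδp]; linarith
  have s5 : (J : ℝ) * e1 ≤ (D : ℝ) ^ 2 * M ^ (D + 2) * T / δ' ^ 2 := by
    have : (D : ℝ) ^ 2 * M ^ (D + 2) * T / δ' ^ 2 = T * e1 := by rw [he1]; field_simp; ring
    rw [this]; gcongr; linarith
  have s6 : ((N : ℝ) - J) * e2 ≤ (δ' + 1) * e2 := by gcongr; linarith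
  have e7 : D * M ^ D * δ / L = δ * e2 := by rw [he2]; ring
  have e8 : 1 / (2 * δ) * (∫ x in (T - δ)..T, φ x) = (1 / δ * (∫ x in (T - δ)..T, φ x)) / 2 := by
    field_simp
  rw [e7, e8]
  linarith

/-- error term for a line -/
def lerr (D : ℕ) (M L T δ δ' : ℝ) : ℝ :=
  (D : ℝ) ^ 2 * M ^ (D + 2) * T / δ' ^ 2 + (δ' + 1) * (D * M ^ D / L) +
        (M ^ D * (δ' + 1) / δ + D * M ^ D * δ / L) / 2

lemma twoside {γ : ℝ → ℝ} {a b M δ δ' : ℝ} (D : ℕ) (h : Sl (Icc a b) γ M) (hM : 1 ≤ M)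
    (hδ' : 0 < δ') (hδ : δ' + 1 ≤ δ) (hT : δ + 1 ≤ (b - a) / 2) :
    ∑' m : ℤ, Fx (Icc a b) γ D m ≤ (∫ x, Fx (Icc a b) γ D x) +
      1 / (2 * δ) * ((∫ x, Fx (Icc a b) γ D x) - ∫ x in (a + δ)..(b - δ), Fx (Icc a b) γ D x) +
      2 * lerr D M ((b - a) / 2 - 1) (b - a) δ δ' := by
  set φ := Fx (Icc a b) γ D with hφ
  have hin : Integrable φ := h.int D
  have hii : ∀ a b, IntervalIntegrable φ volume a b := fun a b => hin.intervalIntegrable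
  set c := ⌊(a + b) / 2⌋ with hc
  have hc1 : (c : ℝ) ≤ (a + b) / 2 := Int.floor_le _
  have hc2 : (a + b) / 2 < c + 1 := Int.lt_floor_add_one _
  set L := (b - a) / 2 - 1 with hL
  have conc := h.conc
  have hval : ∀ x ∈ Icc a b, φ x = γ x ^ D := fun x hx => by simp [hφ, Fx, hx]
  have hout : ∀ x ∉ Icc a b, φ x = 0 := fun x hx => by simp [hφ, Fx, hx]
  have m1 : ∀ x ∈ Icc (-L) (b - c), c + x ∈ Icc a b := fun x hx => ⟨by linarith [hx.1], by linarith [hx.2]⟩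
  have m2 : ∀ x ∈ Icc (-L) (c - a), c - x ∈ Icc a b := fun x hx => ⟨by linarith [hx.2], by linarith [hx.1]⟩
  have H1 := half (γ := fun x => γ (c + x)) (φ := fun x => φ (c + x)) (L := L) (T := b - c) (M := M)
    (δ := δ) (δ' := δ') D
    (by
      refine ⟨convex_Icc _ _, fun x hx y hy p q hp hq hpq => ?_⟩
      have := conc.2 (m1 x hx) (m1 y hy) hp hq hpq
      simp only [smul_eq_mul] at this ⊢
      have e : p * (c + x) + q * (c + y) = c + (p * x + q * y) := by
        linear_combination (c : ℝ) * hpq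
      rwa [e] at this)
    (fun x hx => h.nn _ (m1 x hx)) (fun x hx => h.le _ (m1 x hx)) hM hδ' (by linarith) hδ (by linarith)
    (fun x hx => hval _ (m1 x hx)) (hin.comp_add_left (c : ℝ))
  have H2 := half (γ := fun x => γ (c - x)) (φ := fun x => φ (c - x)) (L := L) (T := c - a) (M := M)
    (δ := δ) (δ' := δ') D
    (by
      refine ⟨convex_Icc _ _, fun x hx y hy p q hp hq hpq => ?_⟩
      have := conc.2 (m2 x hx) (m2 y hy) hp hq hpq
      simp only [smul_eq_mul] at this ⊢
      have e : p * (c - x) + q * (c - y) = c - (p * x + q * y) := by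
        linear_combination (c : ℝ) * hpq
      rwa [e] at this)
    (fun x hx => h.nn _ (m2 x hx)) (fun x hx => h.le _ (m2 x hx)) hM hδ' (by linarith) hδ (by linarith)
    (fun x hx => hval _ (m2 x hx)) (hin.comp_sub_left (c : ℝ))
  simp only [intervalIntegral.integral_comp_add_left, intervalIntegral.integral_comp_sub_left,
    add_zero, sub_zero] at H1 H2
  have e1 : (c : ℝ) + (b - c) = b := by ring
  have e2 : (c : ℝ) + (b - c - δ) = b - δ := by ring
  have e3 : (c : ℝ) - (c - a) = a := by ring
  have e4 : (c : ℝ) - (c - a - δ) = a + δ := by ring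
  rw [e1, e2] at H1
  rw [e3, e4] at H2
  -- the sum
  have z1 : ∀ j ∉ Finset.range (⌊b - c⌋₊ + 1), φ (((j : ℤ) + c : ℤ) : ℝ) = 0 := by
    intro j hj
    apply hout
    rintro ⟨_, h2⟩
    apply hj
    rw [Finset.mem_range, Nat.lt_succ_iff]
    apply Nat.le_floor
    push_cast at h2
    linarith
  have z2 : ∀ j ∉ Finset.range (⌊c - a⌋₊), φ ((-((j : ℤ) + 1) + c : ℤ) : ℝ) = 0 := by
    intro j hj
    apply hout
    rintro ⟨h2, _⟩
    apply hj
    rw [Finset.mem_range, ← Nat.succ_le_iff]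
    apply Nat.le_floor
    push_cast at h2 ⊢
    linarith
  have es : ∑' m : ℤ, φ m = ∑' m : ℤ, φ ((m + c : ℤ) : ℝ) :=
    ((Equiv.addRight c).tsum_eq (fun m : ℤ => φ m)).symm
  have et : ∑' m : ℤ, φ ((m + c : ℤ) : ℝ) = φ c + ∑ j ∈ Finset.range ⌊b - c⌋₊, φ (c + (j + 1)) +
      ∑ j ∈ Finset.range ⌊c - a⌋₊, φ (c - (j + 1)) := by
    rw [tsum_of_nat_of_neg_add_one (f := fun m : ℤ => φ ((m + c : ℤ) : ℝ))
      (summable_of_ne_finset_zero (s := Finset.range (⌊b - c⌋₊ + 1)) z1)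
      (summable_of_ne_finset_zero (s := Finset.range (⌊c - a⌋₊)) z2),
      tsum_eq_sum (s := Finset.range (⌊b - c⌋₊ + 1)) z1, tsum_eq_sum (s := Finset.range (⌊c - a⌋₊)) z2,
      Finset.sum_range_succ']
    congr 1
    · rw [add_comm]
      congr 1
      · simp
      · exact Finset.sum_congr rfl fun j _ => by congr 1; push_cast; ring
    · exact Finset.sum_congr rfl fun j _ => by congr 1; push_cast; ring
  rw [es, et]
  -- the integral
  have hab : a ≤ b := by linarith
  have ei : ∫ x, φ x = ∫ x in a..b, φ x := by
    rw [intervalIntegral.integral_of_le hab, ← integral_Icc_eq_integral_Ioc]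
    exact (setIntegral_eq_integral_of_forall_compl_eq_zero fun x hx => hout x hx).symm
  have i1 := intervalIntegral.integral_add_adjacent_intervals (hii a c) (hii c b)
  have i2 := intervalIntegral.integral_add_adjacent_intervals (hii a (a + δ)) (hii (a + δ) (b - δ))
  have i3 := intervalIntegral.integral_add_adjacent_intervals (hii a (b - δ)) (hii (b - δ) b)
  have er : ∀ T, T ≤ b - a → (D : ℝ) ^ 2 * M ^ (D + 2) * T / δ' ^ 2 + (δ' + 1) * (D * M ^ D / L) +
        (M ^ D * (δ' + 1) / δ + D * M ^ D * δ / L) / 2 ≤ lerr D M L (b - a) δ δ' := by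
    intro T hT
    unfold lerr
    gcongr
  have r1 := er (b - c) (by linarith)
  have r2 := er (c - a) (by linarith)
  have ef : 1 / (2 * δ) * ((∫ x, φ x) - ∫ x in (a + δ)..(b - δ), φ x) =
    1 / (2 * δ) * (∫ x in a..(a + δ), φ x) + 1 / (2 * δ) * (∫ x in (b - δ)..b, φ x) := by
    rw [ei]; rw [← i3, ← i2]; ring
  rw [ef, ei, ← i1]
  linarith

lemma Sl.aff {A : Set ℝ} {γ : ℝ → ℝ} {M : ℝ} (h : Sl A γ M) {k : ℝ} (hk : 0 < k) (w : ℝ) :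
    Sl {s | (s + w) / k ∈ A} (fun s => γ ((s + w) / k)) M where
  bdd := by
    obtain ⟨R, hR⟩ := h.bdd.exists_norm_le
    refine (Metric.isBounded_Icc (-(k * R) - w) (k * R - w)).subset fun s hs => ?_
    have := hR _ hs
    rw [Real.norm_eq_abs, abs_div, abs_of_pos hk, div_le_iff₀ hk, abs_le] at this
    exact ⟨by linarith [this.1], by linarith [this.2]⟩
  conc := by
    have key : ∀ x y p q : ℝ, p + q = 1 → p * ((x + w) / k) + q * ((y + w) / k) = (p * x + q * y + w) / k := by
      intro x y p q hpq
      field_simp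
      linear_combination w * hpq
    refine ⟨fun x hx y hy p q hp hq hpq => ?_, fun x hx y hy p q hp hq hpq => ?_⟩
    · have := h.conv hx hy hp hq hpq
      simp only [smul_eq_mul] at this
      rw [key _ _ _ _ hpq] at this
      exact this
    · have := h.conc.2 hx hy hp hq hpq
      simp only [smul_eq_mul] at this ⊢
      rw [key _ _ _ _ hpq] at this
      exact this
  nn := fun x hx => h.nn _ hx
  le := fun x hx => h.le _ hx
  meas := by
    have : Measurable (fun s : ℝ => (s + w) / k) := by fun_prop
    exact h.meas.comp this

lemma aff_int (F : ℝ → ℝ) {k : ℝ} (hk : 0 < k) (w : ℝ) : ∫ s, F ((s + w) / k) = k * ∫ s, F s := by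
  have := integral_add_right_eq_self (fun s => F (s / k)) w (μ := volume)
  rw [this, Measure.integral_comp_div]
  simp [abs_of_pos hk]

lemma sla {A : Set ℝ} {γ : ℝ → ℝ} {M : ℝ} (h : Sl A γ M) (hM : 1 ≤ M) (D : ℕ) {k : ℝ} (hk : 0 < k) (w : ℝ) :
    |∑' m : ℤ, Fx A γ D ((m + w) / k) - k * ∫ x, Fx A γ D x| ≤ M ^ D := by
  have h' := h.aff hk w
  rw [← aff_int (Fx A γ D) hk w]
  obtain ⟨R, hR⟩ := h'.bdd.exists_norm_le
  refine oneD_a (ψ := fun s => Fx A γ D ((s + w) / k)) (N := ⌈R⌉₊) (fun x => Fx_nn D h.nn _) (fun x => Fx_le D h.nn h.le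
    (by linarith) _) ?_ ?_ (h'.int D)
  · intro x hx
    have : x ∈ {s | (s + w) / k ∈ A} := by
      by_contra hc
      apply hx
      have hc' : (x + w) / k ∉ A := hc
      simp [Fx, hc']
    exact (hR x this).trans (Nat.le_ceil R)
  · intro a x b ha hb
    set A' := {s | (s + w) / k ∈ A} with hA'
    change min (Fx A' (fun s => γ ((s + w) / k)) D a) (Fx A' (fun s => γ ((s + w) / k)) D b) ≤
      Fx A' (fun s => γ ((s + w) / k)) D x
    by_cases haA : a ∈ A'
    · by_cases hbA : b ∈ A'
      · have hx : x ∈ A' := h'.conv.ordConnected.out haA hbA ⟨ha, hb⟩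
        have hseg : x ∈ segment ℝ a b := by rw [segment_eq_Icc (ha.trans hb)]; exact ⟨ha, hb⟩
        have := h'.conc.ge_on_segment haA hbA hseg
        simp only [Fx, indicator_of_mem haA, indicator_of_mem hbA, indicator_of_mem hx]
        rcases min_le_iff.1 this with h1 | h1
        · exact (min_le_left _ _).trans (pow_le_pow_left₀ (h'.nn _ haA) h1 D)
        · exact (min_le_right _ _).trans (pow_le_pow_left₀ (h'.nn _ hbA) h1 D)
      · refine (min_le_right _ _).trans ?_
        have : Fx A' (fun s => γ ((s + w) / k)) D b = 0 := indicator_of_notMem hbA _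
        exact this.le.trans (Fx_nn D h'.nn x)
    · refine (min_le_left _ _).trans ?_
      have : Fx A' (fun s => γ ((s + w) / k)) D a = 0 := indicator_of_notMem haA _
      exact this.le.trans (Fx_nn D h'.nn x)

lemma slb {α β : ℝ} {γ : ℝ → ℝ} {M : ℝ} (h : Sl (Icc α β) γ M) (hM : 1 ≤ M) (D : ℕ) {k : ℝ} (hk : 0 < k) (w : ℝ)
    {δ δ' : ℝ} (hδ' : 0 < δ') (hδ : k * δ' + 1 ≤ k * δ) (hT : k * δ + 1 ≤ k * (β - α) / 2) :
    ∑' m : ℤ, Fx (Icc α β) γ D ((m + w) / k) - k * ∫ x, Fx (Icc α β) γ D x ≤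
      1 / (2 * δ) * ((∫ x, Fx (Icc α β) γ D x) - ∫ x in (α + δ)..(β - δ), Fx (Icc α β) γ D x) +
      2 * lerr D M (k * (β - α) / 2 - 1) (k * (β - α)) (k * δ) (k * δ') := by
  have h' := h.aff hk w
  have es : {s | (s + w) / k ∈ Icc α β} = Icc (k * α - w) (k * β - w) := by
    ext s
    simp only [mem_Icc, mem_ofPred_eq, le_div_iff₀ hk, div_le_iff₀ hk]
    constructor <;> rintro ⟨h1, h2⟩ <;> constructor <;> linarith
  have eF : ∀ s, Fx (Icc (k * α - w) (k * β - w)) (fun s => γ ((s + w) / k)) D s = Fx (Icc α β) γ D ((s + w) / k) := by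
    rw [← es]; intro s; rfl
  rw [es] at h'
  have H := twoside D h' hM (δ := k * δ) (δ' := k * δ') (by positivity) hδ (by linarith)
  simp only [eF] at H
  rw [aff_int (Fx (Icc α β) γ D) hk w] at H
  have ei : ∫ s in (k * α - w + k * δ)..(k * β - w - k * δ), Fx (Icc α β) γ D ((s + w) / k) =
      k * ∫ s in (α + δ)..(β - δ), Fx (Icc α β) γ D s := by
    have := intervalIntegral.integral_comp_add_right (a := k * α - w + k * δ) (b := k * β - w - k * δ)
      (fun s => Fx (Icc α β) γ D (s / k)) w
    rw [this, intervalIntegral.integral_comp_div _ hk.ne', smul_eq_mul]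
    congr 2 <;> (field_simp; ring)
  rw [ei] at H
  have e5 : k * β - w - (k * α - w) = k * (β - α) := by ring
  rw [e5] at H
  have e6 : 1 / (2 * (k * δ)) * ((k * ∫ x, Fx (Icc α β) γ D x) - k * ∫ x in (α + δ)..(β - δ), Fx (Icc α β) γ D x)
    = 1 / (2 * δ) * ((∫ x, Fx (Icc α β) γ D x) - ∫ x in (α + δ)..(β - δ), Fx (Icc α β) γ D x) := by
    field_simp
  rw [e6] at H
  linarith

/-- lattice point -/
def pt {d : ℕ} (w : Fin d → ℝ) (k : ℝ) (z : Fin d → ℤ) : Fin d → ℝ := fun i => (z i + w i) / k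

/-- lattice sum -/
def U {d : ℕ} (F : (Fin d → ℝ) → ℝ) (w : Fin d → ℝ) (k : ℝ) : ℝ := ∑' z : Fin d → ℤ, F (pt w k z)

/-- bounded support -/
def Bs {d : ℕ} (F : (Fin d → ℝ) → ℝ) : Prop := ∃ R : ℝ, ∀ x, F x ≠ 0 → ∀ i, |x i| ≤ R

/-- indicator -/
def one {d : ℕ} (S : Set (Fin d → ℝ)) : (Fin d → ℝ) → ℝ := Fx S (fun _ => 1) 0

lemma one_mem {d : ℕ} {S : Set (Fin d → ℝ)} {x : Fin d → ℝ} (h : x ∈ S) : one S x = 1 := by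
  simp [one, Fx, h]

lemma one_not {d : ℕ} {S : Set (Fin d → ℝ)} {x : Fin d → ℝ} (h : x ∉ S) : one S x = 0 := by
  simp [one, Fx, h]

lemma one_nn {d : ℕ} (S : Set (Fin d → ℝ)) (x : Fin d → ℝ) : 0 ≤ one S x := by
  by_cases h : x ∈ S
  · rw [one_mem h]; exact zero_le_one
  · rw [one_not h]

lemma Bs.sum {d : ℕ} {F : (Fin d → ℝ) → ℝ} (h : Bs F) (w : Fin d → ℝ) {k : ℝ} (hk : 0 < k) :
    Summable (fun z : Fin d → ℤ => F (pt w k z)) := by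
  obtain ⟨R, hR⟩ := h
  refine summable_of_ne_finset_zero (s := Fintype.piFinset fun i =>
    Finset.Icc ⌈-(k * R) - w i⌉ ⌊k * R - w i⌋) fun z hz => ?_
  by_contra hne
  apply hz
  rw [Fintype.mem_piFinset]
  intro i
  have := hR _ hne i
  unfold pt at this
  rw [abs_div, abs_of_pos hk, div_le_iff₀ hk, abs_le] at this
  rw [Finset.mem_Icc, Int.ceil_le, Int.le_floor]
  constructor <;> linarith [this.1, this.2]

lemma Bs.of_le {d : ℕ} {F G : (Fin d → ℝ) → ℝ} (h : Bs F) (hG : ∀ x, F x = 0 → G x = 0) : Bs G := by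
  obtain ⟨R, hR⟩ := h
  exact ⟨R, fun x hx => hR x fun h0 => hx (hG x h0)⟩

lemma Bs.add {d : ℕ} {F G : (Fin d → ℝ) → ℝ} (hF : Bs F) (hG : Bs G) : Bs (fun x => F x + G x) := by
  obtain ⟨R, hR⟩ := hF
  obtain ⟨R', hR'⟩ := hG
  refine ⟨max R R', fun x hx i => ?_⟩
  by_cases h : F x = 0
  · have : G x ≠ 0 := by
      intro h'; apply hx; simp [h, h']
    exact (hR' x this i).trans (le_max_right _ _)
  · exact (hR x h i).trans (le_max_left _ _)

lemma Bs.mul {d : ℕ} {F : (Fin d → ℝ) → ℝ} (hF : Bs F) (c : ℝ) : Bs (fun x => c * F x) :=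
  hF.of_le fun x hx => by simp [hx]

lemma U_add {d : ℕ} {F G : (Fin d → ℝ) → ℝ} (hF : Bs F) (hG : Bs G) (w : Fin d → ℝ) {k : ℝ} (hk : 0 < k) :
    U (fun x => F x + G x) w k = U F w k + U G w k :=
  (hF.sum w hk).tsum_add (hG.sum w hk)

lemma U_mul {d : ℕ} (F : (Fin d → ℝ) → ℝ) (c : ℝ) (w : Fin d → ℝ) (k : ℝ) :
    U (fun x => c * F x) w k = c * U F w k := tsum_mul_left

lemma U_mono {d : ℕ} {F G : (Fin d → ℝ) → ℝ} (hF : Bs F) (hG : Bs G) (w : Fin d → ℝ) {k : ℝ} (hk : 0 < k)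
    (h : ∀ x, F x ≤ G x) : U F w k ≤ U G w k :=
  (hF.sum w hk).tsum_le_tsum (fun _ => h _) (hG.sum w hk)

lemma Good.bs {d : ℕ} {S : Set (Fin d → ℝ)} {g : (Fin d → ℝ) → ℝ} {M : ℝ} (h : Good S g M) (D : ℕ) :
    Bs (Fx S g D) := by
  obtain ⟨R, _, hR⟩ := bdd_coord h.cpt
  refine ⟨R, fun x hx => hR x ?_⟩
  by_contra hc
  exact hx (indicator_of_notMem hc _)

lemma Good.bs1 {d : ℕ} {S : Set (Fin d → ℝ)} {g : (Fin d → ℝ) → ℝ} {M : ℝ} (h : Good S g M) :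
    Bs (Paper.one S) := h.one'.bs 0

/-- line sum -/
def ls {d : ℕ} (F : (Fin (d + 1) → ℝ) → ℝ) (w k : ℝ) (y : Fin d → ℝ) : ℝ := ∑' m : ℤ, F (cn ((m + w) / k) y)

/-- line integral -/
def li {d : ℕ} (F : (Fin (d + 1) → ℝ) → ℝ) (y : Fin d → ℝ) : ℝ := ∫ t, F (cn t y)

lemma Bs.line {d : ℕ} {F : (Fin (d + 1) → ℝ) → ℝ} (h : Bs F) :
    ∃ R : ℝ, ∀ y : Fin d → ℝ, (∃ i, R < |y i|) → ∀ t, F (cn t y) = 0 := by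
  obtain ⟨R, hR⟩ := h
  refine ⟨R, fun y ⟨i, hi⟩ t => ?_⟩
  by_contra hc
  have := hR _ hc i.succ
  rw [cn_succ] at this
  linarith

lemma Bs.ls {d : ℕ} {F : (Fin (d + 1) → ℝ) → ℝ} (h : Bs F) (w k : ℝ) : Bs (ls F w k) := by
  obtain ⟨R, hR⟩ := h.line
  refine ⟨R, fun y hy i => ?_⟩
  by_contra hc
  exact hy (by simp [Paper.ls, hR y ⟨i, not_le.1 hc⟩])

lemma Bs.li {d : ℕ} {F : (Fin (d + 1) → ℝ) → ℝ} (h : Bs F) : Bs (li F) := by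
  obtain ⟨R, hR⟩ := h.line
  refine ⟨R, fun y hy i => ?_⟩
  by_contra hc
  exact hy (by simp [Paper.li, hR y ⟨i, not_le.1 hc⟩])

lemma U_split {d : ℕ} {F : (Fin (d + 1) → ℝ) → ℝ} (h : Bs F) (w : Fin (d + 1) → ℝ) {k : ℝ} (hk : 0 < k) :
    U F w k = U (ls F (w 0) k) (fun i => w i.succ) k := by
  let e : (Fin d → ℤ) × ℤ ≃ (Fin (d + 1) → ℤ) := (Equiv.prodComm _ _).trans (Fin.consEquiv fun _ => ℤ)
  have hs : Summable fun p : (Fin d → ℤ) × ℤ => F (pt w k (e p)) := e.summable_iff.2 (h.sum w hk)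
  have hpt : ∀ p : (Fin d → ℤ) × ℤ, pt w k (e p) = cn ((p.2 + w 0) / k) (pt (fun i => w i.succ) k p.1) := by
    intro p
    ext i
    refine Fin.cases ?_ (fun j => ?_) i <;> simp [pt, e, Fin.consEquiv]
  unfold U
  rw [← e.tsum_eq, hs.tsum_prod]
  refine tsum_congr fun y => ?_
  unfold ls
  refine tsum_congr fun m => ?_
  rw [hpt]

lemma line_a {d : ℕ} {S : Set (Fin (d + 1) → ℝ)} {g : (Fin (d + 1) → ℝ) → ℝ} {M : ℝ} (h : Good S g M) (D : ℕ)
    {k : ℝ} (hk : 0 < k) (w : ℝ) (y : Fin d → ℝ) :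
    |ls (Fx S g D) w k y - k * li (Fx S g D) y| ≤ M ^ D * one (mS S) y := by
  by_cases hy : y ∈ mS S
  · rw [one_mem hy, mul_one]
    exact sla (h.sl y) h.one D hk w
  · have : ∀ t, Fx S g D (cn t y) = 0 := fun t => indicator_of_notMem (fun h => hy ⟨t, h⟩) _
    simp [ls, li, this, one_not hy]

lemma U_step {d : ℕ} {F : (Fin (d + 1) → ℝ) → ℝ} (h : Bs F) (w : Fin (d + 1) → ℝ) {k : ℝ} (hk : 0 < k)
    {H : (Fin d → ℝ) → ℝ} (hH : Bs H) (hle : ∀ y, ls F (w 0) k y - k * li F y ≤ H y) :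
    U F w k - k * U (li F) (fun i => w i.succ) k ≤ U H (fun i => w i.succ) k := by
  rw [U_split h w hk, ← U_mul, sub_le_iff_le_add, ← U_add hH (h.li.mul k) _ hk]
  exact U_mono (h.ls _ _) (hH.add (h.li.mul k)) _ hk fun y => by linarith [hle y]

lemma U_step' {d : ℕ} {F : (Fin (d + 1) → ℝ) → ℝ} (h : Bs F) (w : Fin (d + 1) → ℝ) {k : ℝ} (hk : 0 < k)
    {H : (Fin d → ℝ) → ℝ} (hH : Bs H) (hle : ∀ y, -H y ≤ ls F (w 0) k y - k * li F y) :
    -U H (fun i => w i.succ) k ≤ U F w k - k * U (li F) (fun i => w i.succ) k := by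
  rw [U_split h w hk, ← U_mul, neg_le_sub_iff_le_add, ← U_add (h.ls _ _) hH _ hk]
  exact U_mono (h.li.mul k) ((h.ls _ _).add hH) _ hk fun y => by linarith [hle y]

lemma Good.li_eq {d : ℕ} {S : Set (Fin (d + 1) → ℝ)} {g : (Fin (d + 1) → ℝ) → ℝ} {M : ℝ} (h : Good S g M) (D : ℕ) :
    li (Fx S g D) = Fx (mS S) (mg S g D) (D + 1) := funext fun y => (h.mg_Fx D y).symm

lemma Good.li_int {d : ℕ} {S : Set (Fin (d + 1) → ℝ)} {g : (Fin (d + 1) → ℝ) → ℝ} {M : ℝ} (h : Good S g M) (D : ℕ) :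
    ∫ y, li (Fx S g D) y = ∫ x, Fx S g D x := (fub (h.int D)).symm

lemma int_zero_dim (F : (Fin 0 → ℝ) → ℝ) (x : Fin 0 → ℝ) : ∫ x, F x = F x := by
  have : F = fun _ => F x := funext fun y => by rw [Subsingleton.elim y x]
  rw [this]
  simp [Measure.real, volume_pi]

lemma U_zero_dim (F : (Fin 0 → ℝ) → ℝ) (w x : Fin 0 → ℝ) (k : ℝ) : U F w k = F x := by
  unfold U
  rw [tsum_eq_single (0 : Fin 0 → ℤ) (fun b hb => (hb (Subsingleton.elim _ _)).elim),
    Subsingleton.elim (pt w k 0) x]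

open Topology in
lemma riem : ∀ (d : ℕ) (S : Set (Fin d → ℝ)) (g : (Fin d → ℝ) → ℝ) (M : ℝ), Good S g M → ∀ (D : ℕ) (w : Fin d → ℝ),
    Tendsto (fun k : ℝ => U (Fx S g D) w k / k ^ d) atTop (𝓝 (∫ x, Fx S g D x)) := by
  intro d
  induction d with
  | zero =>
    intro S g M h D w
    simp only [U_zero_dim _ w 0, int_zero_dim _ 0, pow_zero, div_one]
    exact tendsto_const_nhds
  | succ d ih =>
    intro S g M h D w
    set w' : Fin d → ℝ := fun i => w i.succ with hw'
    obtain ⟨M', h'⟩ := h.mgood D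
    have t1 := ih _ _ _ h' (D + 1) w'
    have t2 := ih _ _ _ h'.one' 0 w'
    rw [← h.li_eq, h.li_int] at t1
    have hz : Tendsto (fun k : ℝ => U (Fx S g D) w k / k ^ (d + 1) - U (li (Fx S g D)) w' k / k ^ d) atTop (𝓝 0) := by
      have t3 : Tendsto (fun k : ℝ => M ^ D * (U (one (mS S)) w' k / k ^ d) * k⁻¹) atTop (𝓝 0) := by
        have := (t2.const_mul (M ^ D)).mul tendsto_inv_atTop_zero
        rw [mul_zero] at this
        exact this
      refine squeeze_zero_norm' ?_ t3
      filter_upwards [eventually_gt_atTop 0] with k hk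
      have b1 := U_step (h.bs D) w hk (H := fun y => M ^ D * one (mS S) y) (h'.bs1.mul _)
        fun y => (abs_le.1 (line_a h D hk (w 0) y)).2
      have b2 := U_step' (h.bs D) w hk (H := fun y => M ^ D * one (mS S) y) (h'.bs1.mul _)
        fun y => (abs_le.1 (line_a h D hk (w 0) y)).1
      rw [U_mul] at b1 b2
      have e : U (Fx S g D) w k / k ^ (d + 1) - U (li (Fx S g D)) w' k / k ^ d =
        (U (Fx S g D) w k - k * U (li (Fx S g D)) w' k) / k ^ (d + 1) := by field_simp; ring
      have e' : M ^ D * (U (one (mS S)) w' k / k ^ d) * k⁻¹ = (M ^ D * U (one (mS S)) w' k) / k ^ (d + 1) := by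
        field_simp; ring
      rw [e, e', Real.norm_eq_abs, abs_div, abs_of_pos (pow_pos hk _)]
      gcongr
      exact abs_le.2 ⟨b2, b1⟩
    have := hz.add t1
    simpa using this

lemma lerr_mono {D : ℕ} {M L L' T T' δ δ' : ℝ} (hM : 0 ≤ M) (hL : 0 < L) (hL' : L ≤ L') (hT : T' ≤ T)
    (hδ : 0 < δ) (hδ' : 0 < δ') : lerr D M L' T' δ δ' ≤ lerr D M L T δ δ' := by
  unfold lerr
  gcongr

lemma line_b {d : ℕ} {S : Set (Fin (d + 1) → ℝ)} {g : (Fin (d + 1) → ℝ) → ℝ} {M : ℝ} (h : Good S g M) (D : ℕ)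
    {σ ρ R : ℝ} (hσ : 0 < σ) (hp : cn σ 0 ∈ S) (hm : cn (-σ) 0 ∈ S) (hρ : 0 < ρ) (hρ1 : ρ < 1)
    (hR : ∀ x ∈ S, ∀ i, |x i| ≤ R)
    {k : ℝ} (hk : 0 < k) (hk1 : k * (ρ ^ 4 * σ) + 1 ≤ k * (ρ ^ 2 * σ)) (hk2 : k * (ρ ^ 2 * σ) + 1 ≤ k * (ρ * σ))
    (w : ℝ) (y : Fin d → ℝ) (hy : y ∈ (1 - ρ) • mS S) :
    ls (Fx S g D) w k y - k * li (Fx S g D) y ≤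
      1 / (2 * (ρ ^ 2 * σ)) * (li (Fx S g D) y - li (Fx ((1 - ρ ^ 2) • S) g D) y) +
      2 * lerr D M (k * (ρ * σ) - 1) (2 * k * R) (k * (ρ ^ 2 * σ)) (k * (ρ ^ 4 * σ)) := by
  have hρ2 : ρ ^ 2 < 1 := by nlinarith
  have hρ2p : 0 < ρ ^ 2 := by positivity
  -- the slice is an interval
  have hslc : IsCompact (sl S y) := by
    have hcl : IsClosed (sl S y) := by
      refine h.cpt.isClosed.preimage (f := fun t => cn t y) ?_
      exact cn_cont.comp (Continuous.prodMk continuous_id continuous_const)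
    exact Metric.isCompact_of_isClosed_isBounded hcl (h.sl y).bdd
  obtain ⟨_, ⟨t', ht'⟩, hyy⟩ := hy
  rename_i y'
  simp only at hyy
  have mem1 : ∀ s, |s| ≤ ρ * σ → cn ((1 - ρ) * t' + s) y ∈ S := by
    intro s hs
    have hsσ : |s / ρ| ≤ σ := by rw [abs_div, abs_of_pos hρ, div_le_iff₀ hρ]; linarith
    obtain ⟨h1, h2⟩ := abs_le.1 hsσ
    have : cn (s / ρ) 0 ∈ S := by
      have := h.conv hm hp (a := (1 - s / ρ / σ) / 2) (b := (1 + s / ρ / σ) / 2) (by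
        have : s / ρ / σ ≤ 1 := by rw [div_le_one hσ]; exact h2
        linarith) (by
        have : -1 ≤ s / ρ / σ := by rw [le_div_iff₀ hσ]; linarith
        linarith) (by ring)
      rw [cn_comb] at this
      convert this using 2
      · field_simp; ring
      · simp
    have := h.conv ht' this (show 0 ≤ 1 - ρ by linarith) hρ.le (by ring)
    rw [cn_comb] at this
    convert this using 2
    · field_simp
    · rw [← hyy]; simp
  have hne : (sl S y).Nonempty := ⟨(1 - ρ) * t' + 0, mem1 0 (by simp; positivity)⟩
  obtain ⟨α, hα⟩ : ∃ α, α = sInf (sl S y) := ⟨_, rfl⟩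
  obtain ⟨β, hβ⟩ : ∃ β, β = sSup (sl S y) := ⟨_, rfl⟩
  have hab : sl S y = Icc α β := by
    rw [hα, hβ]
    exact eq_Icc_of_connected_compact ⟨hne, (h.sl y).conv.isPreconnected⟩ hslc
  have hmem : ∀ t, cn t y ∈ S ↔ t ∈ Icc α β := fun t => by rw [← hab]; rfl
  have hlen : ρ * σ ≤ (β - α) / 2 := by
    have h1 := (hmem _).1 (mem1 (ρ * σ) (by rw [abs_of_pos (by positivity)]))
    have h2 := (hmem _).1 (mem1 (-(ρ * σ)) (by rw [abs_neg, abs_of_pos (by positivity)]))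
    linarith [h1.2, h2.1]
  have hαβ : α ≤ β := by nlinarith
  have hαR : -R ≤ α := by
    have := hR _ ((hmem α).2 ⟨le_rfl, hαβ⟩) 0
    exact (abs_le.1 this).1
  have hβR : β ≤ R := by
    have := hR _ ((hmem β).2 ⟨hαβ, le_rfl⟩) 0
    exact (abs_le.1 this).2
  have hS := h.sl y
  rw [hab] at hS
  have eF : ∀ t, Fx S g D (cn t y) = Fx (Icc α β) (fun t => g (cn t y)) D t := fun t => by
    rw [Fx_sl, hab]
  have hl1 : k * (ρ * σ) ≤ k * ((β - α) / 2) := by gcongr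
  have key := slb hS h.one D hk w (δ := ρ ^ 2 * σ) (δ' := ρ ^ 4 * σ) (by positivity) hk1 (by linarith)
  simp only [← eF] at key
  have hlerr : lerr D M (k * (β - α) / 2 - 1) (k * (β - α)) (k * (ρ ^ 2 * σ)) (k * (ρ ^ 4 * σ)) ≤
      lerr D M (k * (ρ * σ) - 1) (2 * k * R) (k * (ρ ^ 2 * σ)) (k * (ρ ^ 4 * σ)) := by
    refine lerr_mono (by linarith [h.one]) ?_ ?_ ?_ (by positivity) (by positivity)
    · have : 0 < k * (ρ ^ 2 * σ) := by positivity
      linarith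
    · linarith
    · nlinarith
  have hint : li (Fx ((1 - ρ ^ 2) • S) g D) y ≤
      ∫ x in (α + ρ ^ 2 * σ)..(β - ρ ^ 2 * σ), Fx S g D (cn x y) := by
    have hle : α + ρ ^ 2 * σ ≤ β - ρ ^ 2 * σ := by nlinarith
    rw [intervalIntegral.integral_of_le hle, ← integral_Icc_eq_integral_Ioc,
      ← integral_indicator measurableSet_Icc]
    have hG := h.smul (r := 1 - ρ ^ 2) (by linarith) (by linarith)
    refine integral_mono ((hG.sl y).int D) (((h.sl y).int D).indicator measurableSet_Icc) fun t => ?_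
    by_cases ht : cn t y ∈ (1 - ρ ^ 2) • S
    · have htI : t ∈ Icc (α + ρ ^ 2 * σ) (β - ρ ^ 2 * σ) := by
        obtain ⟨x, hx, hxe⟩ := ht
        simp only at hxe
        have sh : ∀ s, cn s 0 ∈ S → cn (t + ρ ^ 2 * s) y ∈ S := by
          intro s hs
          have := h.conv hx hs (show 0 ≤ 1 - ρ ^ 2 by linarith) hρ2p.le (by ring)
          rw [hxe, cn_smul] at this
          convert this using 1
          ext i
          refine Fin.cases ?_ (fun j => ?_) i <;> simp
        have h1 := (hmem _).1 (sh _ hp)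
        have h2 := (hmem _).1 (sh _ hm)
        exact ⟨by linarith [h2.1], by linarith [h1.2]⟩
      have hts : cn t y ∈ S := h.smul_sub (by linarith) (by linarith) ht
      rw [indicator_of_mem htI]
      simp [Fx, ht, hts]
    · have : Fx ((1 - ρ ^ 2) • S) g D (cn t y) = 0 := indicator_of_notMem ht _
      simp only [this]
      exact indicator_nonneg (fun s _ => Fx_nn D h.nn _) t
  unfold ls
  have hc : 1 / (2 * (ρ ^ 2 * σ)) * (li (Fx S g D) y - ∫ x in (α + ρ ^ 2 * σ)..(β - ρ ^ 2 * σ), Fx S g D (cn x y)) ≤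
      1 / (2 * (ρ ^ 2 * σ)) * (li (Fx S g D) y - li (Fx ((1 - ρ ^ 2) • S) g D) y) := by
    gcongr
  have e0 : li (Fx S g D) y = ∫ t, Fx S g D (cn t y) := rfl
  rw [e0] at hc ⊢
  linarith

lemma mS_smul {d : ℕ} (S : Set (Fin (d + 1) → ℝ)) (r : ℝ) {y : Fin d → ℝ} {t : ℝ} (h : cn t y ∈ r • S) :
    y ∈ r • mS S := by
  obtain ⟨x, hx, hxe⟩ := h
  refine ⟨fun i => x i.succ, ⟨x 0, by rw [cn_self]; exact hx⟩, ?_⟩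
  ext i
  have := congrFun hxe i.succ
  simpa using this

lemma line_c {d : ℕ} {S : Set (Fin (d + 1) → ℝ)} {g : (Fin (d + 1) → ℝ) → ℝ} {M : ℝ} (h : Good S g M) (D : ℕ)
    {σ ρ R : ℝ} (hσ : 0 < σ) (hp : cn σ 0 ∈ S) (hm : cn (-σ) 0 ∈ S) (hρ : 0 < ρ) (hρ1 : ρ < 1)
    (hR : ∀ x ∈ S, ∀ i, |x i| ≤ R)
    {k : ℝ} (hk : 0 < k) (hk1 : k * (ρ ^ 4 * σ) + 1 ≤ k * (ρ ^ 2 * σ)) (hk2 : k * (ρ ^ 2 * σ) + 1 ≤ k * (ρ * σ))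
    (w : ℝ) (y : Fin d → ℝ) :
    ls (Fx S g D) w k y - k * li (Fx S g D) y ≤
      1 / (2 * (ρ ^ 2 * σ)) * (Fx ((1 - ρ ^ 2) • mS S) (mg S g D) (D + 1) y +
        (-1) * li (Fx ((1 - ρ ^ 2) • S) g D) y) +
      ((2 * lerr D M (k * (ρ * σ) - 1) (2 * k * R) (k * (ρ ^ 2 * σ)) (k * (ρ ^ 4 * σ))) * one (mS S) y +
      M ^ D * (one (mS S) y + (-1) * one ((1 - ρ) • mS S) y)) := by
  have hρ2 : ρ ^ 2 < 1 := by nlinarith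
  have hρ2p : 0 < ρ ^ 2 := by positivity
  have hM : 0 ≤ M := by linarith [h.one]
  obtain ⟨M', h'⟩ := h.mgood D
  have hL : 0 < k * (ρ * σ) - 1 := by
    have : 0 < k * (ρ ^ 2 * σ) := by positivity
    linarith
  have hR0 : 0 ≤ R := (abs_nonneg _).trans (hR _ h.mem0 0)
  have hlerr : 0 ≤ lerr D M (k * (ρ * σ) - 1) (2 * k * R) (k * (ρ ^ 2 * σ)) (k * (ρ ^ 4 * σ)) := by
    unfold lerr
    positivity
  by_cases hy : y ∈ (1 - ρ) • mS S
  · have hyS : y ∈ mS S := h'.smul_sub (by linarith) (by linarith) hy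
    have hyS2 : y ∈ (1 - ρ ^ 2) • mS S := by
      have hh := (h'.smul (r := 1 - ρ ^ 2) (by linarith) (by linarith)).smul_sub (r := (1 - ρ) / (1 - ρ ^ 2))
        (div_nonneg (by linarith) (by linarith)) (by rw [div_le_one (by linarith)]; nlinarith)
      apply hh
      rw [smul_smul, div_mul_cancel₀ _ (by linarith)]
      exact hy
    have e1 : Fx ((1 - ρ ^ 2) • mS S) (mg S g D) (D + 1) y = li (Fx S g D) y := by
      rw [h.li_eq]; simp [Fx, hyS, hyS2]
    have := line_b h D hσ hp hm hρ hρ1 hR hk hk1 hk2 w y hy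
    rw [e1, one_mem hy, one_mem hyS]
    linarith
  · have h1 := (abs_le.1 (line_a h D hk w y)).2
    rw [one_not hy]
    have h2 := mul_nonneg (mul_nonneg zero_le_two hlerr) (one_nn (mS S) y)
    have h3 : li (Fx ((1 - ρ ^ 2) • S) g D) y ≤ Fx ((1 - ρ ^ 2) • mS S) (mg S g D) (D + 1) y := by
      by_cases hy2 : y ∈ (1 - ρ ^ 2) • mS S
      · have hyS : y ∈ mS S := h'.smul_sub (by linarith) (by linarith) hy2
        have e1 : Fx ((1 - ρ ^ 2) • mS S) (mg S g D) (D + 1) y = li (Fx S g D) y := by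
          rw [h.li_eq]; simp [Fx, hyS, hy2]
        rw [e1]
        have hG := h.smul (r := 1 - ρ ^ 2) (by linarith) (by linarith)
        refine integral_mono ((hG.sl y).int D) ((h.sl y).int D) fun t => ?_
        by_cases ht : cn t y ∈ (1 - ρ ^ 2) • S
        · have hts : cn t y ∈ S := h.smul_sub (by linarith) (by linarith) ht
          simp [Fx, ht, hts]
        · have : Fx ((1 - ρ ^ 2) • S) g D (cn t y) = 0 := indicator_of_notMem ht _
          simp only [this]
          exact Fx_nn D h.nn _
      · have : ∀ t, Fx ((1 - ρ ^ 2) • S) g D (cn t y) = 0 := fun t =>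
          indicator_of_notMem (fun ht => hy2 (mS_smul S _ ht)) _
        simp only [li, this, integral_zero]
        exact Fx_nn _ (fun x hx => h.mg_nn D x) _
    have h4 : 0 ≤ 1 / (2 * (ρ ^ 2 * σ)) * (Fx ((1 - ρ ^ 2) • mS S) (mg S g D) (D + 1) y +
        (-1) * li (Fx ((1 - ρ ^ 2) • S) g D) y) := by
      apply mul_nonneg (by positivity)
      linarith
    linarith

lemma lerr_le {D : ℕ} {M ρ σ R k : ℝ} (hM : 1 ≤ M) (hρ : 0 < ρ) (hρ1 : ρ < 1) (hσ : 0 < σ) (hk : 0 < k)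
    (h1 : 1 ≤ k * (ρ ^ 4 * σ)) (h2 : 2 ≤ k * (ρ * σ))
    (h3 : (D : ℝ) ^ 2 * M ^ 2 * (2 * R) / (ρ ^ 9 * σ ^ 2) ≤ k) :
    lerr D M (k * (ρ * σ) - 1) (2 * k * R) (k * (ρ ^ 2 * σ)) (k * (ρ ^ 4 * σ)) ≤ ρ * ((5 * D + 2) * M ^ D) := by
  have hMp : 0 < M := by linarith
  unfold lerr
  have a1 : (D : ℝ) ^ 2 * M ^ (D + 2) * (2 * k * R) / (k * (ρ ^ 4 * σ)) ^ 2 ≤ ρ * M ^ D := by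
    rw [div_le_iff₀ (by positivity)]
    rw [div_le_iff₀ (by positivity)] at h3
    calc (D : ℝ) ^ 2 * M ^ (D + 2) * (2 * k * R) = ((D : ℝ) ^ 2 * M ^ 2 * (2 * R)) * (k * M ^ D) := by ring
      _ ≤ k * (ρ ^ 9 * σ ^ 2) * (k * M ^ D) := by gcongr
      _ = _ := by ring
  have hh : k * (ρ * σ) / 2 ≤ k * (ρ * σ) - 1 := by linarith
  have hhp : 0 < k * (ρ * σ) / 2 := by positivity
  have a2 : (k * (ρ ^ 4 * σ) + 1) * (D * M ^ D / (k * (ρ * σ) - 1)) ≤ 4 * ρ * D * M ^ D := by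
    calc _ ≤ (2 * (k * (ρ ^ 4 * σ))) * (D * M ^ D / (k * (ρ * σ) / 2)) := by
          have hpos : 0 < k * (ρ * σ) - 1 := by linarith
          gcongr
          linarith
      _ = 4 * D * M ^ D * ρ ^ 3 := by field_simp; ring
      _ ≤ 4 * D * M ^ D * ρ := by
          gcongr
          nlinarith [sq_nonneg ρ, mul_pos hρ hρ]
      _ = _ := by ring
  have a3 : M ^ D * (k * (ρ ^ 4 * σ) + 1) / (k * (ρ ^ 2 * σ)) ≤ 2 * ρ * M ^ D := by
    calc _ ≤ M ^ D * (2 * (k * (ρ ^ 4 * σ))) / (k * (ρ ^ 2 * σ)) := by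
          gcongr
          linarith
      _ = 2 * M ^ D * ρ ^ 2 := by field_simp
      _ ≤ 2 * M ^ D * ρ := by gcongr; nlinarith
      _ = _ := by ring
  have a4 : D * M ^ D * (k * (ρ ^ 2 * σ)) / (k * (ρ * σ) - 1) ≤ 2 * ρ * D * M ^ D := by
    calc _ ≤ D * M ^ D * (k * (ρ ^ 2 * σ)) / (k * (ρ * σ) / 2) := by gcongr
      _ = _ := by field_simp
  linarith

lemma one_smul_int {d : ℕ} (S : Set (Fin d → ℝ)) {r : ℝ} (hr : 0 < r) :
    ∫ x, one (r • S) x = r ^ d * ∫ x, one S x := by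
  unfold one
  rw [scale_int S _ 0 hr]
  rfl

open Topology in
lemma step7 {d : ℕ} {S : Set (Fin (d + 1) → ℝ)} {g : (Fin (d + 1) → ℝ) → ℝ} {M : ℝ} (h : Good S g M) (D : ℕ)
    {σ : ℝ} (hσ : 0 < σ) (hp : cn σ 0 ∈ S) (hm : cn (-σ) 0 ∈ S) (w : Fin (d + 1) → ℝ) {η : ℝ} (hη : 0 < η) :
    ∀ᶠ ρ : ℝ in 𝓝[>] 0, ∀ᶠ k : ℝ in atTop,
      k * (U (Fx S g D) w k / k ^ (d + 1) - U (li (Fx S g D)) (fun i => w i.succ) k / k ^ d) ≤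
      1 / (2 * (ρ ^ 2 * σ)) * ((∫ y, Fx ((1 - ρ ^ 2) • mS S) (mg S g D) (D + 1) y) -
        ∫ x, Fx ((1 - ρ ^ 2) • S) g D x) + η := by
  set w' : Fin d → ℝ := fun i => w i.succ with hw'
  obtain ⟨M', h'⟩ := h.mgood D
  obtain ⟨R, hR0, hR⟩ := bdd_coord h.cpt
  set V := ∫ y, one (mS S) y with hV
  set C := (5 * (D : ℝ) + 2) * M ^ D with hC
  have small : ∀ᶠ ρ : ℝ in 𝓝[>] 0, 2 * (ρ * C) * V + M ^ D * (V + (-1) * ((1 - ρ) ^ d * V)) < η := by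
    have hcont : Continuous fun ρ : ℝ => 2 * (ρ * C) * V + M ^ D * (V + (-1) * ((1 - ρ) ^ d * V)) := by fun_prop
    have := hcont.tendsto 0
    simp only [zero_mul, mul_zero, sub_zero, one_pow, one_mul, zero_add] at this
    have h0 : M ^ D * (V + -1 * V) = 0 := by ring
    rw [h0] at this
    exact (this.mono_left nhdsWithin_le_nhds).eventually (gt_mem_nhds hη)
  have lt1 : ∀ᶠ ρ : ℝ in 𝓝[>] 0, ρ < 1 := nhdsWithin_le_nhds (gt_mem_nhds one_pos)
  filter_upwards [small, lt1, self_mem_nhdsWithin] with ρ hs hρ1 hρ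
  have hρ : 0 < ρ := hρ
  have hρ2 : ρ ^ 2 < 1 := by nlinarith
  have hρ2p : 0 < ρ ^ 2 := by positivity
  have G1 := h.smul (r := 1 - ρ ^ 2) (by linarith) (by linarith)
  have G2 := h'.smul (r := 1 - ρ ^ 2) (by linarith) (by linarith)
  have G3 := h'.smul (r := 1 - ρ) (by linarith) (by linarith)
  obtain ⟨M'', G1'⟩ := G1.mgood D
  have t1 := riem d _ _ _ G2 (D + 1) w'
  have t2 := riem d _ _ _ G1' (D + 1) w'
  rw [← G1.li_eq, G1.li_int] at t2
  have t3 := riem d _ _ _ h'.one' 0 w'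
  have t4 := riem d _ _ _ G3.one' 0 w'
  have t := (((t1.add (t2.const_mul (-1))).const_mul (1 / (2 * (ρ ^ 2 * σ)))).add
    ((t3.const_mul (2 * (ρ * C))).add ((t3.add (t4.const_mul (-1))).const_mul (M ^ D))))
  have lim : 1 / (2 * (ρ ^ 2 * σ)) * ((∫ y, Fx ((1 - ρ ^ 2) • mS S) (mg S g D) (D + 1) y) +
        (-1) * ∫ x, Fx ((1 - ρ ^ 2) • S) g D x) + (2 * (ρ * C) * (∫ y, Fx (mS S) (fun _ => 1) 0 y) +
        M ^ D * ((∫ y, Fx (mS S) (fun _ => 1) 0 y) + (-1) * ∫ y, Fx ((1 - ρ) • mS S) (fun _ => 1) 0 y)) <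
      1 / (2 * (ρ ^ 2 * σ)) * ((∫ y, Fx ((1 - ρ ^ 2) • mS S) (mg S g D) (D + 1) y) -
        ∫ x, Fx ((1 - ρ ^ 2) • S) g D x) + η := by
    have e1 := one_smul_int (mS S) (r := 1 - ρ) (by linarith)
    have e2 : (∫ y, Fx (mS S) (fun _ => 1) 0 y) = V := rfl
    have e3 : (∫ y, Fx ((1 - ρ) • mS S) (fun _ => 1) 0 y) = (1 - ρ) ^ d * V := e1
    rw [e2, e3]
    linarith
  have ev := t.eventually (gt_mem_nhds lim)
  have k1 := eventually_ge_atTop (1 / (ρ ^ 4 * σ))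
  have k2 := eventually_ge_atTop (2 / (ρ * σ))
  have k3 := eventually_ge_atTop ((D : ℝ) ^ 2 * M ^ 2 * (2 * R) / (ρ ^ 9 * σ ^ 2))
  have k4 := eventually_ge_atTop (1 / ((ρ ^ 2 - ρ ^ 4) * σ))
  have k5 := eventually_ge_atTop (1 / ((ρ - ρ ^ 2) * σ))
  have q1 : 0 < ρ ^ 2 - ρ ^ 4 := by nlinarith
  have q2 : 0 < ρ - ρ ^ 2 := by nlinarith
  filter_upwards [ev, k1, k2, k3, k4, k5, eventually_gt_atTop 0] with k hk b1 b2 b3 b4 b5 hk0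
  rw [div_le_iff₀ (by positivity)] at b1 b2 b4 b5
  refine le_trans ?_ hk.le
  have hl := lerr_le (D := D) h.one hρ hρ1 hσ hk0 b1 b2 b3
  have main := U_step (h.bs D) w hk0 (H := fun y => 1 / (2 * (ρ ^ 2 * σ)) *
      (Fx ((1 - ρ ^ 2) • mS S) (mg S g D) (D + 1) y + (-1) * li (Fx ((1 - ρ ^ 2) • S) g D) y) +
      ((2 * (ρ * C)) * one (mS S) y + M ^ D * (one (mS S) y + (-1) * one ((1 - ρ) • mS S) y)))
    ((((G2.bs (D + 1)).add ((G1.bs D).li.mul _)).mul _).add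
      ((h'.bs1.mul _).add ((h'.bs1.add (G3.bs1.mul _)).mul _))) (fun y => by
      refine (line_c h D hσ hp hm hρ hρ1 hR hk0 (by linarith) (by linarith) (w 0) y).trans ?_
      have := one_nn (mS S) y
      gcongr)
  rw [U_add (((G2.bs (D + 1)).add ((G1.bs D).li.mul _)).mul _)
      ((h'.bs1.mul _).add ((h'.bs1.add (G3.bs1.mul _)).mul _)) _ hk0, U_mul,
      U_add (G2.bs (D + 1)) ((G1.bs D).li.mul _) _ hk0, U_mul,
      U_add (h'.bs1.mul _) ((h'.bs1.add (G3.bs1.mul _)).mul _) _ hk0, U_mul, U_mul,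
      U_add h'.bs1 (G3.bs1.mul _) _ hk0, U_mul] at main
  have e : k * (U (Fx S g D) w k / k ^ (d + 1) - U (li (Fx S g D)) w' k / k ^ d) =
        (U (Fx S g D) w k - k * U (li (Fx S g D)) w' k) / k ^ d := by
    field_simp
    ring
  rw [e]
  refine (div_le_div_of_nonneg_right main (pow_nonneg hk0.le d)).trans (le_of_eq ?_)
  simp only [one]
  ring

lemma single_zero_cn {d : ℕ} (c : ℝ) : (Pi.single 0 c : Fin (d + 1) → ℝ) = cn c 0 := by
  ext i
  refine Fin.cases ?_ (fun j => ?_) i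
  · simp
  · simp [Pi.single_apply]

lemma single_succ_cn {d : ℕ} (j : Fin d) (c : ℝ) : (Pi.single j.succ c : Fin (d + 1) → ℝ) = cn 0 (Pi.single j c) := by
  ext i
  refine Fin.cases ?_ (fun l => ?_) i
  · simp [Pi.single_apply, (Fin.succ_ne_zero j).symm]
  · simp [Pi.single_apply]

lemma cen_slope {d : ℕ} {S : Set (Fin d → ℝ)} {g : (Fin d → ℝ) → ℝ} {M : ℝ} (h : Good S g M)
    {D : ℕ} (hc : Cen S g D) {ε : ℝ} (hε0 : 0 < ε) (hε1 : ε < 1) :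
    ((∫ x, Fx S g D x) - ∫ x, Fx ((1 - ε) • S) g D x) / ε ≤ d * ∫ x, Fx S g D x := by
  have h1 := h.centroid hc hε0 hε1
  have h2 := one_add_mul_le_pow (a := -ε) (by linarith) d
  have hI : 0 ≤ ∫ x, Fx S g D x := integral_nonneg fun x => Fx_nn D h.nn x
  have h3 := mul_le_mul_of_nonneg_right h2 hI
  rw [div_le_iff₀ hε0]
  rw [← sub_eq_add_neg] at h3
  nlinarith

open Topology in
lemma claim (N : ℝ) (hN : 0 < N) : ∀ (d : ℕ) (S : Set (Fin d → ℝ)) (g : (Fin d → ℝ) → ℝ) (M : ℝ), Good S g M →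
    ∀ (D : ℕ), Cen S g D → ∀ (l : Fin d → ℝ), Monotone l → (∀ j, 0 < l j) →
    (∀ j, Pi.single j (1 / (N * l j)) ∈ S) → (∀ j, Pi.single j (-(1 / (N * l j))) ∈ S) →
    ∀ μ : ℝ, 0 ≤ μ → (∀ j, μ ≤ l j) → ∀ (w : Fin d → ℝ) (η : ℝ), 0 < η →
    ∀ᶠ ρ : ℝ in 𝓝[>] 0, ∀ᶠ k : ℝ in atTop,
      k * (U (Fx S g D) w k / k ^ d - ∫ x, Fx S g D x) ≤
      N / 2 * (μ * (((∫ x, Fx S g D x) - ∫ x, Fx ((1 - ρ ^ 2) • S) g D x) / ρ ^ 2) +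
        ((∑ j, l j) - d * μ) * ∫ x, Fx S g D x) + η := by
  intro d
  induction d with
  | zero =>
    intro S g M h D hc l _ _ _ _ μ hμ _ w η hη
    have lt1 : ∀ᶠ ρ : ℝ in 𝓝[>] 0, ρ < 1 := nhdsWithin_le_nhds (gt_mem_nhds one_pos)
    filter_upwards [lt1, self_mem_nhdsWithin] with ρ hρ1 hρ
    have hρ : 0 < ρ := hρ
    have hρ2 : ρ ^ 2 < 1 := by nlinarith
    filter_upwards with k
    have e : Fx ((1 - ρ ^ 2) • S) g D = Fx S g D := by
      have h1 : (1 - ρ ^ 2) • S = S := by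
        have a := h.mem0
        have b := (h.smul (r := 1 - ρ ^ 2) (by linarith) (by nlinarith)).mem0
        ext x
        rw [Subsingleton.elim x 0]
        exact ⟨fun _ => a, fun _ => b⟩
      rw [h1]
    rw [e, U_zero_dim _ w 0, int_zero_dim _ 0]
    simp
    exact hη.le
  | succ d ih =>
    intro S g M h D hc l hl hl0 hp hm μ hμ0 hμ w η hη
    obtain ⟨M', h'⟩ := h.mgood D
    have hNl : 0 < N * l 0 := mul_pos hN (hl0 0)
    have s7 := step7 h D (σ := 1 / (N * l 0)) (by positivity) (by rw [← single_zero_cn]; exact hp 0)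
      (by rw [← single_zero_cn]; exact hm 0) w (half_pos hη)
    have I := ih (mS S) (mg S g D) M' h' (D + 1) (h.cen_marg hc) (fun j => l j.succ)
      (fun i j hij => hl (Fin.succ_le_succ_iff.2 hij)) (fun j => hl0 _)
      (fun j => ⟨0, by rw [← single_succ_cn]; exact hp _⟩) (fun j => ⟨0, by rw [← single_succ_cn]; exact hm _⟩)
      (l 0) (hl0 0).le (fun j => hl (Fin.zero_le _)) (fun i => w i.succ) _ (half_pos hη)
    have lt1 : ∀ᶠ ρ : ℝ in 𝓝[>] 0, ρ < 1 := nhdsWithin_le_nhds (gt_mem_nhds one_pos)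
    filter_upwards [s7, I, lt1, self_mem_nhdsWithin] with ρ hs hi hρ1 hρ
    have hρ : 0 < ρ := hρ
    have hρ2 : ρ ^ 2 < 1 := by nlinarith
    have hρ2p : 0 < ρ ^ 2 := by positivity
    have cs := cen_slope h hc hρ2p hρ2
    filter_upwards [hs, hi] with k a b
    rw [h.mg_integral] at b
    rw [← h.li_eq] at b
    set I0 := ∫ x, Fx S g D x
    set Φ := ∫ x, Fx ((1 - ρ ^ 2) • S) g D x
    set Φ' := ∫ y, Fx ((1 - ρ ^ 2) • mS S) (mg S g D) (D + 1) y
    rw [Fin.sum_univ_succ]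
    have e1 : 1 / (2 * (ρ ^ 2 * (1 / (N * l 0)))) * (Φ' - Φ) = N / 2 * (l 0 * ((Φ' - Φ) / ρ ^ 2)) := by
      field_simp
    rw [e1] at a
    have e2 : (Φ' - Φ) / ρ ^ 2 + (I0 - Φ') / ρ ^ 2 = (I0 - Φ) / ρ ^ 2 := by ring
    have key : 0 ≤ N / 2 * ((l 0 - μ) * ((d + 1 : ℕ) * I0 - (I0 - Φ) / ρ ^ 2)) := by
      apply mul_nonneg (by positivity)
      exact mul_nonneg (by linarith [hμ 0]) (by linarith)
    rw [← e2] at key ⊢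
    push_cast at key ⊢
    linarith

lemma sl_Icc {d : ℕ} {S : Set (Fin (d + 1) → ℝ)} {g : (Fin (d + 1) → ℝ) → ℝ} {M : ℝ} (h : Good S g M)
    {y : Fin d → ℝ} (hy : y ∈ mS S) : ∃ α β, α ≤ β ∧ ∀ t, cn t y ∈ S ↔ t ∈ Icc α β := by
  have hslc : IsCompact (sl S y) := by
    have hcl : IsClosed (sl S y) := by
      refine h.cpt.isClosed.preimage (f := fun t => cn t y) ?_
      exact cn_cont.comp (Continuous.prodMk continuous_id continuous_const)
    exact Metric.isCompact_of_isClosed_isBounded hcl (h.sl y).bdd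
  have hne : (sl S y).Nonempty := hy
  have hab : sl S y = Icc (sInf (sl S y)) (sSup (sl S y)) :=
    eq_Icc_of_connected_compact ⟨hne, (h.sl y).conv.isPreconnected⟩ hslc
  refine ⟨sInf (sl S y), sSup (sl S y), ?_, fun t => ?_⟩
  · rw [hab] at hne; exact nonempty_Icc.1 hne
  · change t ∈ sl S y ↔ _
    rw [← hab]

lemma li_one {d : ℕ} {S : Set (Fin (d + 1) → ℝ)} {y : Fin d → ℝ} {α β : ℝ} (h : α ≤ β)
    (hm : ∀ t, cn t y ∈ S ↔ t ∈ Icc α β) : li (Fx S (fun _ => 1) 0) y = β - α := by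
  have : ∀ t, Fx S (fun _ => (1 : ℝ)) 0 (cn t y) = (Icc α β).indicator (fun _ => 1) t := by
    intro t
    by_cases ht : t ∈ Icc α β
    · have := (hm t).2 ht
      simp [Fx, ht, this]
    · have : cn t y ∉ S := fun h => ht ((hm t).1 h)
      simp only [Fx, indicator_of_notMem this, indicator_of_notMem ht]
  unfold li
  simp only [this]
  rw [integral_indicator measurableSet_Icc]
  simp [h]

lemma topgap {d : ℕ} {S : Set (Fin (d + 1) → ℝ)} (h : Good S (fun _ => 1) 1) {a b ε : ℝ} (ha : 0 ≤ a) (hb : 0 ≤ b)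
    (h1 : cn a 0 ∈ S) (h2 : cn (-b) 0 ∈ S) (hε0 : 0 < ε) (hε1 : ε < 1) :
    ε * (a + b) * ((1 - ε) ^ d * ∫ y, one (mS S) y) ≤
      (∫ y, Fx ((1 - ε) • mS S) (mg S (fun _ => 1) 0) 1 y) - ∫ x, Fx ((1 - ε) • S) (fun _ => 1) 0 x := by
  obtain ⟨M', h'⟩ := h.mgood 0
  have G1 := h.smul (r := 1 - ε) (by linarith) (by linarith)
  have G2 := h'.smul (r := 1 - ε) (by linarith) (by linarith)
  obtain ⟨M'', G1'⟩ := G1.mgood 0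
  have i1 : Integrable fun y => ε * (a + b) * one ((1 - ε) • mS S) y := (G2.one'.int 0).const_mul _
  have i2 : Integrable fun y => li (Fx ((1 - ε) • S) (fun _ => 1) 0) y := by rw [G1.li_eq]; exact G1'.int 1
  rw [← one_smul_int _ (by linarith), ← G1.li_int, le_sub_iff_add_le, ← integral_const_mul, ← integral_add i1 i2]
  refine integral_mono (i1.add i2) (G2.int 1) fun y => ?_
  simp only
  by_cases hy : y ∈ (1 - ε) • mS S
  · have hyS : y ∈ mS S := h'.smul_sub (by linarith) (by linarith) hy
    have e1 : Fx ((1 - ε) • mS S) (mg S (fun _ => 1) 0) 1 y = li (Fx S (fun _ => 1) 0) y := by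
      rw [h.li_eq]; simp [Fx, hyS, hy]
    rw [e1, one_mem hy]
    obtain ⟨α, β, hαβ, hmem⟩ := sl_Icc h hyS
    have hy' : y ∈ mS ((1 - ε) • S) := by
      obtain ⟨y', ⟨t, ht⟩, rfl⟩ := hy
      exact ⟨(1 - ε) * t, by rw [← cn_smul]; exact smul_mem_smul_set ht⟩
    obtain ⟨α', β', hαβ', hmem'⟩ := sl_Icc G1 hy'
    rw [li_one hαβ hmem, li_one hαβ' hmem']
    have sh : ∀ t s, t ∈ Icc α' β' → cn s 0 ∈ S → t + ε * s ∈ Icc α β := by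
      intro t s ht hs
      rw [← hmem]
      obtain ⟨x, hx, hxe⟩ := (hmem' t).2 ht
      simp only at hxe
      have := h.conv hx hs (show 0 ≤ 1 - ε by linarith) hε0.le (by ring)
      rw [hxe, cn_smul] at this
      convert this using 1
      ext i
      refine Fin.cases ?_ (fun j => ?_) i <;> simp
    have q1 := (sh β' a ⟨hαβ', le_rfl⟩ h1).2
    have q2 := (sh α' (-b) ⟨le_rfl, hαβ'⟩ h2).1
    linarith
  · have : ∀ t, Fx ((1 - ε) • S) (fun _ => (1 : ℝ)) 0 (cn t y) = 0 := fun t =>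
      indicator_of_notMem (fun ht => hy (mS_smul S _ ht)) _
    rw [one_not hy]
    simp only [li, this, integral_zero]
    simp only [mul_zero, add_zero]
    exact Fx_nn _ (fun x _ => h.mg_nn 0 x) _

lemma one_pos' {d : ℕ} {S : Set (Fin d → ℝ)} {g : (Fin d → ℝ) → ℝ} {M : ℝ} (h : Good S g M) : 0 < ∫ x, one S x := by
  have e : one S = S.indicator (fun _ => (1 : ℝ)) := by
    ext x; simp [one, Fx]
  rw [e, integral_indicator h.cpt.measurableSet]
  simp only [integral_const, smul_eq_mul, mul_one, Measure.real]
  simp only [MeasurableSet.univ, Measure.restrict_apply, univ_inter]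
  refine ENNReal.toReal_pos ?_ h.cpt.measure_lt_top.ne
  exact (Measure.measure_pos_of_mem_nhds volume h.zero).ne'

open Topology in
lemma top_bound {d : ℕ} (hd : 1 ≤ d) {S : Set (Fin (d + 1) → ℝ)} (h : Good S (fun _ => 1) 1)
    (hc : Cen S (fun _ => 1) 0) (l : Fin (d + 1) → ℝ) (hl : Monotone l) (hl0 : ∀ j, 0 < l j)
    (hp : ∀ j, Pi.single j (1 / l j) ∈ S) (hm : ∀ j, Pi.single j (-(1 / (((d + 1 : ℕ) : ℝ) * l j))) ∈ S) :
    ∃ η0 > 0, ∀ w : Fin (d + 1) → ℝ, ∀ᶠ k : ℝ in atTop,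
      k * (U (one S) w k / k ^ (d + 1) - ∫ x, one S x) ≤
        ((d + 1 : ℕ) : ℝ) / 2 * (∑ j, l j) * (∫ x, one S x) - η0 := by
  obtain ⟨M', h'⟩ := h.mgood 0
  set V := ∫ y, one (mS S) y with hV
  have hVp : 0 < V := one_pos' h'
  refine ⟨V / 8, by positivity, fun w => ?_⟩
  set N : ℝ := ((d + 1 : ℕ) : ℝ) with hN
  have hN2 : 2 ≤ N := by
    rw [hN]; exact_mod_cast (by omega : 2 ≤ d + 1)
  have hNp : 0 < N := by linarith
  have hp' : ∀ j, (Pi.single j (1 / (N * l j)) : Fin (d + 1) → ℝ) ∈ S := by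
    intro j
    have := h.conv.smul_mem_of_zero_mem h.mem0 (hp j) (t := 1 / N) ⟨by positivity, by
      rw [div_le_one hNp]; linarith⟩
    have e : (1 / N) • (Pi.single j (1 / l j) : Fin (d + 1) → ℝ) = Pi.single j (1 / (N * l j)) := by
      rw [← Pi.single_smul]; congr 1; simp [mul_comm]
    rwa [e] at this
  have I := claim N hNp d (mS S) (mg S (fun _ => 1) 0) M' h' 1 (h.cen_marg hc) (fun j => l j.succ)
      (fun i j hij => hl (Fin.succ_le_succ_iff.2 hij)) (fun j => hl0 _)
      (fun j => ⟨0, by rw [← single_succ_cn]; exact hp' _⟩) (fun j => ⟨0, by rw [← single_succ_cn]; exact hm _⟩)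
      (l 0) (hl0 0).le (fun j => hl (Fin.zero_le _)) (fun i => w i.succ) (V / 16) (by positivity)
  have lt1 : ∀ᶠ ρ : ℝ in 𝓝[>] 0, ρ < 1 := nhdsWithin_le_nhds (gt_mem_nhds one_pos)
  have small : ∀ᶠ ρ : ℝ in 𝓝[>] 0, 5 / 6 < (1 - ρ ^ 2) ^ d := by
    have hcont : Continuous fun ρ : ℝ => (1 - ρ ^ 2) ^ d := by fun_prop
    have := hcont.tendsto 0
    simp only [ne_eq, OfNat.ofNat_ne_zero, not_false_eq_true, zero_pow, sub_zero, one_pow] at this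
    exact (this.mono_left nhdsWithin_le_nhds).eventually (lt_mem_nhds (by norm_num))
  obtain ⟨ρ, hi, hρ1, hsm, hρ⟩ := (I.and (lt1.and (small.and self_mem_nhdsWithin))).exists
  have hρ : 0 < ρ := hρ
  have hρ2 : ρ ^ 2 < 1 := by nlinarith
  have hρ2p : 0 < ρ ^ 2 := by positivity
  have cs := cen_slope h hc hρ2p hρ2
  have gap := topgap h (a := 1 / l 0) (b := 1 / (N * l 0)) (by have := hl0 0; positivity)
    (by have := hl0 0; positivity) (by rw [← single_zero_cn]; exact hp 0)
    (by rw [← single_zero_cn]; exact hm 0) hρ2p hρ2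
  have rie := (riem d _ _ _ h'.one' 0 (fun i => w i.succ)).eventually
    (gt_mem_nhds (show (∫ y, Fx (mS S) (fun _ => (1 : ℝ)) 0 y) < V + V / 16 by
      have : (∫ y, Fx (mS S) (fun _ => (1 : ℝ)) 0 y) = V := rfl
      rw [this]; linarith))
  filter_upwards [hi, rie, eventually_gt_atTop 0] with k b c hk
  have st := U_step (h.bs 0) w hk (H := one (mS S)) h'.bs1
        fun y => by simpa using (abs_le.1 (line_a h 0 hk (w 0) y)).2
  have a : k * (U (Fx S (fun _ => 1) 0) w k / k ^ (d + 1) -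
      U (li (Fx S (fun _ => 1) 0)) (fun i => w i.succ) k / k ^ d) ≤ V + V / 16 := by
    refine le_trans ?_ c.le
    have e : k * (U (Fx S (fun _ => 1) 0) w k / k ^ (d + 1) -
      U (li (Fx S (fun _ => 1) 0)) (fun i => w i.succ) k / k ^ d) =
        (U (Fx S (fun _ => 1) 0) w k - k * U (li (Fx S (fun _ => 1) 0)) (fun i => w i.succ) k) / k ^ d := by
      field_simp
      ring
    rw [e]
    exact div_le_div_of_nonneg_right st (pow_nonneg hk.le d)
  rw [h.mg_integral, ← h.li_eq] at b
  have eI : ∫ x, one S x = ∫ x, Fx S (fun _ => (1 : ℝ)) 0 x := rfl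
  rw [eI]
  have eU : U (one S) w k = U (Fx S (fun _ => 1) 0) w k := rfl
  rw [eU, Fin.sum_univ_succ]
  set I0 := ∫ x, Fx S (fun _ => (1 : ℝ)) 0 x
  set Φ := ∫ x, Fx ((1 - ρ ^ 2) • S) (fun _ => (1 : ℝ)) 0 x
  set Φ' := ∫ y, Fx ((1 - ρ ^ 2) • mS S) (mg S (fun _ => 1) 0) (0 + 1) y with hΦ'
  have l0 := hl0 0
  have gap2 : (N + 1) / 2 * ((1 - ρ ^ 2) ^ d * V) ≤ N / 2 * (l 0 * ((Φ' - Φ) / ρ ^ 2)) := by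
    have e : (N + 1) / 2 * ((1 - ρ ^ 2) ^ d * V) =
      N / 2 * (l 0 * ((ρ ^ 2 * (1 / l 0 + 1 / (N * l 0)) * ((1 - ρ ^ 2) ^ d * V)) / ρ ^ 2)) := by
      field_simp
    rw [e]
    gcongr
  have gap3 : 5 / 4 * V ≤ (N + 1) / 2 * ((1 - ρ ^ 2) ^ d * V) := by
    calc 5 / 4 * V = 3 / 2 * (5 / 6 * V) := by ring
      _ ≤ _ := by gcongr; linarith
  have cs2 : N / 2 * (l 0 * ((I0 - Φ) / ρ ^ 2)) ≤ N / 2 * (l 0 * (N * I0)) := by gcongr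
  have e2 : (I0 - Φ') / ρ ^ 2 = (I0 - Φ) / ρ ^ 2 - (Φ' - Φ) / ρ ^ 2 := by ring
  rw [e2] at b
  have hNd : N = d + 1 := by rw [hN]; push_cast; ring
  have e3 : N / 2 * (l 0 * (N * I0)) = N / 2 * ((d + 1) * l 0 * I0) := by rw [hNd]; ring
  rw [e3] at cs2
  linarith

lemma neg_mem' {d : ℕ} (hd : 0 < d) {S : Set (Fin d → ℝ)} (h : Good S (fun _ => 1) 1) (hc : Cen S (fun _ => 1) 0)
    {x : Fin d → ℝ} (hx : x ∈ S) : (-(1 / (d : ℝ))) • x ∈ S := by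
  by_contra hn
  obtain ⟨f, u, hfu, hux⟩ := geometric_hahn_banach_closed_point h.conv h.cpt.isClosed hn
  have hdp : (0 : ℝ) < d := Nat.cast_pos.2 hd
  have hu : 0 < u := by simpa using hfu 0 h.mem0
  rw [map_smul, smul_eq_mul] at hux
  set B := -f x with hB
  have hBu : d * u < B := by
    have : d * u < d * (-(1 / (d : ℝ)) * f x) := by gcongr
    have e : d * (-(1 / (d : ℝ)) * f x) = B := by rw [hB]; field_simp
    rwa [e] at this
  have hBp : 0 < B := lt_trans (by positivity) hBu
  -- the integral of f vanishes
  have hi : ∀ i, Integrable (fun y : Fin d → ℝ => y i * one S y) := fun i => h.int_coord 0 i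
  have e : (fun y => f y * one S y) = fun y => ∑ i, f (Pi.single i 1) * (y i * one S y) := by
    ext y
    have : f y = ∑ i, f (Pi.single i 1) * y i := by
      conv_lhs => rw [← Finset.univ_sum_single y]
      rw [map_sum]
      refine Finset.sum_congr rfl fun i _ => ?_
      have : (Pi.single i (y i) : Fin d → ℝ) = y i • Pi.single i 1 := by
        rw [← Pi.single_smul]; simp
      rw [this, map_smul, smul_eq_mul, mul_comm]
    rw [this, Finset.sum_mul]
    exact Finset.sum_congr rfl fun i _ => by ring
  have fint : Integrable fun y => f y * one S y := by
    rw [e]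
    exact integrable_finsetSum _ fun i _ => (hi i).const_mul _
  have f0 : ∫ y, f y * one S y = 0 := by
    rw [e, integral_finsetSum _ fun i _ => (hi i).const_mul _]
    refine Finset.sum_eq_zero fun i _ => ?_
    rw [integral_const_mul]
    have := hc i
    have e2 : (∫ y : Fin d → ℝ, y i * one S y) = 0 := this
    rw [e2, mul_zero]
  have oint : Integrable (one S) := h.int 0
  set V := ∫ y, one S y with hV
  have hVp : 0 < V := one_pos' h
  set τ := (B - d * u) / (2 * d * B) with hτ
  have hτ0 : 0 < τ := by
    rw [hτ]; apply div_pos (by linarith) (by positivity)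
  have hτe : τ * (2 * d * B) = B - d * u := by rw [hτ]; field_simp
  have hd1 : (1 : ℝ) ≤ d := by exact_mod_cast hd
  have hτ1 : τ < 1 := by
    by_contra hge
    push Not at hge
    have : 1 * (2 * 1 * B) ≤ τ * (2 * d * B) := by gcongr
    have : 0 < d * u := by positivity
    linarith
  -- the key function
  set G : (Fin d → ℝ) → ℝ := fun y => (u - f y) * one S y with hG
  have hGi : Integrable G := by
    have : G = fun y => u * one S y - f y * one S y := by ext y; rw [hG]; ring
    rw [this]
    exact (oint.const_mul u).sub fint
  have hGv : ∫ y, G y = u * V := by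
    have : G = fun y => u * one S y - f y * one S y := by ext y; rw [hG]; ring
    rw [this, integral_sub (oint.const_mul u) fint, f0, integral_const_mul, sub_zero]
  have hG0 : ∀ y, 0 ≤ G y := by
    intro y
    by_cases hy : y ∈ S
    · rw [hG]; simp only [one_mem hy]; linarith [hfu y hy]
    · rw [hG]; simp only [one_not hy]; simp
  have hs : 0 < 1 - τ := by linarith
  have cv : ∫ q, G (τ • x + (1 - τ) • q) = ((1 - τ) ^ d)⁻¹ * ∫ y, G y := by
    have := Measure.integral_comp_smul (volume : Measure (Fin d → ℝ)) (fun z => G (τ • x + z)) (1 - τ)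
    rw [this, integral_add_left_eq_self]
    simp [abs_of_pos hs]
  have lower : (u + τ * B) * V ≤ ∫ q, G (τ • x + (1 - τ) • q) := by
    have e : (u + τ * B) * V = ∫ q, ((u + τ * B) * one S q - (1 - τ) * (f q * one S q)) := by
      rw [integral_sub (oint.const_mul _) (fint.const_mul _), integral_const_mul, integral_const_mul, f0]
      ring
    rw [e]
    refine integral_mono ((oint.const_mul _).sub (fint.const_mul _)) ?_ fun q => ?_
    · exact (hGi.comp_add_left (τ • x)).comp_smul hs.ne'
    · by_cases hq : q ∈ S
      · have hm : τ • x + (1 - τ) • q ∈ S := h.conv hx hq hτ0.le hs.le (by ring)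
        simp only [hG, one_mem hq, one_mem hm, map_add, map_smul, smul_eq_mul]
        rw [hB]
        apply le_of_eq; ring
      · simp only [one_not hq]
        simpa using hG0 _
  rw [cv, hGv] at lower
  have hpow : 0 < (1 - τ) ^ d := by positivity
  have l2 : (1 - τ) ^ d * (u + τ * B) ≤ u := by
    have : (1 - τ) ^ d * ((u + τ * B) * V) ≤ (1 - τ) ^ d * (((1 - τ) ^ d)⁻¹ * (u * V)) := by gcongr
    rw [mul_inv_cancel_left₀ hpow.ne', ← mul_assoc] at this
    exact le_of_mul_le_mul_right this hVp
  have bern := one_add_mul_le_pow (a := -τ) (by linarith) d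
  rw [← sub_eq_add_neg] at bern
  have l3 : (1 + d * -τ) * (u + τ * B) ≤ u := le_trans (by gcongr) l2
  have l4 : τ * (B - d * u - d * τ * B) ≤ 0 := by nlinarith
  have l5 : 0 < B - d * u - d * τ * B := by nlinarith
  have := mul_pos hτ0 l5
  linarith

lemma poly_lim {n : ℕ} (γ : Fin n → ℂ) {V c : ℝ} (hV : 0 < V) (p : ℕ → ℝ)
    (hp : ∀ k : ℕ, 0 < k → (p k : ℂ) = ∏ i, (1 + (k : ℂ) / γ i))
    (h1 : Tendsto (fun k : ℕ => p k / (k : ℝ) ^ n) atTop (nhds V))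
    (h2 : ∀ᶠ k : ℕ in atTop, (k : ℝ) * (p k / (k : ℝ) ^ n - V) ≤ c) :
    ∃ s : ℝ, ∑ i, γ i = (s : ℂ) ∧ V * s ≤ c := by
  set f : ℂ → ℂ := fun t => ∏ i, (t + (γ i)⁻¹) with hf
  have pk : ∀ k : ℕ, 0 < k → ((p k / (k : ℝ) ^ n : ℝ) : ℂ) = f ((k : ℂ)⁻¹) := by
    intro k hk
    have hk' : (k : ℂ) ≠ 0 := by exact_mod_cast hk.ne'
    push_cast
    rw [hp k hk, hf, div_eq_iff (pow_ne_zero _ hk')]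
    have : (k : ℂ) ^ n = ∏ _i : Fin n, (k : ℂ) := by simp
    rw [this, ← Finset.prod_mul_distrib]
    refine Finset.prod_congr rfl fun i _ => ?_
    rw [add_mul, inv_mul_cancel₀ hk', div_eq_mul_inv]; ring
  have tk : Tendsto (fun k : ℕ => (k : ℂ)⁻¹) atTop (nhds 0) := tendsto_inv_atTop_nhds_zero_nat
  have fc : Continuous f := by rw [hf]; fun_prop
  have hf0 : f 0 = (V : ℂ) := by
    have l1 : Tendsto (fun k : ℕ => f ((k : ℂ)⁻¹)) atTop (nhds (f 0)) := (fc.tendsto 0).comp tk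
    have l2 : Tendsto (fun k : ℕ => ((p k / (k : ℝ) ^ n : ℝ) : ℂ)) atTop (nhds (V : ℂ)) :=
      (Complex.continuous_ofReal.tendsto V).comp h1
    refine tendsto_nhds_unique l1 (l2.congr' ?_)
    filter_upwards [eventually_gt_atTop 0] with k hk using pk k hk
  have hV' : (V : ℂ) ≠ 0 := by exact_mod_cast hV.ne'
  have hprod : ∏ i, (γ i)⁻¹ = (V : ℂ) := by rw [← hf0, hf]; simp
  have hγ : ∀ i, γ i ≠ 0 := by
    intro i hi
    apply hV'
    rw [← hprod]
    exact Finset.prod_eq_zero (Finset.mem_univ i) (by simp [hi])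
  have hd : HasDerivAt f (V * ∑ i, γ i) 0 := by
    have := HasDerivAt.fun_finsetProd (u := (Finset.univ : Finset (Fin n))) (x := (0 : ℂ))
      (f := fun i t => t + (γ i)⁻¹) (f' := fun _ => 1)
      (fun i _ => (hasDerivAt_id (0 : ℂ)).add_const _)
    have ev : (V * ∑ i, γ i : ℂ) = ∑ i, (∏ j ∈ Finset.univ.erase i, (0 + (γ j)⁻¹)) • (1 : ℂ) := by
      rw [Finset.mul_sum]
      refine Finset.sum_congr rfl fun i _ => ?_
      rw [← hprod, ← Finset.mul_prod_erase _ _ (Finset.mem_univ i)]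
      simp only [zero_add, smul_eq_mul, mul_one]
      rw [mul_comm ((γ i)⁻¹), mul_assoc, inv_mul_cancel₀ (hγ i), mul_one]
    rw [ev]
    exact this
  have hs := hasDerivAt_iff_tendsto_slope_zero.1 hd
  have tk' : Tendsto (fun k : ℕ => (k : ℂ)⁻¹) atTop (nhdsWithin 0 {0}ᶜ) := by
    refine tendsto_nhdsWithin_iff.2 ⟨tk, ?_⟩
    filter_upwards [eventually_gt_atTop 0] with k hk
    simp [hk.ne']
  have hq : Tendsto (fun k : ℕ => (((k : ℝ) * (p k / (k : ℝ) ^ n - V) : ℝ) : ℂ)) atTop (nhds (V * ∑ i, γ i)) := by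
    refine (hs.comp tk').congr' ?_
    filter_upwards [eventually_gt_atTop 0] with k hk
    rw [Complex.ofReal_mul, Complex.ofReal_sub, pk k hk, ← hf0]
    simp
  have him : (V * ∑ i, γ i : ℂ).im = 0 := by
    have := (Complex.continuous_im.tendsto _).comp hq
    refine tendsto_nhds_unique this ?_
    have e : (Complex.im ∘ fun k : ℕ => (((k : ℝ) * (p k / (k : ℝ) ^ n - V) : ℝ) : ℂ)) = fun _ => 0 := by
      ext k; exact Complex.ofReal_im _
    rw [e]; exact tendsto_const_nhds
  have hre : (V * ∑ i, γ i : ℂ).re ≤ c := by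
    have := (Complex.continuous_re.tendsto _).comp hq
    refine le_of_tendsto this ?_
    filter_upwards [h2] with k hk
    exact hk
  rw [Complex.im_ofReal_mul] at him
  rw [Complex.re_ofReal_mul] at hre
  refine ⟨(∑ i, γ i).re, ?_, hre⟩
  apply Complex.ext
  · simp
  · simpa [hV.ne'] using him

lemma U_card {d : ℕ} {Q : Set (Fin d → ℝ)} (hQ : Bs (one Q)) (w : Fin d → ℝ) {k : ℝ} (hk : 0 < k) :
    Finite {z : Fin d → ℤ // pt w k z ∈ Q} ∧
    U (one Q) w k = (Nat.card {z : Fin d → ℤ // pt w k z ∈ Q} : ℝ) := by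
  have hs := hQ.sum w hk
  have hfin : {z : Fin d → ℤ | pt w k z ∈ Q}.Finite := by
    have := (hs.tendsto_cofinite_zero).eventually (gt_mem_nhds (zero_lt_one : (0 : ℝ) < 1))
    rw [eventually_cofinite] at this
    refine this.subset fun z hz => ?_
    have hz' : pt w k z ∈ Q := hz
    simp [one_mem hz']
  refine ⟨hfin, ?_⟩
  unfold U
  rw [tsum_eq_sum (s := hfin.toFinset)]
  · rw [Finset.sum_congr rfl (g := fun _ => (1 : ℝ))]
    · rw [Finset.sum_const, nsmul_one]
      congr 1
      rw [← Set.ncard_eq_toFinset_card _ hfin]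
      rfl
    · intro z hz
      have hz' : pt w k z ∈ Q := by simpa using hz
      exact one_mem hz'
  · intro z hz
    have hz' : pt w k z ∉ Q := by simpa using hz
    exact one_not hz'

lemma std_add {n : ℕ} {x y : Euc n} (hx : x ∈ stdLattice n) (hy : y ∈ stdLattice n) : x + y ∈ stdLattice n := by
  intro i
  obtain ⟨a, ha⟩ := hx i
  obtain ⟨b, hb⟩ := hy i
  exact ⟨a + b, by push_cast; rw [← ha, ← hb]; rfl⟩

lemma std_zsmul {n : ℕ} {x : Euc n} (hx : x ∈ stdLattice n) (m : ℤ) : (m : ℝ) • x ∈ stdLattice n := by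
  intro i
  obtain ⟨a, ha⟩ := hx i
  exact ⟨m * a, by push_cast; rw [← ha]; rfl⟩

lemma std_zero {n : ℕ} : (0 : Euc n) ∈ stdLattice n := fun i => ⟨0, by simp⟩

lemma std_sum {n : ℕ} (T : (Fin n → ℝ) ≃ₗ[ℝ] Euc n) (hT : ∀ i, T (Pi.single i 1) ∈ stdLattice n)
    (z : Fin n → ℤ) : T (fun i => (z i : ℝ)) ∈ stdLattice n := by
  have : (fun i => (z i : ℝ)) = ∑ i, (z i : ℝ) • (Pi.single i 1 : Fin n → ℝ) := by
    rw [← Finset.univ_sum_single (fun i => (z i : ℝ))]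
    refine Finset.sum_congr rfl fun i _ => ?_
    rw [← Pi.single_smul]; simp
  rw [this, map_sum]
  refine Finset.sum_induction _ (· ∈ stdLattice n) (fun _ _ => std_add) std_zero fun i _ => ?_
  rw [map_smul]
  exact std_zsmul (hT i) _

lemma count {n : ℕ} (T : (Fin n → ℝ) ≃ₗ[ℝ] Euc n) (hT : ∀ i, T (Pi.single i 1) ∈ stdLattice n)
    (P : Set (Euc n)) (hQ : Bs (one (T ⁻¹' P))) (W : Finset (Fin n → ℝ))
    (hW : ∀ w, w ∈ W ↔ (∀ i, w i ∈ Ico (0 : ℝ) 1) ∧ T w ∈ stdLattice n) {k : ℝ} (hk : 0 < k) :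
    (Nat.card ↥((k • P) ∩ stdLattice n) : ℝ) = ∑ w ∈ W, U (one (T ⁻¹' P)) w k := by
  have fin : ∀ w : W, Finite {z : Fin n → ℤ // pt (w : Fin n → ℝ) k z ∈ T ⁻¹' P} :=
    fun w => (U_card hQ w hk).1
  have key : ∀ (w : Fin n → ℝ) (z : Fin n → ℤ), T (pt w k z) ∈ P ↔ T ((fun i => (z i : ℝ)) + w) ∈ k • P := by
    intro w z
    have : pt w k z = k⁻¹ • ((fun i => (z i : ℝ)) + w) := by
      ext i; simp [pt, div_eq_inv_mul]
    rw [this, map_smul, Set.mem_smul_set_iff_inv_smul_mem₀ hk.ne']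
  have e : (Σ w : W, {z : Fin n → ℤ // pt (w : Fin n → ℝ) k z ∈ T ⁻¹' P}) ≃ ↥((k • P) ∩ stdLattice n) := by
    refine Equiv.ofBijective (fun a => ⟨T ((fun i => (a.2.1 i : ℝ)) + a.1.1), ?_, ?_⟩) ⟨?_, ?_⟩
    · exact (key _ _).1 a.2.2
    · rw [map_add]
      exact std_add (std_sum T hT _) ((hW _).1 a.1.2).2
    · rintro ⟨⟨w, hw⟩, ⟨z, hz⟩⟩ ⟨⟨w', hw'⟩, ⟨z', hz'⟩⟩ h
      have h1 := T.injective (Subtype.ext_iff.1 h)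
      have h2 : z = z' := by
        ext i
        have h3 := congrFun h1 i
        simp only [Pi.add_apply] at h3
        have a1 := ((hW w).1 hw).1 i
        have a2 := ((hW w').1 hw').1 i
        have : ⌊(z i : ℝ) + w i⌋ = ⌊(z' i : ℝ) + w' i⌋ := by rw [h3]
        rw [Int.floor_intCast_add, Int.floor_intCast_add, Int.floor_eq_zero_iff.2 a1, Int.floor_eq_zero_iff.2 a2] at this
        simpa using this
      subst h2
      have h4 : w = w' := by simpa using h1
      subst h4
      rfl
    · rintro ⟨x, hx, hl⟩
      set y := T.symm x with hy
      set z : Fin n → ℤ := fun i => ⌊y i⌋ with hz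
      set w : Fin n → ℝ := fun i => Int.fract (y i) with hw
      have hyzw : (fun i => (z i : ℝ)) + w = y := by
        ext i; simp [hz, hw]
      have hTy : T y = x := by simp [hy]
      have hwW : w ∈ W := by
        refine (hW w).2 ⟨fun i => ⟨Int.fract_nonneg _, Int.fract_lt_one _⟩, ?_⟩
        have : w = y + (fun i => ((- z i : ℤ) : ℝ)) := by
          rw [← hyzw]; ext i; simp
        rw [this, map_add, hTy]
        exact std_add hl (std_sum T hT _)
      refine ⟨⟨⟨w, hwW⟩, ⟨z, ?_⟩⟩, ?_⟩
      · refine (key _ _).2 ?_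
        rw [hyzw, hTy]; exact hx
      · exact Subtype.ext (by simp only [hyzw, hTy])
  rw [← Nat.card_congr e, Nat.card_sigma, Nat.cast_sum, ← Finset.sum_coe_sort W]
  exact Finset.sum_congr rfl fun w _ => ((U_card hQ w hk).2).symm

lemma std_finite {n : ℕ} {B : Set (Euc n)} (hB : Bornology.IsBounded B) : (B ∩ stdLattice n).Finite := by
  obtain ⟨R, hR⟩ := hB.exists_norm_le
  refine ((Set.finite_Icc (fun _ : Fin n => -⌈R⌉) (fun _ => ⌈R⌉)).image
    (fun z : Fin n → ℤ => (WithLp.toLp 2 (fun i => (z i : ℝ)) : Euc n))).subset ?_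
  rintro x ⟨hx, hl⟩
  choose m hm using hl
  have hb : ∀ i, |(m i : ℝ)| ≤ ⌈R⌉ := by
    intro i
    rw [← hm i]
    have := PiLp.norm_apply_le x i
    rw [Real.norm_eq_abs] at this
    exact this.trans ((hR x hx).trans (Int.le_ceil R))
  refine ⟨m, ⟨fun i => ?_, fun i => ?_⟩, ?_⟩
  · have := (abs_le.1 (hb i)).1
    exact_mod_cast this
  · have := (abs_le.1 (hb i)).2
    exact_mod_cast this
  · ext i; simp [hm]

lemma mem_smul_gauge {n : ℕ} {P : Set (Euc n)} (hc : IsCompact P) (hv : Convex ℝ P) (h0 : P ∈ nhds 0)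
    {t : ℝ} (ht : 0 < t) {x : Euc n} : x ∈ t • P ↔ gauge P x ≤ t := by
  constructor
  · exact fun h => gauge_le_of_mem ht.le h
  · intro h
    rw [Set.mem_smul_set_iff_inv_smul_mem₀ ht.ne', ← hc.isClosed.closure_eq,
      ← gauge_le_one_iff_mem_closure hv h0, gauge_smul_of_nonneg (by positivity), smul_eq_mul,
      inv_mul_le_iff₀ ht, mul_one]
    exact h

/-- admissible dilations -/
def As {n : ℕ} (P : Set (Euc n)) (i : ℕ) : Set ℝ := {t : ℝ | 0 < t ∧ ∃ v : Fin i → Euc n,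
    LinearIndependent ℝ v ∧ ∀ j, v j ∈ stdLattice n ∧ v j ∈ t • P}

lemma As_bdd {n : ℕ} (P : Set (Euc n)) (i : ℕ) : BddBelow (As P i) := ⟨0, fun _ h => h.1.le⟩

lemma As_mono {n : ℕ} (P : Set (Euc n)) {i j : ℕ} (hij : i ≤ j) : As P j ⊆ As P i := by
  rintro t ⟨ht, v, hv, h⟩
  exact ⟨ht, v ∘ Fin.castLE hij, hv.comp _ (Fin.castLE_injective hij), fun k => h _⟩

lemma As_ne {n : ℕ} {P : Set (Euc n)} (hc : IsCompact P) (hv : Convex ℝ P) (h0 : P ∈ nhds 0)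
    {i : ℕ} (hi : i ≤ n) : (As P i).Nonempty := by
  refine (Set.Nonempty.mono (As_mono P hi) ?_)
  set b : Fin n → Euc n := fun j => EuclideanSpace.single j 1 with hb
  set t := 1 + ∑ j, gauge P (b j) with ht
  have hs : ∀ j, 0 ≤ gauge P (b j) := fun j => gauge_nonneg _
  have ht0 : 0 < t := by
    have := Finset.sum_nonneg fun j (_ : j ∈ Finset.univ) => hs j
    linarith
  refine ⟨t, ht0, b, ?_, fun j => ⟨fun k => ?_, ?_⟩⟩
  · have := (EuclideanSpace.basisFun (Fin n) ℝ).orthonormal.linearIndependent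
    have e : b = ⇑(EuclideanSpace.basisFun (Fin n) ℝ) := by
      ext j; simp [hb]
    rw [e]; exact this
  · by_cases h : k = j
    · exact ⟨1, by simp [hb, h]⟩
    · exact ⟨0, by simp [hb, h]⟩
  · rw [mem_smul_gauge hc hv h0 ht0]
    have := Finset.single_le_sum (fun j _ => hs j) (Finset.mem_univ j)
    linarith

lemma attain {n : ℕ} {P : Set (Euc n)} (hc : IsCompact P) (hv : Convex ℝ P) (h0 : P ∈ nhds 0)
    {i : ℕ} (hi : i + 1 ≤ n) : ∃ v : Fin (i + 1) → Euc n, LinearIndependent ℝ v ∧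
      ∀ j, v j ∈ stdLattice n ∧ gauge P (v j) ≤ succMin P (stdLattice n) (i + 1) := by
  obtain ⟨t0, ht0, v0, hv0, hm0⟩ := As_ne hc hv h0 hi
  set F : Set (Fin (i + 1) → Euc n) :=
    {v | LinearIndependent ℝ v ∧ ∀ j, v j ∈ stdLattice n ∧ v j ∈ t0 • P} with hF
  have hfin : F.Finite := by
    have hb : Bornology.IsBounded (t0 • P) := (hc.smul t0).isBounded
    refine (Set.Finite.pi' (fun _ : Fin (i + 1) => std_finite hb)).subset ?_
    rintro v ⟨_, h⟩ j
    exact ⟨(h j).2, (h j).1⟩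
  set f : (Fin (i + 1) → Euc n) → ℝ := fun v => Finset.univ.sup' Finset.univ_nonempty fun j => gauge P (v j) with hf
  obtain ⟨v, hvF, hmin⟩ := Set.exists_min_image F f hfin ⟨v0, hv0, hm0⟩
  refine ⟨v, hvF.1, fun j => ⟨(hvF.2 j).1, ?_⟩⟩
  have h1 : gauge P (v j) ≤ f v := Finset.le_sup' (fun j => gauge P (v j)) (Finset.mem_univ j)
  refine h1.trans (le_csInf (As_ne hc hv h0 hi) ?_)
  rintro t ⟨ht, u, hu, hum⟩
  by_cases htt : t ≤ t0
  · have huF : u ∈ F := by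
      refine ⟨hu, fun j => ⟨(hum j).1, ?_⟩⟩
      rw [mem_smul_gauge hc hv h0 ht0]
      exact ((mem_smul_gauge hc hv h0 ht).1 (hum j).2).trans htt
    refine (hmin u huF).trans (Finset.sup'_le _ _ fun j _ => ?_)
    exact (mem_smul_gauge hc hv h0 ht).1 (hum j).2
  · refine le_trans (Finset.sup'_le _ _ fun j _ => ?_) (not_le.1 htt).le
    exact (mem_smul_gauge hc hv h0 ht0).1 (hvF.2 j).2

lemma exch {n : ℕ} {P : Set (Euc n)} (hc : IsCompact P) (hv : Convex ℝ P) (h0 : P ∈ nhds 0) (m : ℕ) (hm : m ≤ n) :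
    ∃ v : Fin m → Euc n, LinearIndependent ℝ v ∧
      ∀ j, v j ∈ stdLattice n ∧ gauge P (v j) ≤ succMin P (stdLattice n) ((j : ℕ) + 1) := by
  induction m with
  | zero => exact ⟨fun _ => 0, linearIndependent_empty_type, fun j => j.elim0⟩
  | succ m ih =>
    obtain ⟨v, hvl, hvm⟩ := ih (by omega)
    obtain ⟨u, hul, hum⟩ := attain hc hv h0 hm
    have : ∃ j, u j ∉ Submodule.span ℝ (Set.range v) := by
      by_contra! hall
      have hle : Submodule.span ℝ (Set.range u) ≤ Submodule.span ℝ (Set.range v) := by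
        rw [Submodule.span_le]
        rintro _ ⟨j, rfl⟩
        exact hall j
      have := Submodule.finrank_mono hle
      rw [finrank_span_eq_card hul, finrank_span_eq_card hvl] at this
      simp at this
    obtain ⟨j, hj⟩ := this
    refine ⟨Fin.snoc v (u j), linearIndependent_finSnoc.2 ⟨hvl, hj⟩, fun k => ?_⟩
    refine Fin.lastCases ?_ (fun k => ?_) k
    · simpa using hum j
    · simpa using hvm k

lemma minima {n : ℕ} {P : Set (Euc n)} (hc : IsCompact P) (hv : Convex ℝ P) (h0 : P ∈ nhds 0) :
    Monotone (fun j : Fin n => succMin P (stdLattice n) ((j : ℕ) + 1)) ∧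
    (∀ j : Fin n, 0 < succMin P (stdLattice n) ((j : ℕ) + 1)) ∧
    ∃ v : Fin n → Euc n, LinearIndependent ℝ v ∧
      ∀ j, v j ∈ stdLattice n ∧ (1 / succMin P (stdLattice n) ((j : ℕ) + 1)) • v j ∈ P := by
  obtain ⟨v, hvl, hvm⟩ := exch hc hv h0 n le_rfl
  have hpos : ∀ j : Fin n, 0 < succMin P (stdLattice n) ((j : ℕ) + 1) := by
    intro j
    refine lt_of_lt_of_le ?_ (hvm j).2
    exact (gauge_pos (absorbent_nhds_zero h0) (NormedSpace.isVonNBounded_of_isBounded ℝ hc.isBounded)).2 (hvl.ne_zero j)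
  refine ⟨?_, hpos, v, hvl, fun j => ⟨(hvm j).1, ?_⟩⟩
  · intro a b hab
    exact csInf_le_csInf (As_bdd P _) (As_ne hc hv h0 (by omega)) (As_mono P (by simpa using hab))
  · have := (mem_smul_gauge hc hv h0 (hpos j)).2 (hvm j).2
    rw [Set.mem_smul_set_iff_inv_smul_mem₀ (hpos j).ne'] at this
    rwa [one_div]

lemma zero_int {n : ℕ} {P : Set (Euc n)} (hc : IsCompact P) (hv : Convex ℝ P) (hint : (interior P).Nonempty)
    (hcen : CentroidAtOrigin P) : P ∈ nhds 0 := by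
  rw [← mem_interior_iff_mem_nhds]
  by_contra hn
  obtain ⟨f, hf⟩ := geometric_hahn_banach_open_point hv.interior isOpen_interior hn
  simp only [map_zero] at hf
  have hle : ∀ x ∈ P, f x ≤ 0 := by
    intro x hx
    have : x ∈ closure (interior P) := by
      rw [hv.closure_interior_eq_closure_of_nonempty_interior hint]; exact subset_closure hx
    exact le_on_closure (fun y hy => (hf y hy).le) f.continuous.continuousOn continuousOn_const this
  have idint : IntegrableOn (fun x : Euc n => x) P := continuous_id.continuousOn.integrableOn_compact hc
  have fint : IntegrableOn (fun x : Euc n => f x) P := f.continuous.continuousOn.integrableOn_compact hc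
  have f0 : ∫ x in P, f x = 0 := by
    rw [ContinuousLinearMap.integral_comp_comm f idint]
    have : (∫ x in P, x) = (0 : Euc n) := hcen
    rw [this, map_zero]
  have g0 : ∫ x in P, - f x = 0 := by rw [integral_neg, f0, neg_zero]
  rw [setIntegral_eq_zero_iff_of_nonneg_ae] at g0
  · have h1 : ∀ᵐ x ∂(volume.restrict P), x ∉ interior P := by
      filter_upwards [g0] with x hx hxi
      have := hf x hxi
      simp at hx
      linarith
    have h2 : volume (interior P) = 0 := by
      have h3 : (volume.restrict P) (interior P) = 0 := by
        rw [ae_iff] at h1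
        simpa using h1
      rwa [Measure.restrict_apply isOpen_interior.measurableSet, inter_eq_left.2 interior_subset] at h3
    exact (isOpen_interior.measure_pos volume hint).ne' h2
  · refine (ae_restrict_mem hc.isClosed.measurableSet).mono fun x hx => ?_
    simpa using hle x hx
  · exact fint.neg

lemma good_pre {n : ℕ} {P : Set (Euc n)} (hc : IsCompact P) (hv : Convex ℝ P) (h0 : P ∈ nhds 0)
    (T : (Fin n → ℝ) ≃L[ℝ] Euc n) : Good (T ⁻¹' P) (fun _ => 1) 1 where
  cpt := T.toHomeomorph.isCompact_preimage.2 hc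
  zero := T.continuous.continuousAt.preimage_mem_nhds (by simpa using h0)
  conc := concaveOn_const _ (hv.linear_preimage T.toLinearMap)
  nn := fun _ _ => zero_le_one
  le := fun _ _ => le_rfl
  one := le_rfl
  meas := measurable_const.indicator (hc.isClosed.preimage T.continuous).measurableSet

lemma cen_pre {n : ℕ} {P : Set (Euc n)} (hc : IsCompact P) (hcen : CentroidAtOrigin P)
    (T : (Fin n → ℝ) ≃L[ℝ] Euc n) : Cen (T ⁻¹' P) (fun _ => 1) 0 := by
  intro i
  set φ : Euc n →L[ℝ] ℝ := (ContinuousLinearMap.proj i).comp (T.symm : Euc n →L[ℝ] (Fin n → ℝ)) with hφ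
  have idint : IntegrableOn (fun x : Euc n => x) P := continuous_id.continuousOn.integrableOn_compact hc
  have e : (fun x : Fin n → ℝ => x i * Fx (T ⁻¹' P) (fun _ => 1) 0 x) = fun x => P.indicator φ (T x) := by
    ext x
    by_cases hx : T x ∈ P
    · simp [Fx, hx, hφ, Set.indicator]
    · simp [Fx, hx, Set.indicator]
  rw [e]
  have me : MeasurableEmbedding (T : (Fin n → ℝ) → Euc n) := T.toHomeomorph.measurableEmbedding
  rw [← me.integral_map (μ := volume) (fun y => P.indicator φ y)]
  have : (Measure.map T (volume : Measure (Fin n → ℝ))).IsAddHaarMeasure := T.isAddHaarMeasure_map volume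
  rw [Measure.isAddLeftInvariant_eq_smul (Measure.map T (volume : Measure (Fin n → ℝ))) (volume : Measure (Euc n))]
  rw [integral_smul_nnreal_measure, integral_indicator hc.isClosed.measurableSet,
    ContinuousLinearMap.integral_comp_comm φ idint]
  have h : (∫ x in P, x) = (0 : Euc n) := hcen
  rw [h, map_zero, smul_zero]

lemma main_bound {n : ℕ} (hn : 2 ≤ n) {P : Set (Euc n)} (hc : IsCompact P) (hv : Convex ℝ P) (hint : (interior P).Nonempty)
    (hcen : CentroidAtOrigin P) : ∃ V c : ℝ, 0 < V ∧
      c < V * ((n : ℝ) / 2 * ∑ i : Fin n, succMin P (stdLattice n) ((i : ℕ) + 1)) ∧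
      Tendsto (fun k : ℕ => (Nat.card ↥(((k : ℝ) • P) ∩ stdLattice n) : ℝ) / (k : ℝ) ^ n) atTop (nhds V) ∧
      ∀ᶠ k : ℕ in atTop, (k : ℝ) * ((Nat.card ↥(((k : ℝ) • P) ∩ stdLattice n) : ℝ) / (k : ℝ) ^ n - V) ≤ c := by
  have h0 := zero_int hc hv hint hcen
  obtain ⟨hmono, hpos, v, hvl, hvm⟩ := minima hc hv h0
  obtain ⟨d, rfl⟩ : ∃ d, n = d + 1 := ⟨n - 1, by omega⟩
  have hd : 1 ≤ d := by omega
  set l : Fin (d + 1) → ℝ := fun j => succMin P (stdLattice (d + 1)) ((j : ℕ) + 1) with hl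
  obtain ⟨T0, hTs⟩ : ∃ T0 : (Fin (d + 1) → ℝ) ≃ₗ[ℝ] Euc (d + 1), ∀ i, T0 (Pi.single i 1) = v i := by
    have hcard : Fintype.card (Fin (d + 1)) = Module.finrank ℝ (Euc (d + 1)) := by simp
    refine ⟨(basisOfLinearIndependentOfCardEqFinrank hvl hcard).equivFun.symm, fun i => ?_⟩
    have h1 := (basisOfLinearIndependentOfCardEqFinrank hvl hcard).equivFun_symm_apply (Pi.single i 1)
    rw [h1, coe_basisOfLinearIndependentOfCardEqFinrank]
    simp [Pi.single_apply]
  let T := T0.toContinuousLinearEquiv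
  have hTs' : ∀ i (a : ℝ), T0 (Pi.single i a) = a • v i := by
    intro i a
    have : (Pi.single i a : Fin (d + 1) → ℝ) = a • Pi.single i 1 := by
      rw [← Pi.single_smul]; simp
    rw [this, map_smul, hTs]
  have hg : Good (T0 ⁻¹' P) (fun _ => 1) 1 := good_pre hc hv h0 T
  have hcc : Cen (T0 ⁻¹' P) (fun _ => 1) 0 := cen_pre hc hcen T
  have hTl : ∀ i, T0 (Pi.single i 1) ∈ stdLattice (d + 1) := fun i => by rw [hTs]; exact (hvm i).1
  have hp : ∀ j, (Pi.single j (1 / l j) : Fin (d + 1) → ℝ) ∈ T0 ⁻¹' P := by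
    intro j
    rw [Set.mem_preimage, hTs']
    exact (hvm j).2
  have hm : ∀ j, (Pi.single j (-(1 / (((d + 1 : ℕ) : ℝ) * l j))) : Fin (d + 1) → ℝ) ∈ T0 ⁻¹' P := by
    intro j
    have := neg_mem' (Nat.succ_pos d) hg hcc (hp j)
    have hlj : l j ≠ 0 := (hpos j).ne'
    have e : (Pi.single j (-(1 / (((d + 1 : ℕ) : ℝ) * l j))) : Fin (d + 1) → ℝ) =
        (-(1 / ((d + 1 : ℕ) : ℝ))) • (Pi.single j (1 / l j) : Fin (d + 1) → ℝ) := by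
      rw [← Pi.single_smul]
      congr 1
      rw [smul_eq_mul]
      field_simp
    rw [e]
    exact this
  obtain ⟨η, hη, hb⟩ := top_bound hd hg hcc l hmono hpos hp hm
  set I := ∫ x, one (T0 ⁻¹' P) x with hI
  have hIp : 0 < I := one_pos' hg
  -- finite set of cosets
  have hWf : {w : Fin (d + 1) → ℝ | (∀ i, w i ∈ Ico (0 : ℝ) 1) ∧ T0 w ∈ stdLattice (d + 1)}.Finite := by
    have hbd : Bornology.IsBounded (T '' (Icc 0 1)) := ((isCompact_Icc).image T.continuous).isBounded
    refine ((std_finite hbd).preimage (T0.injective.injOn)).subset ?_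
    rintro w ⟨hw, hwl⟩
    exact ⟨⟨w, ⟨fun i => (hw i).1, fun i => (hw i).2.le⟩, rfl⟩, hwl⟩
  set W := hWf.toFinset with hWdef
  have hW : ∀ w, w ∈ W ↔ (∀ i, w i ∈ Ico (0 : ℝ) 1) ∧ T0 w ∈ stdLattice (d + 1) := by
    intro w; rw [hWdef, Set.Finite.mem_toFinset]; rfl
  have hWne : W.Nonempty := ⟨0, (hW 0).2 ⟨fun _ => ⟨le_rfl, zero_lt_one⟩, by rw [map_zero]; exact std_zero⟩⟩
  have hWc : 0 < (W.card : ℝ) := by exact_mod_cast hWne.card_pos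
  have hcount : ∀ k : ℕ, 0 < k → (Nat.card ↥(((k : ℝ) • P) ∩ stdLattice (d + 1)) : ℝ)
      = ∑ w ∈ W, U (one (T0 ⁻¹' P)) w k := fun k hk =>
    count T0 hTl P hg.bs1 W hW (by exact_mod_cast hk)
  refine ⟨W.card * I, W.card * (((d + 1 : ℕ) : ℝ) / 2 * (∑ j, l j) * I - η), by positivity, ?_, ?_, ?_⟩
  · have : 0 < W.card * η := by positivity
    have e : W.card * (((d + 1 : ℕ) : ℝ) / 2 * (∑ j, l j) * I - η) =
      W.card * I * (((d + 1 : ℕ) : ℝ) / 2 * ∑ j, l j) - W.card * η := by ring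
    rw [e]; linarith
  · have : Tendsto (fun k : ℕ => ∑ w ∈ W, U (one (T0 ⁻¹' P)) w k / (k : ℝ) ^ (d + 1)) atTop (nhds (∑ _w ∈ W, I)) :=
      tendsto_finsetSum _ fun w _ => (riem (d + 1) _ _ 1 hg 0 w).comp tendsto_natCast_atTop_atTop
    rw [Finset.sum_const, nsmul_eq_mul] at this
    refine this.congr' ?_
    filter_upwards [eventually_gt_atTop 0] with k hk
    rw [hcount k hk, Finset.sum_div]
  · have : ∀ᶠ k : ℕ in atTop, ∀ w ∈ W, (k : ℝ) * (U (one (T0 ⁻¹' P)) w k / (k : ℝ) ^ (d + 1) - I) ≤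
        ((d + 1 : ℕ) : ℝ) / 2 * (∑ j, l j) * I - η := by
      rw [Filter.eventually_all_finset]
      exact fun w _ => tendsto_natCast_atTop_atTop.eventually (hb w)
    filter_upwards [this, eventually_gt_atTop 0] with k hk hk0
    rw [hcount k hk0]
    have e : (k : ℝ) * ((∑ w ∈ W, U (one (T0 ⁻¹' P)) w k) / (k : ℝ) ^ (d + 1) - W.card * I) =
        ∑ w ∈ W, (k : ℝ) * (U (one (T0 ⁻¹' P)) w k / (k : ℝ) ^ (d + 1) - I) := by
      rw [← Finset.mul_sum, Finset.sum_sub_distrib, Finset.sum_div, Finset.sum_const, nsmul_eq_mul]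
    rw [e]
    refine (Finset.sum_le_sum hk).trans ?_
    rw [Finset.sum_const, nsmul_eq_mul]

open scoped ComplexOrder in
/-- **Corollary ii) (roots of the Ehrhart polynomial, centred case).** If `-γ_1,…,-γ_n`
are the roots of the Ehrhart polynomial of a lattice polytope `P` with centroid at the
origin and `n ≥ 2`, then `∑ γ_i < (n/2)·∑ λ_i(P,ℤ^n)`. -/
theorem statement16 {n : ℕ} (hn : 2 ≤ n) (P : Set (Euc n))
    (hP : IsLatticePolytope P) (hint : (interior P).Nonempty)
    (hcen : CentroidAtOrigin P) (γ : Fin n → ℂ)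
    (hE : ∀ k : ℕ, 0 < k →
      (Nat.card ↥(((k : ℝ) • P) ∩ stdLattice n) : ℂ) =
        ∏ i, (1 + (k : ℂ) / γ i)) :
    (∑ i, γ i) <
      (((n : ℝ) / 2) *
        ∑ i : Fin n, succMin P (stdLattice n) ((i : ℕ) + 1) : ℝ) := by
  obtain ⟨A, _, hA⟩ := hP
  have hc : IsCompact P := by rw [hA]; exact A.finite_toSet.isCompact_convexHull (𝕜 := ℝ)
  have hv : Convex ℝ P := by rw [hA]; exact convex_convexHull ℝ _
  obtain ⟨V, c, hV, hcV, h1, h2⟩ := main_bound hn hc hv hint hcen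
  obtain ⟨s, hs, hsc⟩ := poly_lim γ hV
    (fun k => (Nat.card ↥(((k : ℝ) • P) ∩ stdLattice n) : ℝ)) (fun k hk => by rw [← hE k hk]; simp) h1 h2
  rw [hs]
  have hlt : s < (n : ℝ) / 2 * ∑ i : Fin n, succMin P (stdLattice n) ((i : ℕ) + 1) :=
    lt_of_mul_lt_mul_left (hsc.trans_lt hcV) hV.le
  exact_mod_cast hlt

end Paper
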